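/- arXiv:1504.03444 — 6 statements merged into one kernel-verified Lean document; each statement's English description precedes it below -/
import Mathlib

section
/- Fix integers n and h with 2 ≤ h ≤ n−2. There exists a constant C depending only on n such that for every finite field 𝔽_q of odd cardinality q and every monic polynomial A ∈ 𝔽_q[t] of degree n, the Möbius sum over the short interval satisfies |N_μ(A;h)| = |Σ_{f∈I(A;h)} μ(f)| ≤ C·q^{h+1}/√q. -/
open Polynomial

open scoped Classical in
/-- The Möbius function on `𝔽_q[t]`: `μ(f) = (-1)^k` if `f` is a nonzero scalar multiple of a
product of `k` distinct monic irreducibles, and `μ(f) = 0` if `f` is not squarefree. -/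
noncomputable def polyMu {Fq : Type} [Field Fq] (f : Fq[X]) : ℤ :=
  if Squarefree f then (-1) ^ (UniqueFactorizationMonoid.factors f).card else 0



theorem st_dvd {F : Type} [Field F] (f : F[X]) (c k : ℕ) :
    f ^ c ∣ f ^ k * hasseDeriv k (f ^ c) := by
  induction c generalizing k with
  | zero => simp
  | succ c ih =>
    rw [pow_succ, hasseDeriv_mul, Finset.mul_sum]
    refine Finset.dvd_sum fun ij hij => ?_
    have hk : ij.1 + ij.2 = k := by simpa using hij
    rcases Nat.eq_zero_or_pos ij.2 with h0 | h0
    · rw [h0, hasseDeriv_zero', ← mul_assoc]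
      have : ij.1 = k := by omega
      rw [this]
      exact mul_dvd_mul_right (ih k) f
    · obtain ⟨t, ht⟩ : ∃ t, ij.2 = t + 1 := ⟨ij.2 - 1, by omega⟩
      have e : f ^ k * (hasseDeriv ij.1 (f ^ c) * hasseDeriv ij.2 f) =
        (f ^ ij.1 * hasseDeriv ij.1 (f ^ c) * f) * (f ^ t * hasseDeriv ij.2 f) := by
        rw [← hk, pow_add, ht, pow_succ]; ring
      rw [e]
      exact Dvd.dvd.mul_right (mul_dvd_mul_right (ih _) f) _

theorem st_w {F : Type} [Field F] (f : F[X]) (hf : f ≠ 0) (m : ℕ) (hm : f.natDegree ≤ m) (c k : ℕ) :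
    ∃ w : F[X], f ^ k * hasseDeriv k (f ^ c) = f ^ c * w ∧ w.natDegree ≤ k * m := by
  obtain ⟨w, hw⟩ := st_dvd f c k
  refine ⟨w, hw, ?_⟩
  by_cases h0 : w = 0
  · simp [h0]
  have h1 := congrArg natDegree hw
  rw [natDegree_mul (pow_ne_zero _ hf) h0, natDegree_pow] at h1
  have h2 : (f ^ k * hasseDeriv k (f ^ c)).natDegree ≤ k * f.natDegree + c * f.natDegree := by
    refine natDegree_mul_le.trans ?_
    have := natDegree_hasseDeriv_le (f ^ c) k
    rw [natDegree_pow] at *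
    omega
  have : k * f.natDegree ≤ k * m := Nat.mul_le_mul_left _ hm
  omega

theorem st_hasse_X {F : Type} [Field F] [Fintype F] (u : F[X]) (j k : ℕ)
    (hk : k < Fintype.card F) :
    hasseDeriv k (u * X ^ (j * Fintype.card F)) = hasseDeriv k u * X ^ (j * Fintype.card F) := by
  have key : ∀ i, 0 < i → i < Fintype.card F →
      hasseDeriv i (X ^ (Fintype.card F) : F[X]) = 0 := by
    intro i hi hi2
    obtain ⟨p, hp⟩ := CharP.exists F
    obtain ⟨n, hpp, hn⟩ := FiniteField.card F p
    rw [← monomial_one_right_eq_X_pow, hasseDeriv_monomial]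
    have : p ∣ (Fintype.card F).choose i := by
      rw [hn]
      exact hpp.dvd_choose_pow (by omega) (by omega)
    rw [(CharP.cast_eq_zero_iff F p _).2 this]; simp
  induction j with
  | zero => simp
  | succ j ih =>
    rw [add_mul, pow_add, ← mul_assoc, one_mul, hasseDeriv_mul,
      Finset.sum_eq_single (k, 0)]
    · rw [ih, hasseDeriv_zero', mul_assoc]
    · intro b hb hne
      have : b.1 + b.2 = k := by simpa using hb
      have h2 : b.2 ≠ 0 := fun h => hne (Prod.ext (by simp; omega) h)
      rw [key b.2 (by omega) (by omega), mul_zero]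
    · simp

theorem st_nv {F : Type} [Field F] [Fintype F] (hodd : Odd (Fintype.card F)) (f : F[X]) (m : ℕ)
    (hm : f.natDegree ≤ m)
    (hns : ∀ e : F, e ≠ 0 → ¬ ∃ s, C e * f = s ^ 2) (h0 : f.eval 0 ≠ 0)
    (B : ℕ) (hB : 2 * B + m < Fintype.card F) (J : ℕ) :
    ∀ r s : ℕ → F[X], (∀ j, (r j).natDegree ≤ B) → (∀ j, (s j).natDegree ≤ B) →
    ∑ j ∈ Finset.range J, (r j + s j * f ^ (Fintype.card F / 2)) * X ^ (j * Fintype.card F) = 0 →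
    ∀ j < J, r j = 0 ∧ s j = 0 := by
  set q := Fintype.card F with hq
  induction J with
  | zero => intro r s _ _ _ j hj; omega
  | succ J ih =>
    intro r s hr hs h
    rw [Finset.sum_range_succ'] at h
    have e1 : ∑ j ∈ Finset.range J, (r (j+1) + s (j+1) * f ^ (q / 2)) * X ^ ((j+1) * q)
       = X ^ q * ∑ j ∈ Finset.range J, (r (j+1) + s (j+1) * f ^ (q / 2)) * X ^ (j * q) := by
      rw [Finset.mul_sum]
      refine Finset.sum_congr rfl fun j _ => ?_
      rw [add_mul j 1 q, pow_add]; ring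
    rw [e1] at h
    simp only [zero_mul, pow_zero, mul_one] at h
    have hd : X ^ q ∣ r 0 + s 0 * f ^ (q / 2) := by
      refine ⟨- ∑ j ∈ Finset.range J, (r (j+1) + s (j+1) * f ^ (q / 2)) * X ^ (j * q), ?_⟩
      linear_combination h
    have hfq : X ^ q ∣ f ^ q - C (f.eval 0) := by
      have hex : expand F q f = f ^ q := FiniteField.expand_card f
      have : X ∣ f - C (f.eval 0) := by
        rw [← sub_zero (X : F[X]), ← C_0]
        exact X_sub_C_dvd_sub_C_eval
      have := map_dvd (expand F q) this
      simpa [hex] using this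
    have hqq : q = 2 * (q / 2) + 1 := by obtain ⟨t, ht⟩ := hodd; omega
    have hd2 : X ^ q ∣ r 0 ^ 2 * f - s 0 ^ 2 * C (f.eval 0) := by
      have e : r 0 ^ 2 * f - s 0 ^ 2 * C (f.eval 0) =
        (r 0 + s 0 * f ^ (q / 2)) * ((r 0 - s 0 * f ^ (q / 2)) * f)
          + (f ^ q - C (f.eval 0)) * s 0 ^ 2 := by
        have : f ^ q = (f ^ (q/2)) ^ 2 * f := by
          conv_lhs => rw [hqq]
          ring
        rw [this]; ring
      rw [e]
      exact dvd_add (hd.mul_right _) (hfq.mul_right _)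
    have hz : r 0 ^ 2 * f - s 0 ^ 2 * C (f.eval 0) = 0 := by
      by_contra hne
      have := natDegree_le_of_dvd hd2 hne
      rw [natDegree_X_pow] at this
      have h3 : (r 0 ^ 2 * f - s 0 ^ 2 * C (f.eval 0)).natDegree ≤ 2 * B + m := by
        refine (natDegree_sub_le _ _).trans (max_le ?_ ?_)
        · refine natDegree_mul_le.trans ?_
          have := hr 0
          rw [natDegree_pow]; omega
        · refine natDegree_mul_le.trans ?_
          have := hs 0
          rw [natDegree_pow, natDegree_C]; omega
      omega
    have hr0 : r 0 = 0 := by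
      by_contra hne
      have h4 : (r 0) ^ 2 * (C (f.eval 0) * f) = (C (f.eval 0) * s 0) ^ 2 := by
        linear_combination C (f.eval 0) * hz
      have h5 : r 0 ^ 2 ∣ (C (f.eval 0) * s 0) ^ 2 := ⟨_, h4.symm⟩
      rw [IsIntegrallyClosed.pow_dvd_pow_iff two_ne_zero] at h5
      obtain ⟨t, ht⟩ := h5
      refine hns _ h0 ⟨t, ?_⟩
      rw [ht, mul_pow] at h4
      exact mul_left_cancel₀ (pow_ne_zero 2 hne) h4
    have hs0 : s 0 = 0 := by
      have : s 0 ^ 2 * C (f.eval 0) = 0 := by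
        rw [hr0] at hz; linear_combination -hz
      simpa [h0] using this
    rw [hr0, hs0] at h
    have h' : ∑ j ∈ Finset.range J, (r (j+1) + s (j+1) * f ^ (q / 2)) * X ^ (j * q) = 0 := by
      simpa using h
    have := ih (fun j => r (j+1)) (fun j => s (j+1)) (fun j => hr _) (fun j => hs _) h'
    intro j hj
    rcases j with _ | j
    · exact ⟨hr0, hs0⟩
    · exact this j (by omega)


theorem st_count {F : Type} [Field F] [Fintype F] [DecidableEq F]
    (hodd : Odd (Fintype.card F)) (f : F[X]) (m : ℕ)
    (hm : f.natDegree ≤ m)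
    (hns : ∀ e : F, e ≠ 0 → ¬ ∃ s, C e * f = s ^ 2) (h0 : f.eval 0 ≠ 0)
    (B J l : ℕ) (hB : 2 * B + m < Fintype.card F) (hl : l ≤ Fintype.card F)
    (hdim : l * (B + l * m + J) < 2 * J * (B + 1)) (a : F) (ha : a ≠ 0) :
    l * (Finset.univ.filter (fun x : F => (f.eval x) ^ (Fintype.card F / 2) = a)).card ≤
      B + (Fintype.card F / 2) * m + J * Fintype.card F := by
  set q := Fintype.card F with hq
  have hf : f ≠ 0 := by rintro rfl; simp at h0
  have hq1 : 1 < q := Fintype.one_lt_card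
  choose w hw hwd using fun k => st_w f hf m hm (q / 2) k
  let op1 : ℕ → F[X] →ₗ[F] F[X] := fun k => LinearMap.mulLeft F (f ^ k) ∘ₗ hasseDeriv k
  let op2 : ℕ → F[X] →ₗ[F] F[X] := fun k => ∑ ij ∈ Finset.HasAntidiagonal.antidiagonal k,
    LinearMap.mulLeft F (w ij.2) ∘ₗ op1 ij.1
  have hop1 : ∀ k p, p.natDegree ≤ B → (op1 k p).natDegree ≤ B + k * m := by
    intro k p hp
    simp only [op1, LinearMap.comp_apply, LinearMap.mulLeft_apply]
    refine natDegree_mul_le.trans ?_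
    have h1 := natDegree_hasseDeriv_le p k
    have h2 : (f ^ k).natDegree ≤ k * m := by
      rw [natDegree_pow]; exact Nat.mul_le_mul_left _ hm
    omega
  have hop2 : ∀ k p, p.natDegree ≤ B → (op2 k p).natDegree ≤ B + k * m := by
    intro k p hp
    simp only [op2, LinearMap.sum_apply, LinearMap.comp_apply, LinearMap.mulLeft_apply]
    refine natDegree_sum_le_of_forall_le _ _ fun ij hij => ?_
    have hk : ij.1 + ij.2 = k := by simpa using hij
    refine natDegree_mul_le.trans ?_
    have h1 := hop1 ij.1 p hp
    have h2 := hwd ij.2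
    have : k * m = ij.1 * m + ij.2 * m := by rw [← hk, add_mul]
    simp only [op1, LinearMap.comp_apply, LinearMap.mulLeft_apply] at h1 ⊢
    omega
  let V := Fin J → (degreeLT F (B + 1) × degreeLT F (B + 1))
  let pr1 : Fin J → V →ₗ[F] F[X] := fun j =>
    (degreeLT F (B+1)).subtype ∘ₗ LinearMap.fst F _ _ ∘ₗ LinearMap.proj j
  let pr2 : Fin J → V →ₗ[F] F[X] := fun j =>
    (degreeLT F (B+1)).subtype ∘ₗ LinearMap.snd F _ _ ∘ₗ LinearMap.proj j
  have hdeg : ∀ p ∈ degreeLT F (B+1), p.natDegree ≤ B := by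
    intro p hp
    rw [mem_degreeLT] at hp
    by_cases h : p = 0
    · simp [h]
    · rw [← natDegree_lt_iff_degree_lt h] at hp
      omega
  let T : ℕ → V →ₗ[F] F[X] := fun k => ∑ j : Fin J, LinearMap.mulLeft F (X ^ (j : ℕ)) ∘ₗ
    (op1 k ∘ₗ pr1 j + a • (op2 k ∘ₗ pr2 j))
  let N := B + l * m + J
  let Φ : V →ₗ[F] (Fin l → Fin N → F) :=
    LinearMap.pi fun k => LinearMap.pi fun i => lcoeff F (i : ℕ) ∘ₗ T k
  have hker : LinearMap.ker Φ ≠ ⊥ := by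
    apply LinearMap.ker_ne_bot_of_finrank_lt
    have e1 : Module.finrank F (degreeLT F (B+1)) = B + 1 := by
      rw [(degreeLTEquiv F (B+1)).finrank_eq]; simp
    have : Module.Finite F (degreeLT F (B+1)) := Module.Finite.equiv (degreeLTEquiv F (B+1)).symm
    have e2 : Module.finrank F V = J * ((B + 1) + (B + 1)) := by
      rw [Module.finrank_pi_fintype]
      simp [Module.finrank_prod, e1]
    have e3 : Module.finrank F (Fin l → Fin N → F) = l * N := by
      rw [Module.finrank_pi_fintype]
      simp
    rw [e2, e3]
    calc l * N < 2 * J * (B + 1) := hdim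
      _ = _ := by ring
  obtain ⟨v, hv, hv0⟩ := (Submodule.ne_bot_iff _).1 hker
  have hT : ∀ k < l, T k v = 0 := by
    intro k hk
    ext i
    rw [coeff_zero]
    by_cases hi : i < N
    · have := congrFun (congrFun (LinearMap.mem_ker.1 hv) ⟨k, hk⟩) ⟨i, hi⟩
      simpa [Φ] using this
    · apply coeff_eq_zero_of_natDegree_lt
      refine lt_of_le_of_lt ?_ (lt_of_lt_of_le ?_ (not_lt.1 hi)) (b := B + k * m + (J - 1))
      · simp only [T, LinearMap.sum_apply]
        refine natDegree_sum_le_of_forall_le _ _ fun j _ => ?_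
        simp only [LinearMap.comp_apply, LinearMap.mulLeft_apply, LinearMap.add_apply,
          LinearMap.smul_apply]
        refine natDegree_mul_le.trans ?_
        rw [natDegree_X_pow]
        have h1 := hop1 k (pr1 j v) (hdeg _ (v j).1.2)
        have h2 := hop2 k (pr2 j v) (hdeg _ (v j).2.2)
        have h3 := (natDegree_smul_le a (op2 k (pr2 j v))).trans h2
        have h4 := natDegree_add_le_of_degree_le h1 h3
        have := j.2
        omega
      · have : J ≠ 0 := by rintro rfl; simp at hdim
        have : k * m ≤ l * m := Nat.mul_le_mul_right _ hk.le
        simp only [N]; omega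
  let r : ℕ → F[X] := fun j => if h : j < J then pr1 ⟨j, h⟩ v else 0
  let s : ℕ → F[X] := fun j => if h : j < J then pr2 ⟨j, h⟩ v else 0
  have hr : ∀ j, (r j).natDegree ≤ B := by
    intro j
    by_cases h : j < J
    · simp only [r, h, dif_pos]; exact hdeg _ (v ⟨j, h⟩).1.2
    · simp [r, h]
  have hs : ∀ j, (s j).natDegree ≤ B := by
    intro j
    by_cases h : j < J
    · simp only [s, h, dif_pos]; exact hdeg _ (v ⟨j, h⟩).2.2
    · simp [s, h]
  have hTr : ∀ k < l, ∑ j ∈ Finset.range J, X ^ j * (op1 k (r j) + a • op2 k (s j)) = 0 := by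
    intro k hk
    rw [← hT k hk, Finset.sum_range]
    simp only [T, LinearMap.sum_apply]
    refine Finset.sum_congr rfl fun j _ => ?_
    simp [r, s]
  set P := ∑ j ∈ Finset.range J, (r j + s j * f ^ (q / 2)) * X ^ (j * q) with hP
  have hP0 : P ≠ 0 := by
    intro h
    have := st_nv hodd f m hm hns h0 B hB J r s hr hs h
    apply hv0
    funext j
    obtain ⟨h1, h2⟩ := this j j.2
    simp only [r, s, j.2, dif_pos] at h1 h2
    exact Prod.ext (Subtype.ext h1) (Subtype.ext h2)
  have hPd : P.natDegree ≤ B + (q / 2) * m + J * q := by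
    refine natDegree_sum_le_of_forall_le _ _ fun j hj => ?_
    refine natDegree_mul_le.trans ?_
    rw [natDegree_X_pow]
    have h1 : (r j + s j * f ^ (q / 2)).natDegree ≤ B + (q / 2) * m := by
      apply natDegree_add_le_of_degree_le ((hr j).trans (by omega))
      refine natDegree_mul_le.trans (add_le_add (hs j) ?_)
      rw [natDegree_pow]; exact Nat.mul_le_mul_left _ hm
    have : j * q ≤ J * q := Nat.mul_le_mul_right _ (Finset.mem_range.1 hj).le
    omega
  have hdvd : ∀ x, (f.eval x) ^ (q / 2) = a → (X - C x) ^ l ∣ P := by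
    intro x hx
    have hfx : f.eval x ≠ 0 := by
      intro h
      rw [h, zero_pow (by omega)] at hx
      exact ha hx.symm
    have hxq : x ^ q = x := FiniteField.pow_card x
    have hE : ∀ k < l, (hasseDeriv k P).eval x = 0 := by
      intro k hk
      have e1 : f ^ k * hasseDeriv k P = ∑ j ∈ Finset.range J,
          (op1 k (r j) + op2 k (s j) * f ^ (q / 2)) * X ^ (j * q) := by
        rw [hP, map_sum, Finset.mul_sum]
        refine Finset.sum_congr rfl fun j _ => ?_
        rw [st_hasse_X _ _ _ (by omega), map_add, ← mul_assoc]
        congr 1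
        rw [mul_add, hasseDeriv_mul, Finset.mul_sum]
        simp only [op1, op2, LinearMap.sum_apply, LinearMap.comp_apply, LinearMap.mulLeft_apply]
        congr 1
        rw [Finset.sum_mul]
        refine Finset.sum_congr rfl fun ij hij => ?_
        have hk : ij.1 + ij.2 = k := by simpa using hij
        rw [← hk, pow_add]
        linear_combination f ^ ij.1 * hasseDeriv ij.1 (s j) * hw ij.2
      have e2 := congrArg (eval x) e1
      have e3 := congrArg (eval x) (hTr k hk)
      rw [eval_mul, eval_pow, eval_finsetSum] at e2
      rw [eval_finsetSum] at e3
      have e4 : f.eval x ^ k * (hasseDeriv k P).eval x = 0 := by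
        rw [e2]
        rw [eval_zero] at e3
        rw [← e3]
        refine Finset.sum_congr rfl fun j _ => ?_
        simp only [eval_mul, eval_add, eval_pow, eval_X, eval_smul, hx, smul_eq_mul]
        rw [mul_comm j q, pow_mul, hxq]; ring
      exact (mul_eq_zero.1 e4).resolve_left (pow_ne_zero _ hfx)
    have hX : X ^ l ∣ taylor x P := by
      rw [X_pow_dvd_iff]
      intro d hd
      rw [taylor_coeff]; exact hE d hd
    have := map_dvd (taylorAlgHom (-x)) hX
    simpa [taylor_taylor, taylor_X_pow, sub_eq_add_neg] using this
  have hprod : ∏ x ∈ Finset.univ.filter (fun x : F => (f.eval x) ^ (q / 2) = a),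
      (X - C x) ^ l ∣ P := by
    apply Finset.prod_dvd_of_coprime
    · intro x _ y _ hxy
      exact (pairwise_coprime_X_sub_C Function.injective_id hxy).pow
    · intro x hx
      exact hdvd x (by simpa using hx)
  have := natDegree_le_of_dvd hprod hP0
  rw [natDegree_prod_of_monic _ _ (fun x _ => (monic_X_sub_C x).pow l)] at this
  simp only [natDegree_pow, natDegree_X_sub_C, mul_one, Finset.sum_const, smul_eq_mul] at this
  rw [mul_comm l]
  exact this.trans hPd


theorem st_count2 {F : Type} [Field F] [Fintype F] [DecidableEq F]
    (hodd : Odd (Fintype.card F)) (f : F[X]) (m : ℕ)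
    (hm : f.natDegree ≤ m)
    (hns : ∀ e : F, e ≠ 0 → ¬ ∃ s, C e * f = s ^ 2)
    (hq16 : 16 ≤ Fintype.card F) (hqm : 4 * m ≤ Fintype.card F) (a : F) (ha : a ≠ 0) :
    2 * ((Finset.univ.filter (fun x : F => (f.eval x) ^ (Fintype.card F / 2) = a)).card : ℝ) ≤
      Fintype.card F + (10 * m + 14) * Real.sqrt (Fintype.card F) := by
  have hf : f ≠ 0 := by
    rintro rfl
    exact hns 1 one_ne_zero ⟨0, by simp⟩
  obtain ⟨x0, hx0⟩ : ∃ x0, f.eval x0 ≠ 0 := by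
    by_contra! h
    have h1 : Fintype.card F ≤ f.natDegree := by
      have : (Finset.univ : Finset F).val ≤ f.roots := by
        rw [Multiset.le_iff_subset Finset.univ.nodup]
        intro x _
        rw [mem_roots hf]; exact h x
      have := Multiset.card_le_card this
      exact this.trans (card_roots' f)
    omega
  have hcard : (Finset.univ.filter (fun x : F => (f.eval x) ^ (Fintype.card F / 2) = a)).card =
    (Finset.univ.filter (fun x : F => ((f.comp (X + C x0)).eval x) ^ (Fintype.card F / 2) = a)).card := by
    symm
    apply Finset.card_bij (fun x _ => x + x0)
    · intro x; simp
    · intro x _ y _ h; exact add_right_cancel h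
    · intro y hy; exact ⟨y - x0, by simpa using hy, by simp⟩
  rw [hcard]
  set q := Fintype.card F with hq
  obtain ⟨l, hl⟩ : ∃ l, l = Nat.sqrt q := ⟨_, rfl⟩
  have hl1 : l * l ≤ q := hl ▸ Nat.sqrt_le q
  have hl2 : q < (l + 1) * (l + 1) := hl ▸ Nat.lt_succ_sqrt q
  have hl4 : 4 ≤ l := by
    by_contra h
    have : l + 1 ≤ 4 := by omega
    have := Nat.mul_le_mul this this
    omega
  have hl3 : 4 * l ≤ q := (Nat.mul_le_mul_right l hl4).trans hl1
  obtain ⟨J, hJ⟩ : ∃ J, J = l / 2 + 2 * m + 3 := ⟨_, rfl⟩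
  have hJ1 : l + 4 * m + 5 ≤ 2 * J := by omega
  have hJ2 : 2 * J ≤ l + 4 * m + 6 := by omega
  obtain ⟨B, hB⟩ : ∃ B, B = (q - m - 1) / 2 := ⟨_, rfl⟩
  have hB1 : 3 * q ≤ 8 * (B + 1) := by omega
  have hB2 : 2 * B + m < q := by omega
  have hdim : l * (B + l * m + J) < 2 * J * (B + 1) := by
    have a1 := Nat.mul_le_mul_right (B + 1) hJ1
    have a2 := Nat.mul_le_mul_right (4 * m + 5) hB1
    have a3 := Nat.mul_le_mul_right m hl1
    have a4 := Nat.mul_le_mul_right l hJ2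
    have a5 := Nat.mul_le_mul_right m hl3
    nlinarith
  have main := st_count hodd (f.comp (X + C x0)) m (by rw [natDegree_comp]; simpa using hm)
    (by
      rintro e he ⟨s, hs⟩
      refine hns e he ⟨s.comp (X - C x0), ?_⟩
      have := congrArg (fun p => p.comp (X - C x0)) hs
      simpa [comp_assoc] using this) (by simpa using hx0) B J l hB2 (by omega) hdim a ha
  rw [← hq] at main
  set N := (Finset.univ.filter (fun x : F => ((f.comp (X + C x0)).eval x) ^ (q / 2) = a)).card
  have m1 : 2 * (l * N) ≤ q * l + q * (5 * m + 7) := by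
    have a1 := Nat.mul_le_mul_right q hJ2
    have a2 : 2 * (q / 2) * m ≤ q * m := Nat.mul_le_mul_right m (by omega)
    nlinarith
  have hs : Real.sqrt q ≤ 2 * l := by
    rw [Real.sqrt_le_left (by positivity)]
    have : (q : ℝ) ≤ (l + 1) * (l + 1) := by exact_mod_cast hl2.le
    have h4 : (4 : ℝ) ≤ l := by exact_mod_cast hl4
    nlinarith
  have hss : Real.sqrt q * Real.sqrt q = q := Real.mul_self_sqrt (by positivity)
  have m2 : 2 * ((l : ℝ) * N) ≤ q * l + q * (5 * m + 7) := by exact_mod_cast m1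
  have hlp : (0 : ℝ) < l := by positivity
  have h0 : 0 ≤ Real.sqrt q := Real.sqrt_nonneg _
  have m3 : (q : ℝ) * (5 * m + 7) ≤ l * ((10 * m + 14) * Real.sqrt q) := by
    have : (q : ℝ) ≤ 2 * l * Real.sqrt q := by nlinarith
    have h5 : (0 : ℝ) ≤ 5 * m + 7 := by positivity
    nlinarith
  nlinarith

theorem st_weil {F : Type} [Field F] [Fintype F] [DecidableEq F]
    (hodd : Odd (Fintype.card F)) (f : F[X]) (m : ℕ)
    (hm : f.natDegree ≤ m)
    (hns : ∀ e : F, e ≠ 0 → ¬ ∃ s, C e * f = s ^ 2) :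
    |∑ x : F, ((quadraticChar F (f.eval x) : ℤ) : ℝ)| ≤
      (11 * m + 16) * Real.sqrt (Fintype.card F) := by
  have hss : Real.sqrt (Fintype.card F) * Real.sqrt (Fintype.card F) = Fintype.card F :=
    Real.mul_self_sqrt (by positivity)
  have hs1 : 1 ≤ Real.sqrt (Fintype.card F) := by
    rw [Real.one_le_sqrt]; exact_mod_cast Fintype.card_pos
  have hF : ringChar F ≠ 2 := by
    intro h
    have := FiniteField.even_card_of_char_two h
    rw [Nat.odd_iff] at hodd; omega
  have hf : f ≠ 0 := by
    rintro rfl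
    exact hns 1 one_ne_zero ⟨0, by simp⟩
  by_cases hbig : 16 ≤ Fintype.card F ∧ 4 * m ≤ Fintype.card F
  · obtain ⟨h16, h4⟩ := hbig
    have c1 := st_count2 hodd f m hm hns h16 h4 1 one_ne_zero
    have c2 := st_count2 hodd f m hm hns h16 h4 (-1) (by simp)
    set S1 := (Finset.univ.filter (fun x : F => (f.eval x) ^ (Fintype.card F / 2) = 1))
    set S2 := (Finset.univ.filter (fun x : F => (f.eval x) ^ (Fintype.card F / 2) = -1))
    set S0 := (Finset.univ.filter (fun x : F => f.eval x = 0))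
    have hS0 : S0.card ≤ m := by
      refine le_trans ?_ ((card_roots' f).trans hm)
      have : S0.val ≤ f.roots := by
        rw [Multiset.le_iff_subset S0.nodup]
        intro x hx
        rw [mem_roots hf]; simpa [S0] using hx
      exact Multiset.card_le_card this
    have hne : (1 : F) ≠ -1 := by
      intro h; exact (Ring.neg_one_ne_one_of_char_ne_two hF) h.symm
    have hpt : ∀ x : F, ((quadraticChar F (f.eval x) : ℤ) : ℝ) =
        (if x ∈ S1 then 1 else 0) - (if x ∈ S2 then 1 else 0) ∧
        (1 : ℝ) = (if x ∈ S1 then 1 else 0) + (if x ∈ S2 then 1 else 0) + (if x ∈ S0 then 1 else 0) := by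
      intro x
      by_cases hx : f.eval x = 0
      · have : Fintype.card F / 2 ≠ 0 := by omega
        simp [S1, S2, S0, hx, this]
      · rcases FiniteField.pow_dichotomy hF hx with h | h
        · have : quadraticChar F (f.eval x) = 1 := by
            rw [quadraticChar_one_iff_isSquare hx, FiniteField.isSquare_iff hF hx]; exact h
          simp [S1, S2, S0, hx, h, this, hne]
        · have : quadraticChar F (f.eval x) = -1 := by
            rw [quadraticChar_neg_one_iff_not_isSquare, FiniteField.isSquare_iff hF hx, h]
            exact hne.symm
          simp [S1, S2, S0, hx, h, this, hne.symm]
    have e1 : ∑ x : F, ((quadraticChar F (f.eval x) : ℤ) : ℝ) = S1.card - S2.card := by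
      rw [Finset.sum_congr rfl fun x _ => (hpt x).1, Finset.sum_sub_distrib]
      simp
    have e2 : (Fintype.card F : ℝ) = S1.card + S2.card + S0.card := by
      have : (Fintype.card F : ℝ) = ∑ x : F, (1 : ℝ) := by simp
      rw [this, Finset.sum_congr rfl fun x _ => (hpt x).2, Finset.sum_add_distrib,
        Finset.sum_add_distrib]
      simp
    have hS0' : (S0.card : ℝ) ≤ m := by exact_mod_cast hS0
    have hm0 : (0 : ℝ) ≤ m := by positivity
    rw [e1, abs_le]
    constructor <;> nlinarith
  · have htriv : |∑ x : F, ((quadraticChar F (f.eval x) : ℤ) : ℝ)| ≤ Fintype.card F := by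
      refine (Finset.abs_sum_le_sum_abs _ _).trans ?_
      have : ∀ x ∈ (Finset.univ : Finset F), |((quadraticChar F (f.eval x) : ℤ) : ℝ)| ≤ 1 := by
        intro x _
        by_cases hx : f.eval x = 0
        · simp [hx]
        · rcases quadraticChar_dichotomy hx with h | h <;> simp [h]
      refine (Finset.sum_le_sum this).trans ?_
      simp
    have hsm : (Fintype.card F : ℝ) ≤ 16 + 4 * m := by
      have : Fintype.card F ≤ 16 + 4 * m := by omega
      exact_mod_cast this
    have hm0 : (0 : ℝ) ≤ m := by positivity
    refine htriv.trans ?_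
    nlinarith



theorem pl_prod {L : Type} [Field L] {d : ℕ} (v : Fin d → L) :
    ∏ i, eval (v i) (derivative (∏ j, (X - C (v j)))) =
      (-1) ^ (d * (d - 1) / 2) * (Matrix.vandermonde v).det ^ 2 := by
  have h1 : ∀ i, eval (v i) (derivative (∏ j, (X - C (v j)))) =
      ∏ j ∈ ({i} : Finset (Fin d))ᶜ, (v i - v j) := by
    intro i
    have := Lagrange.eval_nodal_derivative_eval_node_eq (s := Finset.univ) (v := v)
      (Finset.mem_univ i)
    rw [Lagrange.nodal] at this
    rw [this, Lagrange.eval_nodal]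
    congr 1
    ext; simp
  simp_rw [h1]
  rw [← Finset.prod_prod_Ioi_mul_eq_prod_prod_off_diag (fun j i => v i - v j),
    Matrix.det_vandermonde]
  have h2 : ∀ i j, (v i - v j) * (v j - v i) = (-1) * (v j - v i) ^ 2 := by intros; ring
  simp_rw [h2, Finset.prod_mul_distrib, Finset.prod_pow, Finset.prod_const]
  congr 1
  rw [Finset.prod_pow_eq_pow_sum]
  congr 1
  simp_rw [Fin.card_Ioi]
  rw [Fin.sum_univ_eq_sum_range (fun i => d - 1 - i), Finset.sum_range_reflect (fun i => i) d,
    Finset.sum_range_id]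

theorem pl_irred {F : Type} [Field F] [Fintype F] [DecidableEq F]
    (hodd : Odd (Fintype.card F)) (g : F[X]) (hg : g.Monic) (hirr : Irreducible g) :
    quadraticChar F (resultant g (derivative g) g.natDegree g.natDegree) =
      quadraticChar F (-1) ^ (g.natDegree * (g.natDegree - 1) / 2) * (-1) ^ (g.natDegree - 1) := by
  have hF : ringChar F ≠ 2 := by
    intro h
    have := FiniteField.even_card_of_char_two h
    rw [Nat.odd_iff] at hodd; omega
  have : Fact (Irreducible g) := ⟨hirr⟩
  let L := AdjoinRoot g
  let pb := AdjoinRoot.powerBasis hirr.ne_zero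
  have : FiniteDimensional F L := PowerBasis.finite pb
  have : Finite L := Module.finite_of_finite F
  have hd : Module.finrank F L = g.natDegree := by
    rw [PowerBasis.finrank pb]; simp [pb]
  let φ := FiniteField.frobeniusAlgHom F L
  obtain ⟨k, hk⟩ : ∃ k, g.natDegree = k + 1 := ⟨g.natDegree - 1, by
    have := hirr.natDegree_pos; omega⟩
  let α : L := AdjoinRoot.root g
  let v : Fin (k + 1) → L := fun i => (φ ^ (i : ℕ)) α
  have hvinj : Function.Injective v := by
    intro i j hij
    have h1 : φ ^ (i : ℕ) = φ ^ (j : ℕ) := AdjoinRoot.algHom_ext hij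
    have hb := (FiniteField.bijective_frobeniusAlgHom_pow F L).1
    have e : Module.finrank F L = k + 1 := hd.trans hk
    have := @hb ⟨i, by omega⟩ ⟨j, by omega⟩ h1
    simp at this
    exact Fin.ext this
  have hφ : φ ^ (k + 1) = 1 := by
    rw [← hk, ← hd, ← FiniteField.orderOf_frobeniusAlgHom F L]
    exact pow_orderOf_eq_one _
  have hroot : ∀ i, (g.map (algebraMap F L)).eval (v i) = 0 := by
    intro i
    rw [eval_map_algebraMap]
    have : aeval α g = 0 := by
      have := AdjoinRoot.eval₂_root g
      rwa [aeval_def]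
    simp only [v]
    rw [aeval_algHom_apply, this, map_zero]
  have hmon : (g.map (algebraMap F L)).Monic := hg.map _
  have hprod : ∏ j, (X - C (v j)) = g.map (algebraMap F L) := by
    symm
    apply eq_of_monic_of_dvd_of_natDegree_le (monic_prod_X_sub_C v _) hmon
    · apply Finset.prod_dvd_of_coprime
      · intro x _ y _ hxy
        exact pairwise_coprime_X_sub_C hvinj hxy
      · intro x _
        exact dvd_iff_isRoot.2 (hroot x)
    · rw [natDegree_map, natDegree_prod_of_monic _ _ (fun x _ => (monic_X_sub_C _))]
      simp [hk]
  have hroots : (g.map (algebraMap F L)).roots = Finset.univ.val.map v := by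
    rw [← hprod, Finset.prod_eq_multiset_prod, 
      ← roots_multiset_prod_X_sub_C (Finset.univ.val.map v), Multiset.map_map]
    rfl
  have hsplit : (g.map (algebraMap F L)).Splits := by
    rw [← hprod]; exact Splits.prod fun i _ => Splits.X_sub_C _
  set δ := (Matrix.vandermonde v).det with hδ
  have hδ0 : δ ≠ 0 := Matrix.det_vandermonde_ne_zero_iff.2 hvinj
  set R := resultant g (derivative g) g.natDegree g.natDegree with hR
  have hRL : algebraMap F L R = (-1) ^ (g.natDegree * (g.natDegree - 1) / 2) * δ ^ 2 := by
    rw [hR, ← resultant_map_map]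
    have h1 := resultant_eq_prod_eval (g.map (algebraMap F L)) ((derivative g).map (algebraMap F L))
      g.natDegree (natDegree_map_le.trans ((natDegree_derivative_le g).trans (by omega))) hsplit
    rw [natDegree_map] at h1
    rw [h1, hmon.leadingCoeff, one_pow, one_mul, hroots, Multiset.map_map, hk, ← pl_prod v, hprod,
      derivative_map]
    rfl
  have hδq : δ ^ Fintype.card F = (-1) ^ k * δ := by
    have h1 : δ ^ Fintype.card F = φ δ := rfl
    have h2 : φ δ = (Matrix.vandermonde (fun i => φ (v i))).det := by
      rw [hδ, AlgHom.map_det]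
      congr 1
      ext i j
      simp [Matrix.vandermonde_apply]
    have h3 : (fun i => φ (v i)) = fun i => v (finRotate (k+1) i) := by
      funext i
      have : φ (v i) = (φ ^ ((i : ℕ) + 1)) α := by
        simp only [v]; rw [pow_succ']; rfl
      rw [this]
      rcases lt_or_ge (i : ℕ) k with h | h
      · simp only [v]
        rw [finRotate_of_lt h]
      · have hi : i = Fin.last k := Fin.ext (by have := i.2; simp; omega)
        rw [hi, finRotate_last]
        simp [v, hφ]
    have h4 : Matrix.vandermonde (fun i => v (finRotate (k+1) i)) =
      (Matrix.vandermonde v).submatrix (finRotate (k+1)) id := rfl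
    rw [h1, h2, h3, h4, Matrix.det_permute, sign_finRotate]
    simp
    exact hδ.symm
  have hδq1 : δ ^ (2 * (Fintype.card F / 2)) = (-1) ^ k := by
    have h1 : Fintype.card F = 2 * (Fintype.card F / 2) + 1 := by
      obtain ⟨t, ht⟩ := hodd; omega
    rw [h1, pow_succ] at hδq
    have h2 := mul_right_cancel₀ hδ0 hδq
    rw [h1]; exact h2 ▸ (by congr 2; omega)
  set e := g.natDegree * (g.natDegree - 1) / 2
  set x := (-1) ^ e * R with hx
  have hee : ((-1 : L)) ^ e * (-1) ^ e = 1 := by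
    rw [← mul_pow, neg_mul_neg, one_mul, one_pow]
  have hxL : algebraMap F L x = δ ^ 2 := by
    rw [hx, map_mul, hRL, map_pow, map_neg, map_one, ← mul_assoc, hee, one_mul]
  have hx0 : x ≠ 0 := by
    intro h; rw [h, map_zero] at hxL; exact hδ0 (by simpa using hxL.symm)
  have hL2 : (1 : L) ≠ -1 := by
    intro h
    have : algebraMap F L 1 = algebraMap F L (-1) := by simpa using h
    have := (algebraMap F L).injective this
    exact Ring.neg_one_ne_one_of_char_ne_two hF this.symm
  have hchi : quadraticChar F x = (-1) ^ k := by
    have h1 := quadraticChar_eq_pow_of_char_ne_two' hF x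
    have h2 := congrArg (algebraMap F L) h1
    rw [map_pow, hxL, ← pow_mul, hδq1] at h2
    rcases quadraticChar_dichotomy hx0 with h | h <;> rcases neg_one_pow_eq_or ℤ k with h' | h' <;>
      rcases neg_one_pow_eq_or L k with h'' | h''
    all_goals
      have h3 : (((-1 : ℤ) ^ k : ℤ) : L) = (-1) ^ k := by simp
      rw [h', h''] at h3
      rw [h, h''] at h2
      rw [h, h']
      try rfl
      try (simp at h2 h3; first | exact absurd h2 hL2 | exact absurd h2.symm hL2 | exact absurd h3 hL2 | exact absurd h3.symm hL2 )
  have hR' : R = (-1) ^ e * x := by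
    rw [hx, ← mul_assoc, ← mul_pow]; simp
  rw [hR', map_mul, map_pow, hchi, hk]; simp


theorem pl_resN {F : Type} [Field F] (f g : F[X]) (hf : f.Monic) (n : ℕ) (hn : g.natDegree ≤ n) :
    resultant f g f.natDegree n = resultant f g := by
  obtain ⟨k, rfl⟩ := Nat.exists_eq_add_of_le hn
  rw [resultant_add_right_deg _ _ _ _ k le_rfl, coeff_natDegree, hf.leadingCoeff, one_pow, one_mul]

theorem pl_resmul {F : Type} [Field F] (g h : F[X]) (hg : g.Monic) (hh : h.Monic) :
    resultant (g * h) (derivative (g * h)) (g * h).natDegree (g * h).natDegree =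
    resultant g (derivative g) g.natDegree g.natDegree *
    resultant h (derivative h) h.natDegree h.natDegree *
      ((-1) ^ (g.natDegree * h.natDegree) * resultant h g ^ 2) := by
  have hd1 := natDegree_derivative_le g
  have hd2 := natDegree_derivative_le h
  have hle : (derivative (g * h)).natDegree ≤ g.natDegree + h.natDegree := by
    refine (natDegree_derivative_le _).trans ?_
    have := natDegree_mul_le (p := g) (q := h)
    omega
  have aux : ∀ u w : F[X], u.Monic → resultant u (w) u.natDegree w.natDegree = resultant u w := fun _ _ _ => rfl
  have key : ∀ u w : F[X], u.Monic → w.Monic → resultant u (derivative u * w + u * derivative w)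
      u.natDegree (u.natDegree + w.natDegree) = resultant u (derivative u) * resultant u w := by
    intro u w hu hw
    have e1 := natDegree_derivative_le u
    have e2 := natDegree_derivative_le w
    have hl : (derivative u * w).natDegree ≤ u.natDegree + w.natDegree := by
      have := natDegree_mul_le (p := derivative u) (q := w)
      omega
    have h3 := resultant_mul_right u (derivative u) w u.natDegree le_rfl
    rw [pl_resN u _ hu _ natDegree_mul_le] at h3
    rw [resultant_add_mul_right _ _ _ _ _ (by omega) le_rfl, pl_resN u _ hu _ hl, h3]
  rw [hg.natDegree_mul hh, resultant_mul_left _ _ _ _ hle, derivative_mul]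
  rw [key g h hg hh]
  rw [show derivative g * h + g * derivative h = derivative h * g + h * derivative g by ring,
    add_comm g.natDegree h.natDegree, key h g hh hg, resultant_comm g h,
    pl_resN g (derivative g) hg g.natDegree (by omega),
    pl_resN h (derivative h) hh h.natDegree (by omega)]
  ring

theorem pl_sqfree {F : Type} [Field F] [Fintype F] [DecidableEq F]
    (hodd : Odd (Fintype.card F)) (N : ℕ) : ∀ f : F[X], f.Monic → Squarefree f → f.natDegree = N →
    quadraticChar F (resultant f (derivative f) f.natDegree f.natDegree) =
      quadraticChar F (-1) ^ (f.natDegree * (f.natDegree - 1) / 2) *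
        (-1) ^ (f.natDegree + (UniqueFactorizationMonoid.factors f).card) := by
  induction N using Nat.strong_induction_on with
  | _ N ih =>
    intro f hf hsf hN
    by_cases h0 : f.natDegree = 0
    · obtain rfl := hf.natDegree_eq_zero.1 h0
      simp
    · have hnu : ¬ IsUnit f := by
        intro h; exact h0 (natDegree_eq_zero_of_isUnit h)
      obtain ⟨g, hg, hirr, h, rfl⟩ := Polynomial.exists_monic_irreducible_factor f hnu
      have hh : h.Monic := Monic.of_mul_monic_left hg hf
      have hgp := hirr.natDegree_pos
      have hnd := hg.natDegree_mul hh
      have hsh : Squarefree h := hsf.squarefree_of_dvd (dvd_mul_left _ _)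
      have hcop : IsCoprime h g := by
        have := (squarefree_mul_iff.1 hsf).1
        exact this.isCoprime.symm
      have hres : resultant h g ≠ 0 := resultant_ne_zero _ _ hcop
      have i1 := pl_irred hodd g hg hirr
      have i2 := ih h.natDegree (by omega) h hh hsh rfl
      have hcard : (UniqueFactorizationMonoid.factors (g * h)).card =
          1 + (UniqueFactorizationMonoid.factors h).card := by
        have := Multiset.card_eq_card_of_rel (UniqueFactorizationMonoid.factors_mul hg.ne_zero hh.ne_zero)
        rw [this, Multiset.card_add]
        rw [UniqueFactorizationMonoid.card_factors_of_irreducible hirr]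
      rw [pl_resmul g h hg hh, map_mul, map_mul, i1, i2, map_mul, map_pow, map_pow, hcard, hnd,
        quadraticChar_sq_one hres]
      obtain ⟨a, ha⟩ : ∃ a, g.natDegree = a + 1 := ⟨g.natDegree - 1, by omega⟩
      have hexp : (g.natDegree + h.natDegree) * (g.natDegree + h.natDegree - 1) / 2 =
        g.natDegree * (g.natDegree - 1) / 2 + h.natDegree * (h.natDegree - 1) / 2 +
          g.natDegree * h.natDegree := by
        rw [← Nat.choose_two_right, ← Nat.choose_two_right, ← Nat.choose_two_right,
          Nat.add_choose_eq]
        rw [show Finset.HasAntidiagonal.antidiagonal 2 = {(0,2),(1,1),(2,0)} from rfl]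
        simp
        ring
      rw [hexp, pow_add _ (_ + _), pow_add _ (_ / 2), ha]
      have : ((-1 : ℤ)) ^ (a + 1 + h.natDegree + (1 + (UniqueFactorizationMonoid.factors h).card)) =
        (-1) ^ a * (-1) ^ (h.natDegree + (UniqueFactorizationMonoid.factors h).card) := by ring
      rw [this]
      simp only [Nat.add_sub_cancel]
      ring

theorem pl_main {F : Type} [Field F] [Fintype F] [DecidableEq F]
    (hodd : Odd (Fintype.card F)) (f : F[X]) (hf : f.Monic) :
    quadraticChar F (resultant f (derivative f) f.natDegree f.natDegree) =
      (quadraticChar F (-1) ^ (f.natDegree * (f.natDegree - 1) / 2) *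
        (-1) ^ f.natDegree) * polyMu f := by
  by_cases hs : Squarefree f
  · rw [polyMu, if_pos hs, pl_sqfree hodd _ f hf hs rfl, pow_add]; ring
  · rw [polyMu, if_neg hs, mul_zero]
    rw [pl_resN _ _ hf _ ((natDegree_derivative_le f).trans (by omega)), quadraticChar_eq_zero_iff,
      resultant_eq_zero_iff]
    refine ⟨Or.inl hf.ne_zero, fun h => hs ?_⟩
    exact Separable.squarefree h


noncomputable def dpoly {F : Type} [Field F] (P : F[X]) : F[X] :=
  resultant (P.map C + C X) ((derivative P).map C) P.natDegree P.natDegree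

theorem dp_eval {F : Type} [Field F] (P : F[X]) (b : F) :
    (dpoly P).eval b = resultant (P + C b) (derivative P) P.natDegree P.natDegree := by
  rw [dpoly, ← coe_evalRingHom, ← resultant_map_map]
  congr 1
  · rw [Polynomial.map_add, map_map, map_C]
    congr 1
    · rw [show (evalRingHom b).comp C = RingHom.id F by ext x; simp, Polynomial.map_id]
    · simp
  · rw [map_map]
    rw [show (evalRingHom b).comp C = RingHom.id F by ext x; simp, Polynomial.map_id]

theorem dp_map {F : Type} [Field F] (P : F[X]) (hP : P.Monic) (h1 : 1 ≤ P.natDegree)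
    (hg : derivative P ≠ 0) :
    ∃ u : AlgebraicClosure F, u ≠ 0 ∧ (dpoly P).map (algebraMap F (AlgebraicClosure F)) =
      C u * (((derivative P).map (algebraMap F (AlgebraicClosure F))).roots.map
        (fun r => X - C (- (P.map (algebraMap F (AlgebraicClosure F))).eval r))).prod := by
  set K := AlgebraicClosure F
  set i := algebraMap F K
  set PK := P.map i with hPK
  set gK := (derivative P).map i with hgK
  have hPm : PK.Monic := hP.map i
  have hPd : PK.natDegree = P.natDegree := by simp [hPK]
  have hg0 : gK ≠ 0 := by rw [hgK]; exact (Polynomial.map_ne_zero_iff (algebraMap F K).injective).2 hg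
  have e1 : (dpoly P).map i = resultant (PK.map C + C X) (gK.map C) P.natDegree P.natDegree := by
    rw [dpoly, ← coe_mapRingHom, ← resultant_map_map]
    congr 1
    · rw [Polynomial.map_add, map_map, map_C, hPK, map_map]
      congr 1
      · congr 1
        ext x; simp
      · simp
    · rw [map_map, hgK, map_map]
      congr 1
      ext x; simp
  have hd : (gK.map (C : K →+* K[X])).natDegree = (derivative P).natDegree := by
    rw [natDegree_map_eq_of_injective C_injective, hgK, natDegree_map]
  have hle : (derivative P).natDegree ≤ P.natDegree := (natDegree_derivative_le P).trans (by omega)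
  obtain ⟨k, hk⟩ := Nat.exists_eq_add_of_le hle
  have hsp : gK.Splits := IsAlgClosed.splits gK
  have hc : (PK.map C + C X : K[X][X]).coeff P.natDegree = 1 := by
    rw [coeff_add, coeff_map, coeff_C_of_ne_zero (by omega), ← hPd, coeff_natDegree, hPm.leadingCoeff]
    simp
  have hnd : (PK.map C + C X : K[X][X]).natDegree ≤ P.natDegree := by
    refine natDegree_add_le_of_degree_le ?_ (by simp)
    rw [natDegree_map_eq_of_injective C_injective, hPd]
  have e2 : resultant (gK.map C) (PK.map C + C X) P.natDegree P.natDegree =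
    (-1) ^ (P.natDegree * k) * resultant (gK.map C) (PK.map C + C X) (gK.map (C : K →+* K[X])).natDegree P.natDegree := by
    conv_lhs => rw [show resultant (gK.map C) (PK.map C + C X) P.natDegree P.natDegree =
       resultant (gK.map C) (PK.map C + C X) ((gK.map (C : K →+* K[X])).natDegree + k) P.natDegree by rw [hd, ← hk]]
    rw [resultant_add_left_deg _ _ _ _ _ le_rfl, hc, one_pow, mul_one]
  rw [e1, resultant_comm, e2, resultant_eq_prod_eval _ _ _ hnd (hsp.map _), hsp.roots_map_of_injective C_injective, Multiset.map_map]
  refine ⟨(-1) ^ (P.natDegree * P.natDegree) * ((-1) ^ (P.natDegree * k) * gK.leadingCoeff ^ P.natDegree), ?_, ?_⟩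
  · refine mul_ne_zero (by simp) (mul_ne_zero (by simp) (pow_ne_zero _ (leadingCoeff_ne_zero.2 hg0)))
  · rw [leadingCoeff_map_of_injective C_injective]
    simp only [map_mul, map_pow, map_neg, map_one, mul_assoc]
    congr 4
    refine Multiset.map_congr rfl fun x _ => ?_
    simp [eval_map, eval₂_at_apply, add_comm]

theorem dp_natDegree {F : Type} [Field F] (P : F[X]) (hP : P.Monic) (h1 : 1 ≤ P.natDegree)
    (hg : derivative P ≠ 0) : (dpoly P).natDegree = (derivative P).natDegree := by
  obtain ⟨u, hu, h⟩ := dp_map P hP h1 hg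
  have := congrArg natDegree h
  rw [natDegree_map, natDegree_C_mul hu, show (fun r => X - C (-eval r (map (algebraMap F (AlgebraicClosure F)) P))) =
      (fun x => X - C x) ∘ (fun r => -eval r (map (algebraMap F (AlgebraicClosure F)) P)) from rfl,
    ← Multiset.map_map, natDegree_multiset_prod_X_sub_C_eq_card, Multiset.card_map,
    ← (IsAlgClosed.splits _).natDegree_eq_card_roots, natDegree_map] at this
  exact this

theorem dp_bound {F : Type} [Field F] [Fintype F] [DecidableEq F] (hodd : Odd (Fintype.card F))
    (P : F[X]) (hP : P.Monic) (n : ℕ) (hn : P.natDegree = n) (hn1 : 1 ≤ n)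
    (hg : 0 < (derivative P).natDegree) (hsep : (derivative P).Separable)
    (hinj : ∀ x y : AlgebraicClosure F, aeval x (derivative P) = 0 → aeval y (derivative P) = 0 →
      aeval x P = aeval y P → x = y) :
    |∑ b : F, (polyMu (P + C b) : ℝ)| ≤ (11 * n + 16) * Real.sqrt (Fintype.card F) := by
  have hg0 : derivative P ≠ 0 := by rintro h; rw [h] at hg; simp at hg
  have hns : ∀ e : F, e ≠ 0 → ¬ ∃ s, C e * dpoly P = s ^ 2 := by
    rintro e he ⟨s, hs⟩
    obtain ⟨u, hu, h⟩ := dp_map P hP (by omega) hg0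
    have h2 := congrArg (Polynomial.map (algebraMap F (AlgebraicClosure F))) hs
    rw [Polynomial.map_mul, h, Polynomial.map_pow, map_C] at h2
    have hsd := congrArg natDegree hs
    rw [natDegree_C_mul he, dp_natDegree P hP (by omega) hg0, natDegree_pow] at hsd
    set gK := (derivative P).map (algebraMap F (AlgebraicClosure F)) with hgK
    have hgs : gK.Separable := hsep.map
    have hgK0 : gK ≠ 0 := hgs.ne_zero
    have hnod := nodup_roots hgs
    classical
    have hprod : (gK.roots.map (fun r => X - C (- (P.map (algebraMap F (AlgebraicClosure F))).eval r))).prod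
        = ∏ r ∈ gK.roots.toFinset, (X - C (- (P.map (algebraMap F (AlgebraicClosure F))).eval r)) := by
      rw [Finset.prod, Multiset.toFinset_val, hnod.dedup]
    have hsq : Squarefree (∏ r ∈ gK.roots.toFinset,
        (X - C (- (P.map (algebraMap F (AlgebraicClosure F))).eval r))) := by
      apply Separable.squarefree
      rw [separable_prod_X_sub_C_iff']
      intro x hx y hy hxy
      rw [Multiset.mem_toFinset, mem_roots hgK0, IsRoot, hgK, eval_map_algebraMap] at hx hy
      rw [neg_inj, eval_map_algebraMap, eval_map_algebraMap] at hxy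
      exact hinj x y hx hy hxy
    rw [hprod, ← mul_assoc, ← C_mul] at h2
    have hne : algebraMap F (AlgebraicClosure F) e * u ≠ 0 := mul_ne_zero (by simpa using he) hu
    have hun := hsq (s.map (algebraMap F (AlgebraicClosure F))) ⟨C (algebraMap F (AlgebraicClosure F) e * u)⁻¹, by
      rw [← pow_two, ← h2, mul_right_comm, ← C_mul, mul_inv_cancel₀ hne, C_1, one_mul]⟩
    have := natDegree_eq_zero_of_isUnit hun
    rw [natDegree_map] at this
    omega
  have hd : (dpoly P).natDegree ≤ n := by
    rw [dp_natDegree P hP (by omega) hg0]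
    have := natDegree_derivative_le P
    omega
  have hw := st_weil hodd (dpoly P) n hd hns
  set ε : ℤ := quadraticChar F (-1) ^ (n * (n - 1) / 2) * (-1) ^ n with hε
  have hε1 : |(ε : ℝ)| = 1 := by
    have : |ε| = 1 := by
      rw [hε, abs_mul, abs_pow, abs_pow]
      rcases quadraticChar_dichotomy (F := F) (a := -1) (by simp) with h | h <;> rw [h] <;> simp
    exact_mod_cast this
  have hb : ∀ b : F, quadraticChar F ((dpoly P).eval b) = ε * polyMu (P + C b) := by
    intro b
    have hm : (P + C b).Monic := hP.add_of_left (by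
      rw [degree_eq_natDegree hP.ne_zero]
      exact lt_of_le_of_lt degree_C_le (by exact_mod_cast (by omega : 0 < P.natDegree)))
    have hN : (P + C b).natDegree = n := by rw [natDegree_add_C, hn]
    have := pl_main hodd _ hm
    rw [hN] at this
    rw [← this, dp_eval, hn, derivative_add, derivative_C, add_zero]
  have : (∑ x : F, ((quadraticChar F ((dpoly P).eval x) : ℤ) : ℝ)) = ε * ∑ b : F, (polyMu (P + C b) : ℝ) := by
    rw [Finset.mul_sum]
    refine Finset.sum_congr rfl fun x _ => ?_
    rw [hb x]; push_cast; rfl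
  rw [this, abs_mul, hε1, one_mul] at hw
  exact hw


theorem bd_sub {R : Type} [CommRing R] {d : ℕ} {f g : R[X]} (hf : f.natDegree ≤ d) (hg : g.natDegree ≤ d) :
    (f - g).natDegree ≤ d := (natDegree_sub_le_of_le hf hg).trans (by simp)

/-- bounded inner degree -/
def bdg {F : Type} [Field F] (d : ℕ) (f : F[X][X]) : Prop := ∀ j, (f.coeff j).natDegree ≤ d

theorem bdg_add {F : Type} [Field F] {d : ℕ} {f g : F[X][X]} (hf : bdg d f) (hg : bdg d g) :
    bdg d (f + g) := fun j => by
  rw [coeff_add]; exact natDegree_add_le_of_degree_le (hf j) (hg j)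

theorem bdg_sub {F : Type} [Field F] {d : ℕ} {f g : F[X][X]} (hf : bdg d f) (hg : bdg d g) :
    bdg d (f - g) := fun j => by
  rw [coeff_sub]; exact bd_sub (hf j) (hg j)

theorem bdg_sum {F : Type} [Field F] {d : ℕ} {ι : Type} (s : Finset ι) (f : ι → F[X][X])
    (hf : ∀ i ∈ s, bdg d (f i)) : bdg d (∑ i ∈ s, f i) := fun j => by
  rw [finsetSum_coeff]
  exact natDegree_sum_le_of_forall_le _ _ (fun i hi => hf i hi j)

theorem bdg_mul {F : Type} [Field F] {d : ℕ} (p f : F[X]) (hp : p.natDegree ≤ d) :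
    bdg d (C p * f.map C) := fun j => by
  rw [coeff_C_mul, coeff_map]
  refine natDegree_mul_le.trans ?_
  simpa using hp

theorem bdg_res {F : Type} [Field F] {d : ℕ} (f g : F[X][X]) (m n : ℕ) (hf : bdg d f) (hg : bdg d g) :
    (resultant f g m n).natDegree ≤ (m + n) * d := by
  rw [resultant, Matrix.det_apply]
  refine natDegree_sum_le_of_forall_le _ _ fun σ _ => ?_
  refine (natDegree_smul_le _ _).trans ?_
  refine (natDegree_prod_le _ _).trans ?_
  refine (Finset.sum_le_card_nsmul _ _ d fun i _ => ?_).trans (by simp)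
  generalize σ i = a
  induction i using Fin.addCases with
  | left i =>
    simp only [sylvester, Matrix.of_apply, Fin.addCases_left]
    split_ifs
    · apply hg
    · simp
  | right i =>
    simp only [sylvester, Matrix.of_apply, Fin.addCases_right]
    split_ifs
    · apply hf
    · simp

noncomputable def bdV {F : Type} [Field F] (g : F[X]) : F[X][X] :=
  ∑ k ∈ Finset.range (g.natDegree + 1), ∑ i ∈ Finset.range k,
    C (C (g.coeff k) * X ^ i) * (X ^ (k - 1 - i) : F[X]).map C

noncomputable def bdW {F : Type} [Field F] (G : F[X]) : F[X][X] :=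
  C (2 * G - X * derivative G) * (1 : F[X]).map C + C (derivative G) * (X : F[X]).map C
    - C 1 * (2 * G - X * derivative G).map C - C X * (derivative G).map C

noncomputable def bdev {F K : Type} [Field F] [Field K] [Algebra F K] (x y : K) : F[X][X] →+* K :=
  eval₂RingHom (aeval x : F[X] →ₐ[F] K).toRingHom y

theorem bdev_C {F K : Type} [Field F] [Field K] [Algebra F K] (x y : K) (p : F[X]) :
    bdev x y (C p) = aeval x p := by simp [bdev]

theorem bdev_map {F K : Type} [Field F] [Field K] [Algebra F K] (x y : K) (p : F[X]) :
    bdev x y (p.map C) = aeval y p := by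
  simp only [bdev, coe_eval₂RingHom, eval₂_map, aeval_def]
  congr 1
  ext a
  simp

theorem bdW_ev {F K : Type} [Field F] [Field K] [Algebra F K] (x y : K) (G : F[X]) :
    bdev x y (bdW G) = 2 * (aeval x G - aeval y G) -
      (x - y) * (aeval x (derivative G) + aeval y (derivative G)) := by
  rw [bdW]
  simp only [map_add, map_sub, map_mul, bdev_C, bdev_map]
  simp only [map_one, map_ofNat, aeval_X]
  ring

theorem bdV_ev {F K : Type} [Field F] [Field K] [Algebra F K] (x y : K) (g : F[X]) :
    bdev x y (bdV g) * (x - y) = aeval x g - aeval y g := by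
  rw [bdV]
  simp only [map_sum, map_mul, bdev_C, bdev_map]
  rw [aeval_eq_sum_range, aeval_eq_sum_range, ← Finset.sum_sub_distrib, Finset.sum_mul]
  refine Finset.sum_congr rfl fun k _ => ?_
  rw [← smul_sub, ← (Commute.all x y).geom_sum₂_mul, Finset.sum_mul, Finset.sum_mul, Finset.smul_sum]
  refine Finset.sum_congr rfl fun i _ => ?_
  simp [Algebra.smul_def, mul_assoc]

theorem bdV_ev_diag {F K : Type} [Field F] [Field K] [Algebra F K] (x : K) (g : F[X]) :
    bdev x x (bdV g) = aeval x (derivative g) := by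
  rw [bdV]
  simp only [map_sum, map_mul, bdev_C, bdev_map]
  conv_rhs => rw [g.as_sum_range]
  rw [derivative_sum, map_sum]
  refine Finset.sum_congr rfl fun k _ => ?_
  rw [derivative_monomial, aeval_monomial]
  have : ∀ i ∈ Finset.range k, (aeval x (C (g.coeff k)) * aeval x (X ^ i : F[X])) * aeval x (X ^ (k - 1 - i) : F[X])
      = algebraMap F K (g.coeff k) * x ^ (k - 1) := by
    intro i hi
    have := Finset.mem_range.1 hi
    simp only [map_pow, aeval_X, aeval_C, mul_assoc, ← pow_add]
    congr 2
    omega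
  rw [Finset.sum_congr rfl this]
  simp
  ring

theorem bdV_bdg {F : Type} [Field F] (g : F[X]) : bdg g.natDegree (bdV g) := by
  refine bdg_sum _ _ fun k hk => bdg_sum _ _ fun i hi => bdg_mul _ _ ?_
  refine (natDegree_C_mul_X_pow_le _ _).trans ?_
  have := Finset.mem_range.1 hi
  have := Finset.mem_range.1 hk
  omega

theorem bdV_nd {F : Type} [Field F] (g : F[X]) : (bdV g).natDegree ≤ g.natDegree := by
  refine natDegree_sum_le_of_forall_le _ _ fun k hk => natDegree_sum_le_of_forall_le _ _ fun i hi => ?_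
  refine (natDegree_C_mul_le _ _).trans (natDegree_map_le.trans ?_)
  rw [natDegree_X_pow]
  have := Finset.mem_range.1 hi
  have := Finset.mem_range.1 hk
  omega

theorem bd_aux {F : Type} [Field F] (G : F[X]) (n : ℕ) (hn : G.natDegree = n) (h1 : 1 ≤ n) :
    (2 * G - X * derivative G).natDegree ≤ n := by
  have := natDegree_derivative_le G
  refine bd_sub ?_ ?_
  · refine natDegree_mul_le.trans ?_
    rw [show (2 : F[X]) = C 2 from rfl, natDegree_C]; omega
  · refine natDegree_mul_le.trans ?_
    rw [natDegree_X]; omega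

theorem bdW_bdg {F : Type} [Field F] (G : F[X]) (n : ℕ) (hn : G.natDegree = n) (h1 : 1 ≤ n) :
    bdg n (bdW G) := by
  have := natDegree_derivative_le G
  refine bdg_sub (bdg_sub (bdg_add (bdg_mul _ _ (bd_aux G n hn h1)) (bdg_mul _ _ (by omega)))
    (bdg_mul _ _ (by simp))) (bdg_mul _ _ (by simpa using h1))

theorem bdW_nd {F : Type} [Field F] (G : F[X]) (n : ℕ) (hn : G.natDegree = n) (h1 : 1 ≤ n) :
    (bdW G).natDegree ≤ n := by
  have := natDegree_derivative_le G
  refine bd_sub (bd_sub (natDegree_add_le_of_degree_le ?_ ?_) ?_) ?_ <;>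
    refine (natDegree_C_mul_le _ _).trans (natDegree_map_le.trans ?_)
  · simp
  · simpa using h1
  · exact bd_aux G n hn h1
  · omega

theorem bdW_ne {F : Type} [Field F] (h2 : (2 : F) ≠ 0) (G : F[X]) (hG : G.Monic) (n : ℕ)
    (hn : G.natDegree = n) (h4 : 4 ≤ n) : (bdW G).natDegree ≠ 0 := by
  intro h0
  obtain ⟨k, rfl⟩ : ∃ k, n = k + 3 := ⟨n - 3, by omega⟩
  have hc : G.coeff (k + 3) = 1 := by rw [← hn]; exact hG.coeff_natDegree
  have hc1 : G.coeff (k + 3 + 1) = 0 := coeff_eq_zero_of_natDegree_lt (by omega)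
  have c1 := congrArg (fun f => f.coeff 0) (coeff_eq_zero_of_natDegree_lt (by omega : (bdW G).natDegree < k + 3))
  have c2 := congrArg (fun f => f.coeff 1) (coeff_eq_zero_of_natDegree_lt (by omega : (bdW G).natDegree < k + 2))
  simp only [bdW, coeff_add, coeff_sub, coeff_C_mul, coeff_map] at c1 c2
  simp [coeff_one, coeff_X, coeff_X_mul, coeff_C, coeff_derivative, hc, hc1, show (2 : F[X]) = C 2 from rfl] at c1 c2
  have : (2 : F) = 0 := by linear_combination -c2 - c1
  exact h2 this


theorem bd_cop {L : Type} [Field L] (u v : L[X]) (c : L) (hc : c ≠ 0) (h : u - v = C c) :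
    IsCoprime u v := by
  refine ⟨C c⁻¹, - C c⁻¹, ?_⟩
  rw [neg_mul, ← sub_eq_add_neg, ← mul_sub, h, ← C_mul, inv_mul_cancel₀ hc, C_1]

theorem bd_badS {F : Type} [Field F] [Fintype F] [DecidableEq F] (h2 : (2 : F) ≠ 0)
    (W V : F[X][X]) (hW : W ≠ 0) (n : ℕ) (hWn : W.natDegree ≤ n) (S : Finset F)
    (hS : ∀ s ∈ S, resultant W (V + C (C (2 * s))) = 0) : S.card ≤ n := by
  classical
  set L := FractionRing F[X]
  set i : F[X] →+* L := algebraMap F[X] L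
  have hi : Function.Injective i := IsFractionRing.injective F[X] L
  set w := W.map i with hw
  have hw0 : w ≠ 0 := (Polynomial.map_ne_zero_iff hi).2 hW
  set v : F → L[X] := fun s => (V + C (C (2 * s))).map i with hv
  have hnc : ∀ s ∈ S, ¬ IsCoprime w (v s) := by
    intro s hs
    have h := congrArg i (hS s hs)
    rw [← resultant_map_map, map_zero] at h
    have e1 : w.natDegree = W.natDegree := natDegree_map_eq_of_injective hi W
    have e2 : (v s).natDegree = (V + C (C (2 * s))).natDegree := natDegree_map_eq_of_injective hi _
    have h' : resultant w (v s) = 0 := by rw [e1, e2]; exact h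
    exact (resultant_eq_zero_iff.1 h').2
  set p : F → L[X] := fun s => EuclideanDomain.gcd w (v s) with hp
  have hp0 : ∀ s, p s ≠ 0 := fun s h => hw0 (EuclideanDomain.gcd_eq_zero_iff.1 h).1
  have hpd : ∀ s ∈ S, 1 ≤ (p s).natDegree := by
    intro s hs
    by_contra hlt
    apply hnc s hs
    rw [← EuclideanDomain.gcd_isUnit_iff]
    have : (p s).natDegree = 0 := by omega
    rw [natDegree_eq_zero] at this
    obtain ⟨x, hx⟩ := this
    change IsUnit (p s)
    rw [← hx, isUnit_C, isUnit_iff_ne_zero]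
    rintro rfl
    exact hp0 s (by rw [← hx]; simp)
  have hcop : ∀ s t : F, s ≠ t → IsCoprime (p s) (p t) := by
    intro s t hst
    have h3 : IsCoprime (v s) (v t) := by
      have hne : i (C (2 * s - 2 * t)) ≠ 0 := by
        rw [map_ne_zero_iff i hi, Ne, C_eq_zero, ← mul_sub]
        exact mul_ne_zero h2 (sub_ne_zero.2 hst)
      refine bd_cop _ _ _ hne ?_
      simp only [hv, Polynomial.map_add, map_C, map_sub]
      ring
    exact IsCoprime.of_isCoprime_of_dvd_left (IsCoprime.of_isCoprime_of_dvd_right h3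
      (EuclideanDomain.gcd_dvd_right _ _)) (EuclideanDomain.gcd_dvd_right _ _)
  have hdvd : ∏ s ∈ S, p s ∣ w := Finset.prod_dvd_of_coprime (fun s _ t _ hst => hcop s t hst)
    (fun s _ => EuclideanDomain.gcd_dvd_left _ _)
  have := natDegree_le_of_dvd hdvd hw0
  rw [natDegree_prod _ _ (fun s _ => hp0 s)] at this
  have h5 : S.card ≤ ∑ s ∈ S, (p s).natDegree := by
    rw [Finset.card_eq_sum_ones]
    exact Finset.sum_le_sum hpd
  have e1 : w.natDegree = W.natDegree := natDegree_map_eq_of_injective hi W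
  omega

theorem bd_count {F : Type} (K : Type) [Field F] [Fintype F] [DecidableEq F] [Field K] [IsAlgClosed K] [Algebra F K] (h2 : (2 : F) ≠ 0)
    (G : F[X]) (hG : G.Monic) (n : ℕ) (hn : G.natDegree = n) (h4 : 4 ≤ n) :
    ∃ S : Finset F, S.card ≤ n + 1 ∧ ∀ s ∉ S, ∃ T : Finset F, T.card ≤ 2 * n * n ∧ ∀ a ∉ T,
      ∀ P : F[X], P = G + C s * X ^ 2 + C a * X →
      0 < (derivative P).natDegree ∧ (derivative P).Separable ∧
      ∀ x y : K, aeval x (derivative P) = 0 → aeval y (derivative P) = 0 →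
        aeval x P = aeval y P → x = y := by
  classical
  set g := derivative G with hg
  have hgd : g.natDegree ≤ G.natDegree - 1 := natDegree_derivative_le G
  set S₀ : Finset F := Finset.univ.filter fun s => resultant (bdW G) (bdV g + C (C (2 * s))) = 0
  have hS₀ : S₀.card ≤ n := bd_badS h2 (bdW G) (bdV g) (fun h => bdW_ne h2 G hG n hn h4 (by rw [h]; simp)) n
    (bdW_nd G n hn (by omega)) S₀ (fun s hs => (Finset.mem_filter.1 hs).2)
  refine ⟨insert (- g.coeff 1 / 2) S₀, (Finset.card_insert_le _ _).trans (by omega), ?_⟩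
  intro s hs
  rw [Finset.mem_insert, not_or] at hs
  obtain ⟨hs1, hs2⟩ := hs
  set U := bdV g + C (C (2 * s)) with hU
  set R := resultant (bdW G) U with hR
  have hR0 : R ≠ 0 := fun h => hs2 (Finset.mem_filter.2 ⟨Finset.mem_univ _, h⟩)
  have hUn : U.natDegree ≤ n := natDegree_add_le_of_degree_le ((bdV_nd g).trans (by omega)) (by rw [natDegree_C]; omega)
  have hWn := bdW_nd G n hn (by omega)
  have hRn : R.natDegree ≤ 2 * n * n := by
    refine (bdg_res (d := n) _ _ _ _ (bdW_bdg G n hn (by omega)) ?_).trans ?_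
    · refine bdg_add (fun j => (bdV_bdg g j).trans (by omega)) (fun j => ?_)
      rw [coeff_C]; split_ifs
      · rw [natDegree_C]; omega
      · simp
    · exact Nat.mul_le_mul_right _ (by omega)
  have hroot : ∀ x y : K, bdev x y (bdW G) = 0 → bdev x y U = 0 → aeval x R = 0 := by
    intro x y hx hy
    obtain ⟨p, q, _, _, h⟩ := exists_mul_add_mul_eq_C_resultant (bdW G) U le_rfl le_rfl
      (Or.inl (bdW_ne h2 G hG n hn h4))
    have := congrArg (bdev x y) h
    rw [map_add, map_mul, map_mul, hx, hy, bdev_C] at this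
    rw [hR, ← this]; ring
  set B : Finset K := (R.aroots K).toFinset.image fun r => - (aeval r g + 2 * algebraMap F K s * r)
  refine ⟨Finset.univ.filter fun a => algebraMap F K a ∈ B, ?_, ?_⟩
  · refine (Finset.card_le_card_of_injOn (t := B) (algebraMap F K) ?_
      (algebraMap F K).injective.injOn).trans ?_
    · intro a ha
      exact (Finset.mem_filter.1 ha).2
    · refine Finset.card_image_le.trans ((Multiset.toFinset_card_le _).trans ?_)
      refine (card_roots' _).trans ?_
      rw [natDegree_map]; exact hRn
  · intro a ha P hP
    have hmem : ∀ x : K, aeval x R = 0 → - (aeval x g + 2 * algebraMap F K s * x) ≠ algebraMap F K a := by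
      intro x hx he
      refine ha (Finset.mem_filter.2 ⟨Finset.mem_univ _, ?_⟩)
      rw [← he]
      refine Finset.mem_image_of_mem _ ?_
      rw [Multiset.mem_toFinset, mem_aroots]
      exact ⟨hR0, hx⟩
    have hC2 : (C (2 : F)) = 2 := rfl
    have hA2 : algebraMap F K 2 = 2 := map_ofNat (algebraMap F K) 2
    have hdP : derivative P = g + C (2 * s) * X + C a := by
      rw [hP, derivative_add, derivative_add, ← hg]
      simp [hC2]
      ring
    have hddP : derivative (derivative P) = derivative g + C (2 * s) := by
      rw [hdP]; simp
    have ev1 : ∀ x : K, aeval x (derivative P) = aeval x g + 2 * algebraMap F K s * x + algebraMap F K a := by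
      intro x; rw [hdP]; simp [hA2]
    refine ⟨?_, ?_, ?_⟩
    · by_contra h0
      have h0' : (derivative P).coeff 1 = 0 := coeff_eq_zero_of_natDegree_lt (by omega)
      rw [hdP] at h0'
      simp [coeff_C] at h0'
      apply hs1
      rw [eq_div_iff h2]
      linear_combination h0'
    · refine (isCoprime_iff_aeval_ne_zero_of_isAlgClosed F K _ _).2 ?_
      intro x
      by_contra hx
      push Not at hx
      obtain ⟨hx1, hx2⟩ := hx
      refine hmem x (hroot x x ?_ ?_) ?_
      · rw [bdW_ev]; ring
      · rw [hU, map_add, bdV_ev_diag, bdev_C, ← hx2, hddP]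
        simp
      · rw [ev1] at hx1
        linear_combination -hx1
    · intro x y hx hy hxy
      by_contra hne
      have e1 := hx
      have e2 := hy
      rw [ev1] at e1 e2
      have e3 : aeval x G + algebraMap F K s * x ^ 2 + algebraMap F K a * x =
        aeval y G + algebraMap F K s * y ^ 2 + algebraMap F K a * y := by
        rw [hP] at hxy; simpa using hxy
      refine hmem x (hroot x y ?_ ?_) ?_
      · rw [bdW_ev, ← hg]
        linear_combination 2 * e3 - (x - y) * e1 - (x - y) * e2
      · have := bdV_ev x y g
        apply mul_right_cancel₀ (sub_ne_zero.2 hne)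
        rw [hU, map_add, add_mul, this, bdev_C]
        simp [hA2]
        linear_combination e1 - e2
      · linear_combination -e1


theorem fin_two {F : Type} [Field F] [Fintype F] (hodd : Odd (Fintype.card F)) : (2 : F) ≠ 0 := by
  apply Ring.two_ne_zero
  intro h
  have := FiniteField.even_card_of_char_two h
  rw [Nat.odd_iff] at hodd
  omega

theorem fin_mu {F : Type} [Field F] (f : F[X]) : |(polyMu f : ℝ)| ≤ 1 := by
  rw [polyMu]
  split_ifs <;> simp

theorem fin_three {F : Type} [Field F] [Fintype F] [DecidableEq F] (hodd : Odd (Fintype.card F))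
    (G : F[X]) (hG : G.Monic) (n : ℕ) (hn : G.natDegree = n) (h4 : 4 ≤ n) :
    |∑ s : F, ∑ a : F, ∑ b : F, (polyMu (G + C s * X ^ 2 + C a * X + C b) : ℝ)| ≤
      (2 * n * n + 12 * n + 17) * ((Fintype.card F : ℝ) ^ 2 * Real.sqrt (Fintype.card F)) := by
  obtain ⟨S, hS, hgood⟩ := bd_count (AlgebraicClosure F) (fin_two hodd) G hG n hn h4
  set q : ℝ := (Fintype.card F : ℝ) with hq
  have hq1 : 1 ≤ q := by
    rw [hq]; exact_mod_cast (Fintype.card_pos : 0 < Fintype.card F)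
  have hr1 : 1 ≤ Real.sqrt q := by rw [Real.one_le_sqrt]; exact hq1
  have triv : ∀ s a : F, |∑ b : F, (polyMu (G + C s * X ^ 2 + C a * X + C b) : ℝ)| ≤ q := by
    intro s a
    refine (Finset.abs_sum_le_sum_abs _ _).trans ((Finset.sum_le_card_nsmul _ _ 1 fun b _ => fin_mu _).trans ?_)
    simp [hq]
  have hin : ∀ s : F, |∑ a : F, ∑ b : F, (polyMu (G + C s * X ^ 2 + C a * X + C b) : ℝ)| ≤
      (if s ∈ S then q ^ 2 else 0) + (2 * n * n + 11 * n + 16) * (q * Real.sqrt q) := by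
    intro s
    by_cases hs : s ∈ S
    · rw [if_pos hs]
      refine (Finset.abs_sum_le_sum_abs _ _).trans ((Finset.sum_le_card_nsmul _ _ q fun b _ => triv _ _).trans ?_)
      simp only [Finset.card_univ, nsmul_eq_mul, ← hq]
      have : 0 ≤ (2 * n * n + 11 * n + 16 : ℝ) * (q * Real.sqrt q) := by positivity
      nlinarith
    · rw [if_neg hs, zero_add]
      obtain ⟨T, hT, hT2⟩ := hgood s hs
      have hab : ∀ a : F, |∑ b : F, (polyMu (G + C s * X ^ 2 + C a * X + C b) : ℝ)| ≤
          (if a ∈ T then q else 0) + (11 * n + 16) * Real.sqrt q := by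
        intro a
        by_cases ha : a ∈ T
        · rw [if_pos ha]
          have : 0 ≤ (11 * n + 16 : ℝ) * Real.sqrt q := by positivity
          have := triv s a
          linarith
        · rw [if_neg ha, zero_add]
          obtain ⟨g1, g2, g3⟩ := hT2 a ha _ rfl
          have hlow : (C s * X ^ 2 + C a * X : F[X]).degree < G.degree := by
            rw [degree_eq_natDegree hG.ne_zero, hn]
            refine lt_of_le_of_lt (b := ((2 : ℕ) : WithBot ℕ)) ?_ (by exact_mod_cast (by omega : 2 < n))
            refine (degree_add_le _ _).trans (max_le (degree_C_mul_X_pow_le _ _) ?_)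
            exact (degree_C_mul_X_le _).trans (by norm_num)
          have hm : (G + C s * X ^ 2 + C a * X).Monic := by
            rw [add_assoc]; exact hG.add_of_left hlow
          have hnd : (G + C s * X ^ 2 + C a * X).natDegree = n := by
            rw [add_assoc, natDegree_add_eq_left_of_degree_lt hlow, hn]
          exact dp_bound hodd _ hm n hnd (by omega) g1 g2 g3
      refine (Finset.abs_sum_le_sum_abs _ _).trans ((Finset.sum_le_sum fun a _ => hab a).trans ?_)
      rw [Finset.sum_add_distrib, Finset.sum_ite_mem, Finset.univ_inter, Finset.sum_const, Finset.sum_const,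
        Finset.card_univ, nsmul_eq_mul, nsmul_eq_mul, ← hq]
      have hT' : (T.card : ℝ) ≤ 2 * n * n := by exact_mod_cast hT
      have h1 : (T.card : ℝ) * q ≤ (2 * n * n) * (q * Real.sqrt q) := by
        refine mul_le_mul hT' ?_ (by positivity) (by positivity)
        nlinarith
      linarith
  refine (Finset.abs_sum_le_sum_abs _ _).trans ((Finset.sum_le_sum fun a _ => hin a).trans ?_)
  rw [Finset.sum_add_distrib, Finset.sum_ite_mem, Finset.univ_inter, Finset.sum_const, Finset.sum_const,
    Finset.card_univ, nsmul_eq_mul, nsmul_eq_mul, ← hq]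
  have hS' : (S.card : ℝ) ≤ n + 1 := by exact_mod_cast hS
  have h1 : (S.card : ℝ) * q ^ 2 ≤ (n + 1) * (q ^ 2 * Real.sqrt q) := by
    refine mul_le_mul hS' ?_ (by positivity) (by positivity)
    have : 0 ≤ q ^ 2 := by positivity
    nlinarith
  linarith

/-- For fixed `2 ≤ h ≤ n - 2` there is a constant `C = C(n)` such that for every
finite field `𝔽_q` of odd cardinality and every monic `A` of degree `n`,
`|∑_{f ∈ I(A;h)} μ(f)| ≤ C · q^{h+1} / √q`. -/
theorem mobius_short_interval_cancellation (n h : ℕ) (h2 : 2 ≤ h) (hn : h + 2 ≤ n) :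
    ∃ C : ℝ, ∀ (Fq : Type) [Field Fq] [Fintype Fq],
      Odd (Fintype.card Fq) →
      ∀ A : Fq[X], A.Monic → A.natDegree = n →
        |∑ᶠ f ∈ {f : Fq[X] | (f - A).degree ≤ (h : WithBot ℕ)}, (polyMu f : ℝ)|
          ≤ C * (Fintype.card Fq : ℝ) ^ (h + 1) / Real.sqrt (Fintype.card Fq) := by
  refine ⟨2 * n * n + 12 * n + 17, ?_⟩
  intro F _ _ hodd A hA hAn
  classical
  set q : ℝ := (Fintype.card F : ℝ) with hq
  have hq1 : 1 ≤ q := by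
    rw [hq]; exact_mod_cast (Fintype.card_pos : 0 < Fintype.card F)
  have hr1 : 1 ≤ Real.sqrt q := by rw [Real.one_le_sqrt]; exact hq1
  let e := (degreeLTEquiv F (h + 1)).toEquiv
  let _ : Fintype (degreeLT F (h + 1)) := Fintype.ofEquiv _ e.symm
  have hcard : (Fintype.card (degreeLT F (h + 1)) : ℝ) = q ^ (h + 1) := by
    rw [Fintype.card_congr e, Fintype.card_fun, Fintype.card_fin, hq]; push_cast; rfl
  have hset : {f : F[X] | (f - A).degree ≤ (h : WithBot ℕ)} =
      Set.range (fun v : degreeLT F (h + 1) => A + (v : F[X])) := by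
    ext f
    have hlt : (f - A).degree ≤ (h : WithBot ℕ) ↔ f - A ∈ degreeLT F (h + 1) := by
      rw [mem_degreeLT, degree_lt_iff_coeff_zero, degree_le_iff_coeff_zero]
      simp
    constructor
    · intro hf
      exact ⟨⟨f - A, hlt.1 hf⟩, by simp⟩
    · rintro ⟨v, rfl⟩
      refine hlt.2 ?_
      simp
  rw [hset, finsum_mem_range (by intro v w hvw; exact Subtype.ext (add_left_cancel hvw)), finsum_eq_sum_of_fintype]
  set Tot := ∑ v : degreeLT F (h + 1), (polyMu (A + (v : F[X])) : ℝ) with hTot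
  have hmem : ∀ s a b : F, C s * X ^ 2 + C a * X + C b ∈ degreeLT F (h + 1) := by
    intro s a b
    rw [mem_degreeLT]
    refine lt_of_le_of_lt (b := ((2 : ℕ) : WithBot ℕ)) degree_quadratic_le (by exact_mod_cast (by omega : 2 < h + 1))
  have htr : ∀ s a b : F, ∑ v : degreeLT F (h + 1), (polyMu ((A + (v : F[X])) + C s * X ^ 2 + C a * X + C b) : ℝ) = Tot := by
    intro s a b
    rw [hTot, ← Equiv.sum_comp (Equiv.addRight (⟨_, hmem s a b⟩ : degreeLT F (h + 1)))
      (fun v => (polyMu (A + (v : F[X])) : ℝ))]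
    refine Finset.sum_congr rfl fun v _ => ?_
    simp [add_assoc]
  have htot : q ^ 3 * Tot = ∑ v : degreeLT F (h + 1), ∑ s : F, ∑ a : F, ∑ b : F,
      (polyMu ((A + (v : F[X])) + C s * X ^ 2 + C a * X + C b) : ℝ) := by
    rw [Finset.sum_comm]
    simp_rw [Finset.sum_comm (s := (Finset.univ : Finset (degreeLT F (h + 1)))), htr]
    simp [← hq]
    ring
  have hbd : |q ^ 3 * Tot| ≤ q ^ (h + 1) * ((2 * n * n + 12 * n + 17) * (q ^ 2 * Real.sqrt q)) := by
    rw [htot]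
    refine (Finset.abs_sum_le_sum_abs _ _).trans ((Finset.sum_le_card_nsmul _ _
      ((2 * n * n + 12 * n + 17) * (q ^ 2 * Real.sqrt q)) fun v _ => ?_).trans ?_)
    · have hv : (v : F[X]).degree < A.degree := by
        rw [degree_eq_natDegree hA.ne_zero, hAn]
        exact (mem_degreeLT.1 v.2).trans (by exact_mod_cast (by omega : h + 1 < n))
      exact fin_three hodd _ (hA.add_of_left hv) n (by rw [natDegree_add_eq_left_of_degree_lt hv, hAn]) (by omega)
    · rw [nsmul_eq_mul, Finset.card_univ, hcard]
  rw [abs_mul, abs_of_nonneg (by positivity : (0:ℝ) ≤ q ^ 3)] at hbd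
  have hqs : Real.sqrt q * Real.sqrt q = q := Real.mul_self_sqrt (by linarith)
  rw [le_div_iff₀ (by linarith)]
  have h5 : 0 < q ^ 2 * Real.sqrt q := by positivity
  refine le_of_mul_le_mul_left ?_ h5
  calc q ^ 2 * √q * (|Tot| * √q) = q ^ 2 * (√q * √q) * |Tot| := by ring
    _ = q ^ 3 * |Tot| := by rw [hqs]; ring
    _ ≤ _ := hbd
    _ = _ := by ring
end

section
/- Fix an integer n ≥ 2. There exists a constant C depending only on n such that for every finite field 𝔽_q with q odd, every polynomial Q ∈ 𝔽_q[t] with 1 ≤ deg Q < n, and every A ∈ 𝔽_q[t] coprime to Q, the number of squarefree monic polynomials f of degree n with f ≡ A (mod Q) satisfies |#{f ∈ M_n : f ≡ A (mod Q), f squarefree} − q^{n−deg Q}| ≤ C·q^{n−deg Q−1}. -/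
open Polynomial

lemma aux_double {F : Type} [Field F] [Fintype F] (v : F[X]) (T E : Set F[X]) (hT : T.Finite)
    (hET : E ⊆ T) (hcl : ∀ f ∈ T, ∀ a : F, f + C a * v ∈ T) (K : ℕ)
    (hK : ∀ f ∈ T, {a : F | f + C a * v ∈ E}.ncard ≤ K) :
    Fintype.card F * E.ncard ≤ K * T.ncard := by
  classical
  have hE := hT.subset hET
  lift T to Finset F[X] using hT
  lift E to Finset F[X] using hE
  rw [Set.ncard_coe_finset, Set.ncard_coe_finset]
  have h1 : (E ×ˢ (Finset.univ : Finset F)).card ≤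
      (T.sigma (fun f => (Finset.univ : Finset F).filter (fun a => f + C a * v ∈ E))).card := by
    apply Finset.card_le_card_of_injOn (fun p => ⟨p.1 - C p.2 * v, p.2⟩)
    · rintro ⟨e, a⟩ h
      have he : e ∈ E := by simpa using h
      have := hcl e (hET he) (-a)
      simp only [map_neg, neg_mul, ← sub_eq_add_neg] at this
      simpa [he] using this
    · rintro ⟨e, a⟩ _ ⟨e', a'⟩ _ h
      simp only [Sigma.mk.injEq, heq_eq_eq] at h
      obtain ⟨h, rfl⟩ := h
      simpa using h
  rw [Finset.card_product, Finset.card_univ, mul_comm] at h1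
  refine h1.trans ?_
  rw [Finset.card_sigma, mul_comm, ← smul_eq_mul]
  apply Finset.sum_le_card_nsmul
  intro f hf
  have := hK f hf
  rw [← Set.ncard_coe_finset]
  simpa using this

lemma aux_W {F : Type} [Field F] [Fintype F] (n : ℕ) (Q f : F[X]) (hd : 1 ≤ Q.natDegree)
    (hdn : Q.natDegree < n) (hf : f.natDegree ≤ n) (hc : IsCoprime f Q) :
    {a : F | ¬ Squarefree (f + C a * Q) ∧
      ¬ (derivative (f + C a * Q) = 0 ∧ derivative Q = 0)}.ncard ≤ 2 * n := by
  classical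
  set B := {a : F | ¬ Squarefree (f + C a * Q) ∧
      ¬ (derivative (f + C a * Q) = 0 ∧ derivative Q = 0)} with hB
  have hfin : B.Finite := Set.toFinite B
  have hQ0 : Q ≠ 0 := by rintro rfl; simp at hd
  set W := f * derivative Q - derivative f * Q with hW
  rcases B.eq_empty_or_nonempty with h0 | ⟨a0, ha0⟩
  · rw [h0]; simp
  have hW0 : W ≠ 0 := by
    intro h
    have h1 : f * derivative Q = derivative f * Q := sub_eq_zero.mp h
    have h2 : Q ∣ derivative Q := hc.symm.dvd_of_dvd_mul_left ⟨derivative f, by rw [h1, mul_comm]⟩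
    have h3 : derivative Q = 0 := by
      by_contra h3
      have := natDegree_le_of_dvd h2 h3
      have := natDegree_derivative_lt (p := Q) (by omega)
      omega
    rw [h3, mul_zero] at h1
    have h4 : derivative f = 0 := by
      rcases mul_eq_zero.mp h1.symm with h | h
      · exact h
      · exact absurd h hQ0
    exact ha0.2 ⟨by simp [h3, h4], h3⟩
  have hP : ∀ a : F, ∃ P : F[X], a ∈ B → P * P ∣ f + C a * Q ∧ ¬ IsUnit P := by
    intro a
    by_cases ha : a ∈ B
    · have := ha.1
      unfold Squarefree at this
      push Not at this
      obtain ⟨P, h⟩ := this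
      exact ⟨P, fun _ => h⟩
    · exact ⟨0, fun h => absurd h ha⟩
  choose P hP using hP
  have hPW : ∀ a ∈ B, P a ∣ W := by
    intro a ha
    obtain ⟨R, hR⟩ := (hP a ha).1
    have hd' : derivative f = derivative (P a * P a * R) - C a * derivative Q := by
      rw [← hR]; simp
    have hf' : f = P a * P a * R - C a * Q := by rw [← hR]; ring
    rw [hW, hd']
    nth_rw 1 [hf']
    simp only [derivative_mul]
    exact ⟨P a * R * derivative Q - (derivative (P a) * R + derivative (P a) * R
      + P a * derivative R) * Q, by ring⟩
  have hcop : ∀ a ∈ B, ∀ b ∈ B, a ≠ b → IsCoprime (P a) (P b) := by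
    intro a ha b hb hab
    have h1 : IsCoprime (f + C a * Q) (f + C b * Q) := by
      have hu : IsUnit (C (b - a) : F[X]) := isUnit_C.mpr (isUnit_iff_ne_zero.mpr (sub_ne_zero.mpr hab.symm))
      have h2 : IsCoprime (f + C a * Q) Q := by
        have := (IsCoprime.add_mul_right_left_iff (x := f) (y := Q) (z := C a)).mpr hc
        simpa [mul_comm] using this
      have h3 : IsCoprime (f + C a * Q) (C (b - a) * Q) :=
        (isCoprime_mul_unit_left_right hu _ _).mpr h2
      have h4 := (IsCoprime.add_mul_left_right_iff (x := f + C a * Q) (y := C (b-a) * Q) (z := 1)).mpr h3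
      have h5 : f + C b * Q = C (b - a) * Q + (f + C a * Q) * 1 := by
        simp only [map_sub]; ring
      rw [h5]
      exact h4
    exact h1.of_isCoprime_of_dvd_left ((dvd_mul_right _ _).trans (hP a ha).1)
      |>.of_isCoprime_of_dvd_right ((dvd_mul_right _ _).trans (hP b hb).1)
  lift B to Finset F using hfin with B' hB'
  rw [Set.ncard_coe_finset]
  have hdvd : ∏ a ∈ B', P a ∣ W :=
    Finset.prod_dvd_of_coprime (fun a ha b hb hab => hcop a ha b hb hab) (fun a ha => hPW a ha)
  have hP0 : ∀ a ∈ B', P a ≠ 0 := fun a ha h => hW0 (by simpa [h] using hPW a ha)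
  have hdeg := natDegree_le_of_dvd hdvd hW0
  rw [natDegree_prod _ _ hP0] at hdeg
  have h5 : B'.card ≤ ∑ a ∈ B', (P a).natDegree := by
    rw [Finset.card_eq_sum_ones]
    apply Finset.sum_le_sum
    intro a ha
    by_contra h
    have h6 : (P a).natDegree = 0 := by omega
    rw [natDegree_eq_zero] at h6
    obtain ⟨c, hc⟩ := h6
    refine (hP a ha).2 ?_
    rw [← hc]
    refine isUnit_C.mpr (isUnit_iff_ne_zero.mpr ?_)
    rintro rfl
    exact hP0 a ha (by rw [← hc]; simp)
  have h7 : W.natDegree ≤ 2 * n := by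
    refine (natDegree_sub_le _ _).trans (max_le ?_ ?_)
    · refine natDegree_mul_le.trans ?_
      have := natDegree_derivative_le Q
      omega
    · refine natDegree_mul_le.trans ?_
      have := natDegree_derivative_le f
      omega
  omega

lemma aux_T {F : Type} [Field F] [Fintype F] (n : ℕ) (Q A : F[X]) (hd : 1 ≤ Q.natDegree)
    (hdn : Q.natDegree < n) :
    {f : F[X] | f.Monic ∧ f.natDegree = n ∧ Q ∣ (f - A)}.Finite ∧
    {f : F[X] | f.Monic ∧ f.natDegree = n ∧ Q ∣ (f - A)}.ncard =
      Fintype.card F ^ (n - Q.natDegree) := by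
  classical
  have hQ0 : Q ≠ 0 := by rintro rfl; simp at hd
  set m := n - Q.natDegree with hm
  set r := (A - X ^ n) % Q with hr
  have hrdeg : r.degree < n := by
    refine (EuclideanDomain.mod_lt (A - X ^ n) hQ0).trans ?_
    rw [degree_eq_natDegree hQ0]; exact_mod_cast hdn
  have hrQ : Q ∣ X ^ n + r - A := by
    have := EuclideanDomain.div_add_mod (A - X ^ n) Q
    refine ⟨- ((A - X ^ n) / Q), ?_⟩
    rw [← hr] at this
    linear_combination this
  have himg : {f : F[X] | f.Monic ∧ f.natDegree = n ∧ Q ∣ (f - A)} =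
      Set.range (fun g : degreeLT F m => X ^ n + r + Q * (g : F[X])) := by
    ext f
    simp only [Set.mem_setOf_eq, Set.mem_range]
    constructor
    · rintro ⟨h1, h2, h3⟩
      obtain ⟨g, hg⟩ := (dvd_sub h3 hrQ)
      have hg' : f = X ^ n + r + Q * g := by linear_combination hg
      refine ⟨⟨g, ?_⟩, hg'.symm⟩
      rw [mem_degreeLT]
      by_cases hg0 : g = 0
      · simp [hg0]
      have h4 : (f - X ^ n).degree < (n : WithBot ℕ) := by
        have := degree_sub_lt (p := f) (q := X ^ n) (by rw [degree_X_pow, degree_eq_natDegree h1.ne_zero, h2]) h1.ne_zero (by simp [h1.leadingCoeff])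
        rwa [degree_eq_natDegree h1.ne_zero, h2] at this
      have h5 : (Q * g).degree < n := by
        have : Q * g = (f - X ^ n) - r := by rw [hg']; ring
        rw [this]
        exact (degree_sub_le _ _).trans_lt (max_lt h4 hrdeg)
      rw [degree_mul, degree_eq_natDegree hQ0, degree_eq_natDegree hg0] at h5
      rw [degree_eq_natDegree hg0]
      norm_cast at h5 ⊢
      omega
    · rintro ⟨⟨g, hg⟩, rfl⟩
      rw [mem_degreeLT] at hg
      have h5 : (r + Q * g).degree < n := by
        refine (degree_add_le _ _).trans_lt (max_lt hrdeg ?_)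
        by_cases hg0 : g = 0
        · simp [hg0]
        rw [degree_eq_natDegree hg0] at hg
        rw [degree_mul, degree_eq_natDegree hQ0, degree_eq_natDegree hg0]
        norm_cast at hg ⊢
        omega
      simp only [add_assoc]
      refine ⟨monic_X_pow_add h5, ?_, ?_⟩
      · rw [natDegree_add_eq_left_of_degree_lt (by rwa [degree_X_pow]), natDegree_X_pow]
      · have := dvd_add hrQ (dvd_mul_right Q g)
        convert this using 1; ring
  have hinj : Function.Injective (fun g : degreeLT F m => X ^ n + r + Q * (g : F[X])) := by
    intro g h hgh
    simp only [add_right_inj] at hgh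
    exact Subtype.ext (mul_left_cancel₀ hQ0 hgh)
  have e : degreeLT F m ≃ (Fin m → F) := (degreeLTEquiv F m).toEquiv
  haveI : Finite (degreeLT F m) := Finite.of_equiv _ e.symm
  rw [himg]
  refine ⟨Set.finite_range _, ?_⟩
  rw [← Set.image_univ, Set.ncard_image_of_injective _ hinj, Set.ncard_univ, Nat.card_congr e]
  simp

/-- For fixed `n ≥ 2` there is a constant `C = C(n)` such that for every finite
field `𝔽_q` with `q` odd, every modulus `Q` with `1 ≤ deg Q < n`, and every `A` coprime to `Q`,
the number of squarefree monic `f` of degree `n` with `f ≡ A (mod Q)` is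
`q^{n - deg Q} + O_n(q^{n - deg Q - 1})`. -/
theorem squarefree_count_arithmetic_progression (n : ℕ) (hn : 2 ≤ n) :
    ∃ C : ℝ, ∀ (Fq : Type) [Field Fq] [Fintype Fq],
      Odd (Fintype.card Fq) →
      ∀ Q A : Fq[X], 1 ≤ Q.natDegree → Q.natDegree < n → IsCoprime A Q →
        |({f : Fq[X] | f.Monic ∧ f.natDegree = n ∧ Q ∣ (f - A) ∧ Squarefree f}.ncard : ℝ)
            - (Fintype.card Fq : ℝ) ^ (n - Q.natDegree)|
          ≤ C * (Fintype.card Fq : ℝ) ^ (n - Q.natDegree - 1) := by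
  refine ⟨2 * n + 1, ?_⟩
  intro F _ _ _ Q A hd hdn hc
  have hQ0 : Q ≠ 0 := by rintro rfl; simp at hd
  obtain ⟨hTf, hTc⟩ := aux_T n Q A hd hdn
  set T := {f : F[X] | f.Monic ∧ f.natDegree = n ∧ Q ∣ (f - A)} with hT
  set D := {f : F[X] | f ∈ T ∧ derivative f = 0 ∧ derivative Q = 0} with hD
  set E := {f : F[X] | f ∈ T ∧ ¬ Squarefree f ∧ ¬ (derivative f = 0 ∧ derivative Q = 0)} with hE
  set S := {f : F[X] | f.Monic ∧ f.natDegree = n ∧ Q ∣ (f - A) ∧ Squarefree f} with hS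
  have hcl : ∀ v : F[X], v.natDegree < n → Q ∣ v → ∀ f ∈ T, ∀ a : F, f + C a * v ∈ T := by
    rintro v hv hQv f ⟨h1, h2, h3⟩ a
    have h4 : (C a * v).degree < f.degree := by
      rw [degree_eq_natDegree h1.ne_zero, h2]
      refine degree_le_natDegree.trans_lt ?_
      have := natDegree_C_mul_le a v
      exact_mod_cast this.trans_lt hv
    refine ⟨h1.add_of_left h4, ?_, ?_⟩
    · rw [natDegree_add_eq_left_of_degree_lt h4, h2]
    · have := dvd_add h3 (hQv.mul_left (C a))
      convert this using 1; ring
  have hEb : Fintype.card F * E.ncard ≤ 2 * n * T.ncard := by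
    refine aux_double Q T E hTf (fun f h => h.1) (hcl Q hdn dvd_rfl) _ ?_
    intro f hf
    refine le_trans (Set.ncard_le_ncard ?_ (Set.toFinite _)) (aux_W n Q f hd hdn hf.2.1.le ?_)
    · intro a ha
      exact ha.2
    · obtain ⟨g, hg⟩ := hf.2.2
      have h4 := (IsCoprime.add_mul_left_left_iff (x := A) (y := Q) (z := g)).mpr hc
      have h5 : f = A + Q * g := by linear_combination hg
      rw [h5]
      exact h4
  have hDb : Fintype.card F * D.ncard ≤ 1 * T.ncard := by
    by_cases hm : n = Q.natDegree + 1
    · have : D = ∅ := by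
        rw [Set.eq_empty_iff_forall_notMem]
        rintro f ⟨⟨h1, h2, h3⟩, h4, h5⟩
        have e1 : (Q.natDegree : F) = 0 := by
          have := congrArg (fun p => coeff p (Q.natDegree - 1)) h5
          simp only [coeff_derivative, coeff_zero] at this
          rw [Nat.sub_add_cancel hd] at this
          rcases mul_eq_zero.mp this with h | h
          · exact absurd h (by simpa using hQ0)
          · rw [← h, Nat.cast_sub hd]; simp
        have e2 := congrArg (fun p => coeff p (Q.natDegree)) h4
        simp only [coeff_derivative, coeff_zero] at e2
        rw [← hm, ← h2, coeff_natDegree, h1.leadingCoeff, e1] at e2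
        simp at e2
      rw [this]; simp
    · refine aux_double (X * Q) T D hTf (fun f h => h.1) (hcl _ ?_ (dvd_mul_left _ _)) _ ?_
      · rw [natDegree_X_mul hQ0]; omega
      · intro f hf
        rw [Set.ncard_le_one_iff]
        rintro a b ⟨_, h1, h2⟩ ⟨_, h3, _⟩
        simp [h2] at h1 h3
        have h4 : C (a - b) * Q = 0 := by
          simp only [map_sub]; linear_combination h1 - h3
        rcases mul_eq_zero.mp h4 with h | h
        · exact sub_eq_zero.mp (C_eq_zero.mp h)
        · exact absurd h hQ0
  have hST : S ⊆ T := fun f h => ⟨h.1, h.2.1, h.2.2.1⟩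
  have h1 : S.ncard ≤ T.ncard := Set.ncard_le_ncard hST hTf
  have h2 : T.ncard ≤ S.ncard + (D.ncard + E.ncard) := by
    have hsub : T ⊆ S ∪ (D ∪ E) := by
      intro f hf
      by_cases hs : Squarefree f
      · exact Or.inl ⟨hf.1, hf.2.1, hf.2.2, hs⟩
      · by_cases hz : derivative f = 0 ∧ derivative Q = 0
        · exact Or.inr (Or.inl ⟨hf, hz⟩)
        · exact Or.inr (Or.inr ⟨hf, hs, hz⟩)
    have hfin : (S ∪ (D ∪ E)).Finite := hTf.subset
      (Set.union_subset hST (Set.union_subset (fun f h => h.1) (fun f h => h.1)))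
    refine (Set.ncard_le_ncard hsub hfin).trans ((Set.ncard_union_le _ _).trans ?_)
    exact Nat.add_le_add_left (Set.ncard_union_le _ _) _
  have hq : 0 < Fintype.card F := Fintype.card_pos
  have hpow : Fintype.card F ^ (n - Q.natDegree) =
      Fintype.card F * Fintype.card F ^ (n - Q.natDegree - 1) := by
    rw [← pow_succ']; congr 1; omega
  have h3 : D.ncard + E.ncard ≤ (2 * n + 1) * Fintype.card F ^ (n - Q.natDegree - 1) := by
    refine Nat.le_of_mul_le_mul_left ?_ hq
    rw [hTc, hpow] at hEb hDb
    nlinarith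
  rw [← Nat.cast_pow, ← Nat.cast_pow, ← hTc, abs_le]
  have h1' : (S.ncard : ℝ) ≤ T.ncard := by exact_mod_cast h1
  have h4 : (T.ncard : ℝ) ≤ S.ncard + (2 * n + 1) * (Fintype.card F ^ (n - Q.natDegree - 1) : ℕ) := by
    exact_mod_cast h2.trans (Nat.add_le_add_left h3 _)
  have h5 : (0 : ℝ) ≤ (2 * n + 1) * (Fintype.card F ^ (n - Q.natDegree - 1) : ℕ) := by positivity
  constructor <;> linarith
end

section
/- Fix an integer n ≥ 3. There exists a constant C depending only on n such that for every finite field 𝔽_q with q odd, every integer h with 0 < h ≤ n−2, and every monic polynomial A ∈ 𝔽_q[t] of degree n, the number of squarefree polynomials in the short interval I(A;h) satisfies |#{f ∈ I(A;h) : f squarefree} − q^{h+1}(1 − 1/q)| ≤ C·q^h. -/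
open Polynomial

lemma aux_root {F : Type} [Field F] (f : F[X]) (hf : derivative f ≠ 0) (hs : ¬ Squarefree f) :
    ∃ a : AlgebraicClosure F, aeval a f = 0 ∧ aeval a (derivative f) = 0 := by
  unfold Squarefree at hs
  push Not at hs
  obtain ⟨d, ⟨e, he⟩, hd⟩ := hs
  have hd0 : d ≠ 0 := by
    rintro rfl
    apply hf
    rw [he]; simp
  have hdeg : d.degree ≠ 0 := fun h => hd (Polynomial.isUnit_iff_degree_eq_zero.2 h)
  obtain ⟨a, ha⟩ := IsAlgClosed.exists_aeval_eq_zero (AlgebraicClosure F) d hdeg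
  refine ⟨a, ?_, ?_⟩
  · rw [he]; simp [ha]
  · rw [he]; simp [derivative_mul, ha]

lemma aux_fibre {F : Type} [Field F] (n : ℕ) (s : Finset F[X])
    (hs : ∀ f ∈ s, ¬ Squarefree f ∧ derivative f ≠ 0 ∧ f.natDegree ≤ n)
    (hc : ∀ f ∈ s, ∀ g ∈ s, ∃ c, f = g + C c) : s.card ≤ n := by
  classical
  rcases s.eq_empty_or_nonempty with rfl | ⟨g, hg⟩
  · simp
  have key : ∀ f : F[X], ∃ a : AlgebraicClosure F,
      f ∈ s → aeval a f = 0 ∧ aeval a (derivative f) = 0 := by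
    intro f
    by_cases hf : f ∈ s
    · obtain ⟨a, ha⟩ := aux_root f (hs f hf).2.1 (hs f hf).1
      exact ⟨a, fun _ => ha⟩
    · exact ⟨0, fun h => absurd h hf⟩
  choose φ hφ using key
  set G := (derivative g).map (algebraMap F (AlgebraicClosure F)) with hG
  have hG0 : G ≠ 0 := (Polynomial.map_ne_zero_iff (algebraMap F _).injective).2 (hs g hg).2.1
  have h1 : s.card ≤ G.roots.toFinset.card := by
    apply Finset.card_le_card_of_injOn φ
    · intro f hf
      obtain ⟨c, rfl⟩ := hc f hf g hg
      have := (hφ _ hf).2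
      simp only [derivative_add, derivative_C, add_zero] at this
      simp only [Finset.mem_coe, Multiset.mem_toFinset, mem_roots hG0, IsRoot.def]
      rw [hG, eval_map_algebraMap]
      exact this
    · intro f hf f' hf' hff
      obtain ⟨c, rfl⟩ := hc f hf f' hf'
      have h1 := (hφ _ hf).1
      have h2 := (hφ _ hf').1
      rw [hff] at h1
      simp [h2] at h1
      simp [h1]
  calc s.card ≤ _ := h1
    _ ≤ G.roots.card := Multiset.toFinset_card_le _
    _ ≤ G.natDegree := card_roots' _
    _ ≤ (derivative g).natDegree := natDegree_map_le
    _ ≤ g.natDegree := (natDegree_derivative_le g).trans (Nat.sub_le _ _)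
    _ ≤ n := (hs g hg).2.2

lemma aux_card {F : Type} [Field F] [Fintype F] (h : ℕ) (A : F[X]) :
    {f : F[X] | (f - A).degree ≤ (h : WithBot ℕ)}.Finite ∧
    {f : F[X] | (f - A).degree ≤ (h : WithBot ℕ)}.ncard = Fintype.card F ^ (h + 1) := by
  let e : {f : F[X] | (f - A).degree ≤ (h : WithBot ℕ)} ≃ (Fin (h + 1) → F) :=
    (Equiv.subtypeEquiv (Equiv.subRight A) (by
      intro f
      simp only [Set.mem_ofPred_eq, Equiv.subRight_apply, mem_degreeLT]
      rw [Polynomial.degree_le_iff_coeff_zero, Polynomial.degree_lt_iff_coeff_zero]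
      constructor
      · intro H m hm
        exact H m (by exact_mod_cast hm)
      · intro H m hm
        exact H m (by exact_mod_cast hm))).trans (degreeLTEquiv F (h + 1)).toEquiv
  have : Finite {f : F[X] | (f - A).degree ≤ (h : WithBot ℕ)} := Finite.of_equiv _ e.symm
  refine ⟨Set.toFinite _, ?_⟩
  rw [← Nat.card_coe_set_eq, Nat.card_congr e]
  simp

lemma aux_bad {F : Type} [Field F] [Fintype F] (n h : ℕ) (hh : 0 < h) (hn : h + 2 ≤ n) (A : F[X])
    (hA : A.natDegree = n) (s : Finset F[X])
    (hs : ∀ f ∈ s, (f - A).degree ≤ (h : WithBot ℕ) ∧ ¬ Squarefree f) :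
    s.card ≤ (n + 1) * Fintype.card F ^ h := by
  classical
  have hco : ∀ f ∈ s, ∀ m, h < m → f.coeff m = A.coeff m := by
    intro f hf m hm
    have := (Polynomial.degree_le_iff_coeff_zero _ _).1 (hs f hf).1 m (by exact_mod_cast hm)
    rw [coeff_sub] at this
    exact sub_eq_zero.1 this
  have hT : (Finset.univ : Finset (Fin h → F)).card = Fintype.card F ^ h := by simp
  have h1 : (s.filter (fun f => derivative f = 0)).card ≤ Fintype.card F ^ h := by
    rw [← hT]
    apply Finset.card_le_card_of_injOn
      (fun f => fun i : Fin h => f.coeff (if i.1 = 0 then 0 else i.1 + 1))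
    · intro f _; simp
    · intro f hf g hg hfg
      simp only [Finset.coe_filter, Set.mem_ofPred_eq] at hf hg
      have c1 : ∀ f : F[X], derivative f = 0 → f.coeff 1 = 0 := by
        intro f hf
        have := congrArg (fun p => coeff p 0) hf
        simpa [coeff_derivative] using this
      ext m
      by_cases hm : h < m
      · rw [hco f hf.1 m hm, hco g hg.1 m hm]
      rcases m with _ | _ | m
      · have := congrFun hfg ⟨0, hh⟩
        simpa using this
      · rw [zero_add, c1 f hf.2, c1 g hg.2]
      · have := congrFun hfg ⟨m + 1, by omega⟩
        simpa using this
  have h2 : (s.filter (fun f => ¬ derivative f = 0)).card ≤ n * Fintype.card F ^ h := by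
    rw [← hT]
    apply Finset.card_le_mul_card_image_of_maps_to
      (f := fun f => fun i : Fin h => f.coeff (i.1 + 1))
    · intro f _; simp
    · intro b _
      apply aux_fibre
      · intro f hf
        simp only [Finset.mem_filter] at hf
        refine ⟨(hs f hf.1.1).2, hf.1.2, ?_⟩
        rw [natDegree_le_iff_coeff_eq_zero]
        intro N hN
        rw [hco f hf.1.1 N (by omega)]
        exact coeff_eq_zero_of_natDegree_lt (by omega)
      · intro f hf g hg
        simp only [Finset.mem_filter] at hf hg
        refine ⟨f.coeff 0 - g.coeff 0, ?_⟩
        ext m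
        rcases m with _ | m
        · simp
        · rw [coeff_add, coeff_C_succ, add_zero]
          by_cases hm : h < m + 1
          · rw [hco f hf.1.1 _ hm, hco g hg.1.1 _ hm]
          · exact congrFun (hf.2.trans hg.2.symm) ⟨m, by omega⟩
  rw [← Finset.card_filter_add_card_filter_not (s := s) (fun f => derivative f = 0)]
  linarith

/-- For fixed `n ≥ 3` there is a constant `C = C(n)` such that for every finite
field `𝔽_q` with `q` odd, every `0 < h ≤ n - 2`, and every monic `A` of degree `n`, the number
of squarefree polynomials in the short interval `I(A;h)` is `q^{h+1}(1 - 1/q) + O_n(q^h)`. -/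
theorem squarefree_count_short_interval (n : ℕ) (hn : 3 ≤ n) :
    ∃ C : ℝ, ∀ (Fq : Type) [Field Fq] [Fintype Fq],
      Odd (Fintype.card Fq) →
      ∀ h : ℕ, 0 < h → h + 2 ≤ n →
      ∀ A : Fq[X], A.Monic → A.natDegree = n →
        |({f : Fq[X] | (f - A).degree ≤ (h : WithBot ℕ) ∧ Squarefree f}.ncard : ℝ)
            - (Fintype.card Fq : ℝ) ^ (h + 1) * (1 - 1 / (Fintype.card Fq : ℝ))|
          ≤ C * (Fintype.card Fq : ℝ) ^ h := by
  refine ⟨n + 1, ?_⟩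
  intro Fq _ _ _ h hh hn A _ hA
  classical
  obtain ⟨hfin, hcard⟩ := aux_card h A
  set S := {f : Fq[X] | (f - A).degree ≤ (h : WithBot ℕ)} with hS
  set G := {f : Fq[X] | (f - A).degree ≤ (h : WithBot ℕ) ∧ Squarefree f} with hG
  have hGS : G ⊆ S := fun f hf => hf.1
  have hsum := Set.ncard_sdiff_add_ncard_of_subset hGS hfin
  have hBfin : (S \ G).Finite := hfin.subset Set.sdiff_subset
  have hB : (S \ G).ncard ≤ (n + 1) * Fintype.card Fq ^ h := by
    rw [Set.ncard_eq_toFinset_card _ hBfin]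
    apply aux_bad n h hh hn A hA
    intro f hf
    rw [Set.Finite.mem_toFinset] at hf
    exact ⟨hf.1, fun hq => hf.2 ⟨hf.1, hq⟩⟩
  rw [hcard] at hsum
  have hq : (Fintype.card Fq : ℝ) ≠ 0 := by
    exact_mod_cast Fintype.card_ne_zero
  have e1 : ((S \ G).ncard : ℝ) + (G.ncard : ℝ) = (Fintype.card Fq : ℝ) ^ (h + 1) := by
    exact_mod_cast hsum
  have e2 : ((S \ G).ncard : ℝ) ≤ ((n : ℝ) + 1) * (Fintype.card Fq : ℝ) ^ h := by
    exact_mod_cast hB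
  have e3 : (Fintype.card Fq : ℝ) ^ (h + 1) * (1 - 1 / (Fintype.card Fq : ℝ))
      = (Fintype.card Fq : ℝ) ^ (h + 1) - (Fintype.card Fq : ℝ) ^ h := by
    field_simp
    ring
  have e4 : (0 : ℝ) ≤ (Fintype.card Fq : ℝ) ^ h := by positivity
  have e5 : (0 : ℝ) ≤ ((S \ G).ncard : ℝ) := by positivity
  have e6 : (0 : ℝ) ≤ (n : ℝ) * (Fintype.card Fq : ℝ) ^ h := by positivity
  rw [e3, abs_le]
  constructor <;> linarith
end

section
/- Let p be an odd prime, q = p^k a power of p, and n a positive integer with 2p ∣ n. Then the Möbius sum over the short interval I(t^n;1) = {t^n + a·t + b : a, b ∈ 𝔽_q} satisfies |Σ_{a,b∈𝔽_q} μ(t^n + a·t + b)| = q(q−1). In particular there is no cancellation beyond one factor: |N_μ(t^n;1)| ≫ q² = #I(t^n;1). -/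
open Polynomial

theorem aux_card_image {α β γ : Type*} [DecidableEq β] [DecidableEq γ] (s : Finset α) (f : α → β)
    (g : α → γ) (h : ∀ x ∈ s, ∀ y ∈ s, f x = f y ↔ g x = g y) :
    (s.image f).card = (s.image g).card := by
  classical
  have h1 : (s.image fun x => (f x, g x)).card = (s.image f).card := by
    rw [← Finset.card_image_of_injOn (s := s.image fun x => (f x, g x)) (f := Prod.fst)]
    · rw [Finset.image_image]; rfl
    · intro u hu v hv huv
      simp only [Finset.coe_image, Set.mem_image, Finset.mem_coe] at hu hv
      obtain ⟨x, hx, rfl⟩ := hu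
      obtain ⟨y, hy, rfl⟩ := hv
      exact Prod.ext huv ((h x hx y hy).1 huv)
  have h2 : (s.image fun x => (f x, g x)).card = (s.image g).card := by
    rw [← Finset.card_image_of_injOn (s := s.image fun x => (f x, g x)) (f := Prod.snd)]
    · rw [Finset.image_image]; rfl
    · intro u hu v hv huv
      simp only [Finset.coe_image, Set.mem_image, Finset.mem_coe] at hu hv
      obtain ⟨x, hx, rfl⟩ := hu
      obtain ⟨y, hy, rfl⟩ := hv
      exact Prod.ext ((h x hx y hy).2 huv) huv
  omega

theorem aux_sign {α β : Type*} [Fintype α] [DecidableEq α] [DecidableEq β] (σ : Equiv.Perm α)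
    (g : α → β) (h : ∀ x y, g x = g y ↔ σ.SameCycle x y) :
    Equiv.Perm.sign σ = (-1) ^ (Fintype.card α + (Finset.univ.image g).card) := by
  classical
  have h1 : (σ.support.image g).card = σ.cycleType.card := by
    have : σ.support.image σ.cycleOf = σ.cycleFactorsFinset := by
      ext c
      simp only [Finset.mem_image]
      constructor
      · rintro ⟨x, hx, rfl⟩
        exact Equiv.Perm.cycleOf_mem_cycleFactorsFinset_iff.2 hx
      · intro hc
        have hc' := (Equiv.Perm.mem_cycleFactorsFinset_iff.1 hc)
        obtain ⟨x, hx, -⟩ := hc'.1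
        have hx' : x ∈ c.support := by simpa using hx
        exact ⟨x, Equiv.Perm.mem_cycleFactorsFinset_support_le hc hx',
          (Equiv.Perm.cycle_is_cycleOf hx' hc).symm⟩
    rw [Equiv.Perm.cycleType_def, Multiset.card_map, ← Finset.card_def, ← this]
    apply aux_card_image
    intro x hx y hy
    rw [h, Equiv.Perm.sameCycle_iff_cycleOf_eq_of_mem_support hx hy]
  have h2 : (σ.supportᶜ.image g).card = σ.supportᶜ.card := by
    apply Finset.card_image_of_injOn
    intro x hx y hy hxy
    have := (h x y).1 hxy
    simp only [Finset.coe_compl, Set.mem_compl_iff, Finset.mem_coe, Equiv.Perm.notMem_support] at hx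
    exact (this.eq_of_left hx)
  have h3 : (Finset.univ.image g).card = (σ.support.image g).card + (σ.supportᶜ.image g).card := by
    rw [← Finset.card_union_of_disjoint, ← Finset.image_union, Finset.union_compl]
    rw [Finset.disjoint_left]
    simp only [Finset.mem_image, not_exists, not_and]
    rintro _ ⟨x, hx, rfl⟩ y hy hxy
    have := (h y x).1 hxy
    simp only [Finset.mem_compl, Equiv.Perm.notMem_support] at hy
    have h5 := this.eq_of_left hy
    subst h5
    simp at hx
    exact hx hy
  have h4 := Finset.card_add_card_compl σ.support
  rw [Equiv.Perm.sign_of_cycleType, Equiv.Perm.sum_cycleType, h3, h2, h1, ← h4,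
    show σ.support.card + σ.supportᶜ.card + (σ.cycleType.card + σ.supportᶜ.card) =
      (σ.support.card + σ.cycleType.card) + 2 * σ.supportᶜ.card by ring, pow_add _ _ (2 * _), pow_mul]
  simp

theorem aux_delta {L : Type*} [Field L] (n : ℕ) (r : Fin n → L) (a : L) (f : L[X])
    (hf : f = ∏ i, (X - C (r i))) (hd : derivative f = C a) :
    (Matrix.vandermonde r).det ^ 2 = (-1) ^ (∑ i : Fin n, (Finset.Ioi i).card) * a ^ n := by
  have h1 : ∀ i, ∏ j ∈ ({i}ᶜ : Finset (Fin n)), (r i - r j) = a := by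
    intro i
    have := congrArg (eval (r i)) hd
    rw [hf, derivative_prod_finset, eval_finsetSum, Finset.sum_eq_single i] at this
    · simp only [eval_mul, eval_prod, derivative_X_sub_C, eval_one, mul_one, eval_sub, eval_X,
        eval_C] at this
      rw [← this]
      congr 1
      ext; simp
    · intro j _ hj
      rw [eval_mul, eval_prod, Finset.prod_eq_zero (i := i)]
      · simp
      · simp [hj.symm]
      · simp
    · simp
  have h2 : ∏ i, ∏ j ∈ Finset.Ioi i, (r i - r j) * (r j - r i) = a ^ n := by
    rw [Finset.prod_prod_Ioi_mul_eq_prod_prod_off_diag (fun j i => r i - r j)]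
    simp [h1]
  rw [Matrix.det_vandermonde, ← h2, ← Finset.prod_pow_eq_pow_sum, ← Finset.prod_pow,
    ← Finset.prod_mul_distrib]
  refine Finset.prod_congr rfl fun i _ => ?_
  rw [← Finset.prod_const, ← Finset.prod_pow, ← Finset.prod_mul_distrib]
  refine Finset.prod_congr rfl fun j _ => ?_
  ring

theorem aux_mu {K : Type} [Field K] [Fintype K] (n : ℕ) (hn : Even n)
    (hq : Odd (Fintype.card K)) (f : K[X]) (hm : f.Monic) (hdeg : f.natDegree = n) (a : K)
    (ha : a ≠ 0) (hd : derivative f = C a) :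
    Squarefree f ∧ (-1 : ℤ) ^ (UniqueFactorizationMonoid.factors f).card =
      ((-1) ^ (∑ i : Fin n, (Finset.Ioi i).card)) ^ ((Fintype.card K - 1) / 2) := by
  classical
  have hsep : f.Separable := by
    rw [Polynomial.Separable, hd]
    exact ⟨0, C a⁻¹, by rw [← C_mul, inv_mul_cancel₀ ha]; simp⟩
  have hsq := hsep.squarefree
  have hf0 := hm.ne_zero
  refine ⟨hsq, ?_⟩
  let L := f.SplittingField
  let φ := FiniteField.frobeniusAlgEquivOfAlgebraic K L
  have hφ : ∀ x, φ x = x ^ Fintype.card K := fun x => rfl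
  have hsp : (f.map (algebraMap K L)).Splits := SplittingField.splits f
  have hcard := card_rootSet_eq_natDegree hsep hsp
  rw [hdeg] at hcard
  let e : Fin n ≃ f.rootSet L := (Fintype.equivFinOfCardEq hcard).symm
  let r : Fin n → L := fun i => (e i : L)
  have hr : Function.Injective r := Subtype.val_injective.comp e.injective
  have hmem : ∀ x : L, aeval x f = 0 ↔ ∃ i, r i = x := by
    intro x
    constructor
    · intro hx
      exact ⟨e.symm ⟨x, (mem_rootSet_of_ne hf0).2 hx⟩, by simp [r]⟩
    · rintro ⟨i, rfl⟩
      exact (mem_rootSet_of_ne hf0).1 (e i).2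
  have hprod : f.map (algebraMap K L) = ∏ i, (X - C (r i)) := by
    rw [hsp.eq_prod_roots_of_monic (hm.map _)]
    have : (f.map (algebraMap K L)).roots = (Finset.univ.image r).val := by
      refine (Multiset.Nodup.ext (nodup_roots hsep.map) (Finset.nodup _)).2 fun x => ?_
      rw [mem_roots (hm.map _).ne_zero, IsRoot.def, eval_map_algebraMap, hmem]
      simp
    rw [this]
    change ∏ x ∈ Finset.univ.image r, (X - C x) = _
    rw [Finset.prod_image (fun x _ y _ h => hr h)]
  have hτ : ∀ i, ∃ j, r j = φ (r i) := by
    intro i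
    rw [← hmem]
    have := (hmem (r i)).2 ⟨i, rfl⟩
    rw [← AlgEquiv.coe_toAlgHom, aeval_algHom_apply, this, map_zero]
  choose τf hτf using hτ
  have hinj : Function.Injective τf := by
    intro i j hij
    apply hr
    apply φ.injective
    rw [← hτf, ← hτf, hij]
  let τ : Equiv.Perm (Fin n) := Equiv.ofBijective τf (Finite.injective_iff_bijective.1 hinj)
  have hτ : ∀ i, r (τ i) = φ (r i) := hτf
  have hτk : ∀ (k : ℕ) i, r ((τ ^ k) i) = (φ ^ k) (r i) := by
    intro k
    induction k with
    | zero => simp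
    | succ k ih => intro i; rw [pow_succ', pow_succ', Equiv.Perm.mul_apply, AlgEquiv.mul_apply, hτ, ih]
  have hsame : ∀ i j, minpoly K (r i) = minpoly K (r j) ↔ τ.SameCycle i j := by
    intro i j
    constructor
    · intro h
      obtain ⟨s, hs⟩ := (isConjRoot_iff_exists_algEquiv (K := K)).1
        (show IsConjRoot K (r j) (r i) from h.symm)
      obtain ⟨k, hk⟩ := (FiniteField.bijective_frobeniusAlgEquivOfAlgebraic_pow K L).2 s
      refine ⟨(k.1 : ℤ), hr ?_⟩
      rw [zpow_natCast, hτk, ← hs, ← hk]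
    · intro h
      obtain ⟨k, -, hk⟩ := h.exists_pow_eq'
      rw [← hk, hτk]
      exact (minpoly.algEquiv_eq _ _).symm
  have hsign := aux_sign τ (fun i => minpoly K (r i)) hsame
  have hfac : (UniqueFactorizationMonoid.factors f).card =
      (Finset.univ.image (fun i => minpoly K (r i))).card := by
    have h1 : (UniqueFactorizationMonoid.factors f).card =
        (UniqueFactorizationMonoid.normalizedFactors f).card := by
      rw [UniqueFactorizationMonoid.normalizedFactors, Multiset.card_map]
    rw [h1, ← Multiset.toFinset_card_of_nodup
      ((UniqueFactorizationMonoid.squarefree_iff_nodup_normalizedFactors hf0).1 hsq)]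
    congr 1
    ext P
    rw [Multiset.mem_toFinset, Polynomial.mem_normalizedFactors_iff hf0]
    simp only [Finset.mem_image, Finset.mem_univ, true_and]
    constructor
    · rintro ⟨hi, hmo, hdv⟩
      have hPs : (P.map (algebraMap K L)).Splits :=
        hsp.of_dvd (map_ne_zero hf0) (Polynomial.map_dvd _ hdv)
      obtain ⟨x, hx⟩ := hPs.exists_eval_eq_zero (by
        rw [degree_map]; exact (degree_pos_of_irreducible hi).ne')
      rw [eval_map_algebraMap] at hx
      obtain ⟨Q, hQ⟩ := hdv
      obtain ⟨i, hi'⟩ := (hmem x).1 (by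
        have h5 := congrArg (aeval x) hQ
        rw [map_mul, hx, zero_mul] at h5
        exact h5)
      refine ⟨i, ?_⟩
      rw [hi']
      exact (minpoly.eq_of_irreducible_of_monic hi hx hmo).symm
    · rintro ⟨i, rfl⟩
      have hint : IsIntegral K (r i) := Algebra.IsIntegral.isIntegral _
      exact ⟨minpoly.irreducible hint, minpoly.monic hint,
        minpoly.dvd _ _ ((hmem (r i)).2 ⟨i, rfl⟩)⟩
  rw [← hfac, Fintype.card_fin, pow_add, hn.neg_one_pow, one_mul] at hsign
  set δ := (Matrix.vandermonde r).det with hδ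
  have hδ0 : δ ≠ 0 := Matrix.det_vandermonde_ne_zero_iff.2 hr
  have hδφ : φ δ = ((Equiv.Perm.sign τ : ℤ) : L) * δ := by
    rw [hδ, AlgEquiv.map_det, ← Matrix.det_permute]
    congr 1
    ext i j
    simp [Matrix.vandermonde_apply, hτ]
  have hδ2 := aux_delta n r (algebraMap K L a) _ hprod (by rw [derivative_map, hd, map_C])
  rw [← hδ] at hδ2
  obtain ⟨m, hm⟩ := hq
  have hm' : (Fintype.card K - 1) / 2 = m := by omega
  rw [hm']
  have ham : (algebraMap K L a) ^ (2 * m) = 1 := by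
    rw [← map_pow, show 2 * m = Fintype.card K - 1 by omega, FiniteField.pow_card_sub_one_eq_one a ha,
      map_one]
  obtain ⟨n', hn'⟩ := hn.two_dvd
  have key : ((-1 : L)) ^ (UniqueFactorizationMonoid.factors f).card =
      ((-1) ^ (∑ i : Fin n, (Finset.Ioi i).card)) ^ m := by
    rw [hφ, hm, pow_succ, pow_mul, hδ2] at hδφ
    have := mul_right_cancel₀ hδ0 hδφ
    rw [hsign, mul_pow, hn', ← pow_mul (algebraMap K L a), show 2 * n' * m = 2 * m * n' by ring,
      pow_mul (algebraMap K L a), ham] at this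
    subst hn'
    simpa using this.symm
  have h2 : (2 : L) ≠ 0 := by
    have : (2 : K) ≠ 0 := by
      apply Ring.two_ne_zero
      intro hc
      have := FiniteField.even_card_of_char_two hc
      omega
    have h3 := (map_ne_zero (algebraMap K L)).2 this
    rwa [map_ofNat] at h3
  have h11 : (-1 : L) ≠ 1 := by
    intro h
    apply h2
    linear_combination -h
  rcases neg_one_pow_eq_or ℤ (UniqueFactorizationMonoid.factors f).card with h | h <;>
  rcases neg_one_pow_eq_or ℤ ((∑ i : Fin n, (Finset.Ioi i).card) * m) with h' | h' <;>
  · rw [pow_mul] at h'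
    have e1 := congrArg (Int.cast : ℤ → L) h
    have e2 := congrArg (Int.cast : ℤ → L) h'
    push_cast at e1 e2
    rw [e1, e2] at key
    rw [h, h']
    first | done | exact absurd key h11 | exact absurd key.symm h11

/-- Let `p` be an odd prime, `q = p^k`, and `n > 0` with `2p ∣ n`. Then the
Möbius sum over the short interval `I(t^n; 1) = {t^n + a·t + b : a, b ∈ 𝔽_q}` has absolute
value exactly `q(q - 1)`; in particular there is no cancellation beyond one factor. -/
theorem mobius_no_cancellation_h_one (p : ℕ) (hp : p.Prime) (hpodd : Odd p)
    (k : ℕ) (hk : 0 < k) (Fq : Type) [Field Fq] [Fintype Fq]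
    (hq : Fintype.card Fq = p ^ k) (n : ℕ) (hn : 0 < n) (hdvd : 2 * p ∣ n) :
    |∑ a : Fq, ∑ b : Fq, polyMu ((X : Fq[X]) ^ n + C a * X + C b)|
      = (Fintype.card Fq : ℤ) * ((Fintype.card Fq : ℤ) - 1) := by
  classical
  haveI : Fact p.Prime := ⟨hp⟩
  haveI : CharP Fq p := charP_of_card_eq_prime_pow hq
  have hpn : p ∣ n := (Dvd.intro_left 2 rfl).trans hdvd
  have hev : Even n := (even_iff_two_dvd).2 ((Dvd.intro p rfl).trans hdvd)
  have hp2 := hp.two_le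
  have hn1 : 1 < n := lt_of_lt_of_le hp2 (Nat.le_of_dvd hn hpn)
  have hodd : Odd (Fintype.card Fq) := hq ▸ hpodd.pow
  set ε : ℤ := ((-1) ^ (∑ i : Fin n, (Finset.Ioi i).card)) ^ ((Fintype.card Fq - 1) / 2) with hε
  have h0 : ∀ b : Fq, polyMu ((X : Fq[X]) ^ n + C 0 * X + C b) = 0 := by
    intro b
    obtain ⟨m, hm⟩ := hpn
    have hm0 : m ≠ 0 := by rintro rfl; omega
    obtain ⟨k', rfl⟩ : ∃ k', k = k' + 1 := ⟨k - 1, by omega⟩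
    have hb : (b ^ p ^ k') ^ p = b := by
      rw [← pow_mul, ← pow_succ, ← hq, FiniteField.pow_card]
    have : (X : Fq[X]) ^ n + C 0 * X + C b = (X ^ m + C (b ^ p ^ k')) ^ p := by
      rw [add_pow_char, ← C_pow, hb, ← pow_mul, mul_comm m p, ← hm]; simp
    rw [polyMu, this, if_neg]
    intro hs
    have hu := hs (X ^ m + C (b ^ p ^ k')) (by rw [← pow_two]; exact pow_dvd_pow _ hp2)
    have := natDegree_eq_zero_of_isUnit hu
    rw [natDegree_X_pow_add_C] at this
    exact hm0 this
  have h1 : ∀ a : Fq, a ≠ 0 → ∀ b : Fq, polyMu ((X : Fq[X]) ^ n + C a * X + C b) = ε := by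
    intro a ha b
    have hdl : (C a * X + C b : Fq[X]).degree < n :=
      lt_of_le_of_lt degree_linear_le (by exact_mod_cast hn1)
    have hmon : ((X : Fq[X]) ^ n + C a * X + C b).Monic := by
      rw [add_assoc]; exact monic_X_pow_add hdl
    have hdeg : ((X : Fq[X]) ^ n + C a * X + C b).natDegree = n := by
      rw [add_assoc]; exact natDegree_eq_of_degree_eq_some (by
        rw [degree_add_eq_left_of_degree_lt (by rwa [degree_X_pow]), degree_X_pow])
    have hder : derivative ((X : Fq[X]) ^ n + C a * X + C b) = C a := by
      have : (n : Fq) = 0 := (CharP.cast_eq_zero_iff Fq p n).2 hpn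
      simp [derivative_X_pow, this]
    obtain ⟨hs, he⟩ := aux_mu n hev hodd _ hmon hdeg a ha hder
    rw [polyMu, if_pos hs, he]
  have hsum : ∑ a : Fq, ∑ b : Fq, polyMu ((X : Fq[X]) ^ n + C a * X + C b) =
      ((Fintype.card Fq : ℤ) * ((Fintype.card Fq : ℤ) - 1)) * ε := by
    rw [← Finset.add_sum_erase _ _ (Finset.mem_univ (0 : Fq))]
    rw [Finset.sum_eq_zero (fun b _ => h0 b), zero_add,
      Finset.sum_congr rfl (fun a ha => Finset.sum_congr rfl
        (fun b _ => h1 a (Finset.ne_of_mem_erase ha) b))]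
    have hc : 1 ≤ Fintype.card Fq := Fintype.card_pos
    simp only [Finset.sum_const, Finset.card_univ, nsmul_eq_mul,
      Finset.card_erase_of_mem (Finset.mem_univ _), Nat.cast_sub hc]
    push_cast
    ring
  have habs : |ε| = 1 := by rw [hε, abs_pow, abs_pow]; simp
  have hc : (1 : ℤ) ≤ Fintype.card Fq := by exact_mod_cast Fintype.card_pos
  rw [hsum, abs_mul, habs, mul_one, abs_of_nonneg]
  exact mul_nonneg (by omega) (by omega)
end

section
/- Let α : 𝔽_q[t] → ℂ be even (α(cf) = α(f) for all c ∈ 𝔽_q^×), symmetric (α(f*) = α(f) whenever f(0) ≠ 0, where f*(t) = t^{deg f}·f(1/t)), and weakly multiplicative (α(t^k·f) = α(t^k)·α(f) whenever f(0) ≠ 0). Then for 0 ≤ h ≤ n−2 and every B ∈ M_{n−h−1}: N_α(t^{h+1}B; h) = q^{h+1}·⟨α⟩_n + (1/q^{n−h−1})·Σ_{m=0}^{n} α(t^{n−m})·Σ_{χ ≠ χ₀ even mod t^{n−h}} conj(χ)(θ_{n−h−1}(B))·M(m; αχ), where the inner sum is over nontrivial even Dirichlet characters χ modulo t^{n−h},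 M(m; αχ) = Σ_{f∈M_m} α(f)·χ(f), ⟨α⟩_n = (1/q^n)·Σ_{f∈M_n} α(f), and q^{n−h−1} is the number of even characters modulo t^{n−h}. -/
open Polynomial

theorem sicf_sum_all (R : Type) [CommRing R] [Finite R] [Fintype (MulChar R ℂ)] [DecidableEq R]
    (a : R) : ∑ χ : MulChar R ℂ, χ a = if a = 1 then (Nat.card Rˣ : ℂ) else 0 := by
  have : NeZero (Monoid.exponent Rˣ : ℂ) :=
    ⟨by exact_mod_cast Monoid.exponent_ne_zero_of_finite⟩
  split_ifs with ha
  · rw [ha, ← MulChar.card_eq_card_units_of_hasEnoughRootsOfUnity R ℂ]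
    simp
  · obtain ⟨χ, hχ⟩ := MulChar.exists_apply_ne_one_of_hasEnoughRootsOfUnity R ℂ ha
    refine eq_zero_of_mul_eq_self_left hχ ?_
    simp only [Finset.mul_sum, ← MulChar.mul_apply]
    exact Fintype.sum_bijective _ (Group.mulLeft_bijective χ) _ _ fun χ' ↦ rfl

theorem sicf_sum_inv (R : Type) [CommRing R] [Finite R] [Fintype (MulChar R ℂ)] [DecidableEq R]
    (b a : R) (hb : IsUnit b) :
    ∑ χ : MulChar R ℂ, (starRingEnd ℂ) (χ b) * χ a = if a = b then (Nat.card Rˣ : ℂ) else 0 := by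
  have h1 : ∀ χ : MulChar R ℂ, (starRingEnd ℂ) (χ b) * χ a = χ (Ring.inverse b * a) := by
    intro χ
    rw [map_mul, ← MulChar.inv_apply, ← MulChar.star_apply']
    rfl
  simp only [h1, sicf_sum_all]
  congr 1
  apply propext
  constructor
  · intro h
    have := congrArg (b * ·) h
    simpa [← mul_assoc, Ring.mul_inverse_cancel _ hb] using this
  · rintro rfl
    exact Ring.inverse_mul_cancel _ hb

theorem sicf_even (K R : Type) [Field K] [Fintype K] [CommRing R] [Finite R]
    [Fintype (MulChar R ℂ)] [DecidableEq R] [DecidableEq K] (i : K →+* R) (b g : R) (hb : IsUnit b)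
    [DecidablePred fun χ : MulChar R ℂ => ∀ c : K, c ≠ 0 → χ (i c) = 1] :
    (Fintype.card Kˣ : ℂ) * ∑ χ : MulChar R ℂ with (∀ c : K, c ≠ 0 → χ (i c) = 1),
      (starRingEnd ℂ) (χ b) * χ g
      = (Nat.card Rˣ : ℂ) * ∑ c : Kˣ, if i c * g = b then 1 else 0 := by
  have h1 : ∀ χ : MulChar R ℂ, ∑ c : Kˣ, χ (i c)
      = if (∀ c : K, c ≠ 0 → χ (i c) = 1) then (Fintype.card Kˣ : ℂ) else 0 := by
    intro χ
    classical
    let f : Kˣ →* ℂ := (χ.toMonoidHom.comp i.toMonoidHom).comp (Units.coeHom K)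
    have h2 : ∀ c : Kˣ, f c = χ (i c) := fun c => rfl
    have h3 : f = 1 ↔ (∀ c : K, c ≠ 0 → χ (i c) = 1) := by
      constructor
      · intro h c hc
        have := DFunLike.congr_fun h (Units.mk0 c hc)
        simpa [h2] using this
      · intro h
        ext c
        simpa [h2] using h c c.ne_zero
    have := sum_hom_units f
    simp only [h2] at this
    rw [this]
    simp only [h3]
    split_ifs <;> simp
  rw [Finset.sum_filter, Finset.mul_sum, Finset.mul_sum]
  have h4 : ∀ c : Kˣ, (Nat.card Rˣ : ℂ) * (if i c * g = b then 1 else 0)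
      = ∑ χ : MulChar R ℂ, (starRingEnd ℂ) (χ b) * χ (i c * g) := by
    intro c
    rw [sicf_sum_inv R b _ hb]
    split_ifs <;> simp
  simp only [h4]
  rw [Finset.sum_comm]
  apply Finset.sum_congr rfl
  intro χ _
  have : ∑ c : Kˣ, (starRingEnd ℂ) (χ b) * χ (i c * g)
      = (∑ c : Kˣ, χ (i c)) * ((starRingEnd ℂ) (χ b) * χ g) := by
    rw [Finset.sum_mul]
    apply Finset.sum_congr rfl
    intro c _
    rw [map_mul]; ring
  rw [this, h1]
  split_ifs <;> simp

theorem sicf_isUnit (K : Type) [Field K] (N : ℕ) (hN : N ≠ 0) (g : K[X]) :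
    IsUnit (Ideal.Quotient.mk (Ideal.span {(X : K[X]) ^ N}) g) ↔ g.coeff 0 ≠ 0 := by
  constructor
  · intro h h0
    obtain ⟨r, hr⟩ := h.exists_right_inv
    obtain ⟨p, rfl⟩ := Ideal.Quotient.mk_surjective r
    rw [← map_mul, ← map_one (Ideal.Quotient.mk _), Ideal.Quotient.eq, Ideal.mem_span_singleton,
      X_pow_dvd_iff] at hr
    have := hr 0 (Nat.pos_of_ne_zero hN)
    simp [h0] at this
  · intro h
    have hc : IsCoprime ((X : K[X]) ^ N) g := by
      apply IsCoprime.pow_left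
      rw [irreducible_X.coprime_iff_not_dvd, X_dvd_iff]
      exact h
    obtain ⟨u, v, huv⟩ := hc
    apply IsUnit.of_mul_eq_one_right (Ideal.Quotient.mk _ v)
    rw [← map_mul, ← map_one (Ideal.Quotient.mk _), Ideal.Quotient.eq, Ideal.mem_span_singleton]
    exact ⟨-u, by rw [← huv]; ring⟩

theorem sicf_finite (K : Type) [Field K] [Fintype K] (N : ℕ) :
    Finite (K[X] ⧸ Ideal.span {(X : K[X]) ^ N}) := by
  have e := (AdjoinRoot.powerBasisAux' (monic_X_pow (R := K) N)).equivFun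
  exact Finite.of_equiv _ e.symm.toEquiv

theorem sicf_card (K : Type) [Field K] [Fintype K] (N : ℕ) :
    Nat.card (K[X] ⧸ Ideal.span {(X : K[X]) ^ N}) = Fintype.card K ^ N := by
  have e := (AdjoinRoot.powerBasisAux' (monic_X_pow (R := K) N)).equivFun
  refine (Nat.card_congr e.toEquiv).trans ?_
  simp

theorem sicf_card_units (K : Type) [Field K] [Fintype K] [DecidableEq K] (N : ℕ) (hN : N ≠ 0) :
    Nat.card (K[X] ⧸ Ideal.span {(X : K[X]) ^ N})ˣ
      = Fintype.card Kˣ * Fintype.card K ^ (N - 1) := by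
  classical
  have := sicf_finite K N
  have hcard := sicf_card K N
  have hun := sicf_isUnit K N hN
  set R := (K[X] ⧸ Ideal.span {(X : K[X]) ^ N}) with hR
  have : Fintype R := Fintype.ofFinite R
  let ε : R →+* K := Ideal.Quotient.lift _ (constantCoeff (R := K)) (by
    intro a ha
    rw [Ideal.mem_span_singleton, X_pow_dvd_iff] at ha
    exact ha 0 (Nat.pos_of_ne_zero hN))
  have hε : ∀ g, ε (Ideal.Quotient.mk _ g) = g.coeff 0 := fun g => rfl
  have hsurj : ∀ c : K, c ∈ Set.range ε := fun c => ⟨Ideal.Quotient.mk _ (C c), by simp [hε]⟩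
  have hu : ∀ r : R, IsUnit r ↔ ε r ≠ 0 := by
    intro r
    obtain ⟨g, rfl⟩ := Ideal.Quotient.mk_surjective r
    rw [hε]; exact hun g
  have hfib : ∀ c : K, (Finset.univ.filter fun r : R => ε r = c).card
      = (Finset.univ.filter fun r : R => ε r = 0).card := fun c =>
    AddMonoidHom.card_fiber_eq_of_mem_range ε.toAddMonoidHom (hsurj c) (hsurj 0)
  set F := (Finset.univ.filter fun r : R => ε r = 0).card with hF
  have h1 : Fintype.card R = Fintype.card K * F := by
    rw [← Finset.card_univ, Finset.card_eq_sum_card_fiberwise (f := ε) (t := Finset.univ)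
      (by intro x _; simp)]
    simp [hfib]
  have h2 : Fintype.card Rˣ = Fintype.card Kˣ * F := by
    have : Fintype.card Rˣ = (Finset.univ.filter fun r : R => ε r ≠ 0).card := by
      rw [← Finset.card_univ]
      refine Finset.card_bij (fun (u : Rˣ) _ => (u : R)) ?_ ?_ ?_
      · intro u _
        simpa using (hu u).1 u.isUnit
      · intro a _ b _ h
        exact Units.ext h
      · intro r hr
        have := (hu r).2 (by simpa using hr)
        exact ⟨this.unit, by simp, rfl⟩
    have h3 := Finset.card_filter_add_card_filter_not (s := (Finset.univ : Finset R))
      (fun r : R => ε r = 0)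
    rw [Finset.card_univ, h1, ← hF] at h3
    rw [this, Fintype.card_units, Nat.sub_mul]
    simp only [ne_eq]
    omega
  rw [Nat.card_eq_fintype_card, h2]
  rw [Nat.card_eq_fintype_card, h1] at hcard
  congr 1
  obtain ⟨M, rfl⟩ := Nat.exists_eq_succ_of_ne_zero hN
  rw [pow_succ, mul_comm] at hcard
  simpa using Nat.eq_of_mul_eq_mul_right Fintype.card_pos hcard

theorem sicf_finM (K : Type) [Field K] [Fintype K] (n : ℕ) :
    {f : K[X] | f.Monic ∧ f.natDegree = n}.Finite := by
  have : Finite (degreeLT K (n+1)) := Finite.of_equiv _ (degreeLTEquiv K (n+1)).symm.toEquiv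
  refine Set.Finite.subset (s := (degreeLT K (n+1) : Set K[X])) (Set.toFinite _) ?_
  rintro f ⟨hf, hd⟩
  simp only [SetLike.mem_coe, mem_degreeLT]
  rw [degree_eq_natDegree hf.ne_zero, hd]
  exact_mod_cast Nat.lt_succ_self n

/-- the reversal bijection -/
noncomputable def sicfPhi {K : Type} [Field K] (n : ℕ) (g : K[X]) : K[X] :=
  C (g.coeff 0)⁻¹ * reflect n g

theorem sicf_natDegree_reflect {K : Type} [Field K] (n : ℕ) (g : K[X]) (hg : g.natDegree ≤ n)
    (h0 : g.coeff 0 ≠ 0) : (reflect n g).natDegree = n := by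
  apply le_antisymm
  · exact natDegree_reflect_le.trans (by simp [hg])
  · apply le_natDegree_of_ne_zero
    simpa [coeff_reflect] using h0

theorem sicf_phi_monic {K : Type} [Field K] (n : ℕ) (g : K[X]) (hg : g.natDegree ≤ n)
    (h0 : g.coeff 0 ≠ 0) : (sicfPhi n g).Monic ∧ (sicfPhi n g).natDegree = n := by
  have h1 := sicf_natDegree_reflect n g hg h0
  have h2 : (sicfPhi n g).natDegree = n := by
    rw [sicfPhi, natDegree_C_mul (inv_ne_zero h0), h1]
  refine ⟨?_, h2⟩
  rw [Monic, leadingCoeff, h2, sicfPhi, coeff_C_mul, coeff_reflect]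
  simp [h0]

theorem sicf_reflect_reflect {K : Type} [Field K] (n : ℕ) (g : K[X]) (hg : g.natDegree ≤ n) :
    reflect n g = X ^ (n - g.natDegree) * reflect g.natDegree g := by
  obtain ⟨k, hk⟩ := Nat.exists_eq_add_of_le' hg
  have := reflect_mul (1 : K[X]) g (F := k) (G := g.natDegree) (by simp) le_rfl
  rw [one_mul, reflect_one, ← hk] at this
  rw [this]
  congr 2
  omega

theorem sicf_key (K : Type) [Field K] [Fintype K] (n : ℕ) (α w : K[X] → ℂ)
    (heven : ∀ (c : K), c ≠ 0 → ∀ f : K[X], α (C c * f) = α f)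
    (hsym : ∀ f : K[X], f.coeff 0 ≠ 0 → α (Polynomial.reflect f.natDegree f) = α f)
    (hmul : ∀ (k : ℕ) (f : K[X]), f.coeff 0 ≠ 0 → α ((X : K[X]) ^ k * f) = α (X ^ k) * α f)
    [DecidableEq K] :
    ∑ f ∈ (sicf_finM K n).toFinset, w f * α f
      = ∑ m ∈ Finset.range (n + 1), α ((X : K[X]) ^ (n - m)) *
        ∑ g ∈ (sicf_finM K m).toFinset, if g.coeff 0 ≠ 0 then w (sicfPhi n g) * α g else 0 := by
  simp only [Finset.mul_sum, ← Finset.sum_filter]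
  rw [Finset.sum_sigma']
  symm
  refine Finset.sum_bij (fun x _ => sicfPhi n x.2) ?_ ?_ ?_ ?_
  · rintro ⟨m, g⟩ hx
    simp only [Finset.mem_sigma, Finset.mem_range, Finset.mem_filter, Set.Finite.mem_toFinset,
      Set.mem_ofPred_eq] at hx ⊢
    exact sicf_phi_monic n g (by omega) hx.2.2
  · rintro ⟨m, g⟩ hx ⟨m', g'⟩ hx' h
    simp only [Finset.mem_sigma, Finset.mem_range, Finset.mem_filter, Set.Finite.mem_toFinset,
      Set.mem_ofPred_eq] at hx hx' h
    have h1 : C (g.coeff 0)⁻¹ * g = C (g'.coeff 0)⁻¹ * g' := by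
      have := congrArg (reflect n) h
      simpa [sicfPhi, reflect_C_mul] using this
    have h2 : (g.coeff 0)⁻¹ = (g'.coeff 0)⁻¹ := by
      have := congrArg leadingCoeff h1
      simpa [leadingCoeff_mul, hx.2.1.1.leadingCoeff, hx'.2.1.1.leadingCoeff] using this
    have h3 : g = g' := by
      rw [h2] at h1
      exact mul_left_cancel₀ (by simpa using hx'.2.2) h1
    have h4 : m = m' := by rw [← hx.2.1.2, ← hx'.2.1.2, h3]
    subst h3 h4; rfl
  · intro f hf
    simp only [Set.Finite.mem_toFinset, Set.mem_ofPred_eq] at hf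
    obtain ⟨hm, hd⟩ := hf
    have hr0 : reflect n f ≠ 0 := by simpa using hm.ne_zero
    have hl : (reflect n f).leadingCoeff ≠ 0 := by simpa using hr0
    have hc : (reflect n f).coeff 0 = 1 := by
      rw [coeff_reflect]; simpa [← hd] using hm.leadingCoeff
    refine ⟨⟨(reflect n f).natDegree, C (reflect n f).leadingCoeff⁻¹ * reflect n f⟩, ?_, ?_⟩
    · simp only [Finset.mem_sigma, Finset.mem_range, Finset.mem_filter, Set.Finite.mem_toFinset,
        Set.mem_ofPred_eq]
      refine ⟨?_, ⟨?_, ?_⟩, ?_⟩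
      · have := natDegree_reflect_le (N := n) (p := f)
        rw [hd, max_self] at this
        omega
      · rw [Monic, leadingCoeff_mul, leadingCoeff_C, inv_mul_cancel₀ hl]
      · rw [natDegree_C_mul (inv_ne_zero hl)]
      · rw [coeff_C_mul, hc, mul_one]; exact inv_ne_zero hl
    · simp only [sicfPhi, coeff_C_mul, hc, mul_one, inv_inv, reflect_C_mul, reflect_reflect]
      rw [← mul_assoc, ← C_mul, mul_inv_cancel₀ hl, C_1, one_mul]
  · rintro ⟨m, g⟩ hx
    simp only [Finset.mem_sigma, Finset.mem_range, Finset.mem_filter, Set.Finite.mem_toFinset,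
      Set.mem_ofPred_eq] at hx ⊢
    obtain ⟨hm, ⟨hg, rfl⟩, h0⟩ := hx
    have : α (sicfPhi n g) = α (X ^ (n - g.natDegree)) * α g := by
      rw [sicfPhi, heven _ (inv_ne_zero h0), sicf_reflect_reflect n g (by omega), hmul, hsym _ h0]
      rw [coeff_reflect]
      simpa using hg.ne_zero
    rw [this]; ring

theorem sicf_interval (K : Type) [Field K] (n h : ℕ) (hh : h + 2 ≤ n) (B : K[X])
    (hBdeg : B.natDegree = n - h - 1) (g : K[X]) (hg : g.natDegree ≤ n) :
    (sicfPhi n g - X ^ (h + 1) * B).degree ≤ (h : WithBot ℕ) ↔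
      X ^ (n - h) ∣ C (g.coeff 0)⁻¹ * g - reflect (n - h - 1) B := by
  have h1 : C (g.coeff 0)⁻¹ * g - reflect (n - h - 1) B
      = reflect n (sicfPhi n g - X ^ (h + 1) * B) := by
    rw [reflect_sub, sicfPhi, reflect_C_mul, reflect_reflect]
    congr 1
    have := reflect_mul ((X : K[X]) ^ (h+1)) B (F := h + 1) (G := n - h - 1) (by simp) hBdeg.le
    rw [show h + 1 + (n - h - 1) = n by omega, reflect_monomial] at this
    simp [this]
  have h2 : (sicfPhi n g - X ^ (h + 1) * B).natDegree ≤ n := by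
    refine (natDegree_sub_le _ _).trans (max_le ?_ ?_)
    · refine (natDegree_C_mul_le _ _).trans (natDegree_reflect_le.trans (by simp [hg]))
    · refine natDegree_mul_le.trans ?_
      rw [natDegree_X_pow, hBdeg]; omega
  rw [h1, X_pow_dvd_iff, degree_le_iff_coeff_zero]
  generalize sicfPhi n g - X ^ (h + 1) * B = D at *
  constructor
  · intro H d hd
    rw [coeff_reflect, revAt_le (by omega)]
    apply H
    exact_mod_cast (by omega : h < n - d)
  · intro H m hm
    have hm : h < m := by exact_mod_cast hm
    by_cases hmn : m ≤ n
    · have := H (n - m) (by omega)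
      rw [coeff_reflect, revAt_le (by omega)] at this
      rwa [show n - (n - m) = m by omega] at this
    · exact coeff_eq_zero_of_natDegree_lt (by omega)

theorem sicf_E (K : Type) [Field K] [Fintype K] [DecidableEq K] (n h : ℕ) (hh : h + 2 ≤ n)
    (B : K[X]) (hB : B.Monic) (hBdeg : B.natDegree = n - h - 1)
    [Fintype (MulChar (K[X] ⧸ Ideal.span {(X : K[X]) ^ (n - h)}) ℂ)]
    [DecidablePred fun χ : MulChar (K[X] ⧸ Ideal.span {(X : K[X]) ^ (n - h)}) ℂ =>
      ∀ c : K, c ≠ 0 → χ (Ideal.Quotient.mk (Ideal.span {(X : K[X]) ^ (n - h)}) (C c)) = 1]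
    (w : K[X] → ℂ)
    (hw1 : ∀ f, (f - X ^ (h + 1) * B).degree ≤ (h : WithBot ℕ) → w f = 1)
    (hw0 : ∀ f, ¬ (f - X ^ (h + 1) * B).degree ≤ (h : WithBot ℕ) → w f = 0)
    (g : K[X]) (hg : g.natDegree ≤ n) :
    ∑ χ : MulChar (K[X] ⧸ Ideal.span {(X : K[X]) ^ (n - h)}) ℂ with
      (∀ c : K, c ≠ 0 → χ (Ideal.Quotient.mk (Ideal.span {(X : K[X]) ^ (n - h)}) (C c)) = 1),
      (starRingEnd ℂ) (χ (Ideal.Quotient.mk (Ideal.span {(X : K[X]) ^ (n - h)})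
        (reflect (n - h - 1) B))) * χ (Ideal.Quotient.mk (Ideal.span {(X : K[X]) ^ (n - h)}) g)
      = (Fintype.card K : ℂ) ^ (n - h - 1) *
        (if g.coeff 0 ≠ 0 then w (sicfPhi n g) else 0) := by
  classical
  have := sicf_finite K (n - h)
  have hb0 : (reflect (n - h - 1) B).coeff 0 = 1 := by
    rw [coeff_reflect]; simpa [← hBdeg] using hB.leadingCoeff
  have hb := (sicf_isUnit K (n - h) (by omega) (reflect (n - h - 1) B)).2 (by simp [hb0])
  have h1 := sicf_even K _ ((Ideal.Quotient.mk (Ideal.span {(X : K[X]) ^ (n - h)})).comp C)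
    _ (Ideal.Quotient.mk (Ideal.span {(X : K[X]) ^ (n - h)}) g) hb
  simp only [RingHom.comp_apply] at h1
  rw [sicf_card_units K (n - h) (by omega), Nat.cast_mul, mul_assoc] at h1
  have hq : (Fintype.card Kˣ : ℂ) ≠ 0 := by exact_mod_cast Fintype.card_ne_zero
  have h2 := mul_left_cancel₀ hq h1
  rw [h2, Nat.cast_pow]
  congr 1
  have h3 : ∀ c : Kˣ, (Ideal.Quotient.mk (Ideal.span {(X : K[X]) ^ (n - h)}) (C (c : K)) *
      Ideal.Quotient.mk (Ideal.span {(X : K[X]) ^ (n - h)}) g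
      = Ideal.Quotient.mk (Ideal.span {(X : K[X]) ^ (n - h)}) (reflect (n - h - 1) B)) ↔
      (X ^ (n - h) ∣ C (c : K) * g - reflect (n - h - 1) B) := by
    intro c
    rw [← map_mul, Ideal.Quotient.eq, Ideal.mem_span_singleton]
  have h4 : ∀ c : Kˣ, (X ^ (n - h) ∣ C (c : K) * g - reflect (n - h - 1) B) →
      (c : K) * g.coeff 0 = 1 := by
    intro c hc
    have := X_pow_dvd_iff.1 hc 0 (by omega)
    rwa [coeff_sub, hb0, coeff_C_mul, sub_eq_zero] at this
  simp only [h3]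
  by_cases h0 : g.coeff 0 = 0
  · rw [if_neg (by simpa using h0)]
    apply Finset.sum_eq_zero
    intro c _
    rw [if_neg]
    intro hc
    have := h4 c hc
    simp [h0] at this
  · rw [if_pos h0, Finset.sum_eq_single (Units.mk0 _ (inv_ne_zero h0))]
    · by_cases hI : (sicfPhi n g - X ^ (h + 1) * B).degree ≤ (h : WithBot ℕ)
      · rw [hw1 _ hI, if_pos]
        exact (sicf_interval K n h hh B hBdeg g hg).1 hI
      · rw [hw0 _ hI, if_neg]
        exact fun H => hI ((sicf_interval K n h hh B hBdeg g hg).2 H)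
    · intro c _ hc
      rw [if_neg]
      intro H
      apply hc
      ext
      simpa using eq_inv_of_mul_eq_one_left (h4 c H)
    · simp





/-- for `α` even, symmetric and weakly multiplicative, `0 ≤ h ≤ n-2` and
`B ∈ M_{n-h-1}`,
`N_α(t^{h+1}B; h) = q^{h+1}⟨α⟩_n + (1/q^{n-h-1}) ∑_{m=0}^{n} α(t^{n-m})
  ∑_{χ ≠ χ₀ even mod t^{n-h}} conj(χ(θ_{n-h-1}(B))) M(m; αχ)`,
where `M(m; αχ) = ∑_{f ∈ M_m} α(f)χ(f)`, the characters are Dirichlet characters modulo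
`t^{n-h}` (multiplicative characters of the quotient ring, vanishing on non-units, evaluated
via reduction), `χ` even means `χ(c) = 1` for all scalars `c ∈ 𝔽_q^×`, and
`θ_m = reflect m` is coefficient reversal. -/
theorem short_interval_sum_character_formula (Fq : Type) [Field Fq] [Fintype Fq]
    (n h : ℕ) (hh : h + 2 ≤ n) (α : Fq[X] → ℂ)
    (heven : ∀ (c : Fq), c ≠ 0 → ∀ f : Fq[X], α (C c * f) = α f)
    (hsym : ∀ f : Fq[X], f.coeff 0 ≠ 0 → α (Polynomial.reflect f.natDegree f) = α f)
    (hmul : ∀ (k : ℕ) (f : Fq[X]), f.coeff 0 ≠ 0 → α ((X : Fq[X]) ^ k * f) = α (X ^ k) * α f)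
    (B : Fq[X]) (hB : B.Monic) (hBdeg : B.natDegree = n - h - 1) :
    (∑ᶠ f ∈ {f : Fq[X] | (f - X ^ (h + 1) * B).degree ≤ (h : WithBot ℕ)}, α f)
      = (Fintype.card Fq : ℂ) ^ (h + 1) *
          ((1 / (Fintype.card Fq : ℂ) ^ n) *
            ∑ᶠ f ∈ {f : Fq[X] | f.Monic ∧ f.natDegree = n}, α f)
        + (1 / (Fintype.card Fq : ℂ) ^ (n - h - 1)) *
          ∑ m ∈ Finset.range (n + 1), α ((X : Fq[X]) ^ (n - m)) *
            (∑ᶠ χ ∈ {χ : MulChar (Fq[X] ⧸ Ideal.span {(X : Fq[X]) ^ (n - h)}) ℂ |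
                χ ≠ 1 ∧ ∀ c : Fq, c ≠ 0 →
                  χ (Ideal.Quotient.mk (Ideal.span {(X : Fq[X]) ^ (n - h)}) (C c)) = 1},
              (starRingEnd ℂ)
                  (χ (Ideal.Quotient.mk (Ideal.span {(X : Fq[X]) ^ (n - h)})
                    (Polynomial.reflect (n - h - 1) B))) *
                ∑ᶠ f ∈ {f : Fq[X] | f.Monic ∧ f.natDegree = m},
                  α f * χ (Ideal.Quotient.mk (Ideal.span {(X : Fq[X]) ^ (n - h)}) f)) := by
  classical
  have hfin := sicf_finite Fq (n - h)
  have : Fintype (MulChar (Fq[X] ⧸ Ideal.span {(X : Fq[X]) ^ (n - h)}) ℂ) := Fintype.ofFinite _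
  set w : Fq[X] → ℂ := fun f => if (f - X ^ (h + 1) * B).degree ≤ (h : WithBot ℕ) then 1 else 0
    with hw
  have hE := sicf_E Fq n h hh B hB hBdeg w (fun f hf => if_pos hf) (fun f hf => if_neg hf)
  have hb0 : (reflect (n - h - 1) B).coeff 0 = 1 := by
    rw [coeff_reflect]; simpa [← hBdeg] using hB.leadingCoeff
  have hb := (sicf_isUnit Fq (n - h) (by omega) (reflect (n - h - 1) B)).2 (by simp [hb0])
  have hun := sicf_isUnit Fq (n - h) (by omega)
  have hq : (Fintype.card Fq : ℂ) ≠ 0 := by exact_mod_cast Fintype.card_ne_zero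
  have hL : (∑ᶠ f ∈ {f : Fq[X] | (f - X ^ (h + 1) * B).degree ≤ (h : WithBot ℕ)}, α f)
      = ∑ f ∈ (sicf_finM Fq n).toFinset, w f * α f := by
    have hsub : ∀ f : Fq[X], (f - X ^ (h + 1) * B).degree ≤ (h : WithBot ℕ) →
        f.Monic ∧ f.natDegree = n := by
      intro f hf
      have hXB : (X ^ (h + 1) * B : Fq[X]).Monic := (monic_X_pow _).mul hB
      have hXBd : (X ^ (h + 1) * B : Fq[X]).natDegree = n := by
        rw [(monic_X_pow _).natDegree_mul hB, natDegree_X_pow, hBdeg]; omega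
      have hlt : (f - X ^ (h + 1) * B).degree < (X ^ (h + 1) * B : Fq[X]).degree := by
        rw [degree_eq_natDegree hXB.ne_zero, hXBd]
        exact lt_of_le_of_lt hf (by exact_mod_cast (by omega : h < n))
      have hf' : f = X ^ (h + 1) * B + (f - X ^ (h + 1) * B) := by ring
      refine ⟨?_, ?_⟩
      · rw [hf']; exact hXB.add_of_left hlt
      · rw [hf', natDegree_add_eq_left_of_degree_lt hlt, hXBd]
    rw [finsum_mem_eq_sum_of_inter_support_eq (t := (sicf_finM Fq n).toFinset.filter
      (fun f => (f - X ^ (h + 1) * B).degree ≤ (h : WithBot ℕ)))]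
    · rw [Finset.sum_filter]
      apply Finset.sum_congr rfl
      intro f _
      simp only [hw]
      split_ifs <;> simp
    · congr 1
      ext f
      simp only [Finset.coe_filter, Set.Finite.mem_toFinset, Set.mem_ofPred_eq]
      exact ⟨fun hf => ⟨hsub f hf, hf⟩, fun hf => hf.2⟩
  have hM : ∀ (m : ℕ) (F : Fq[X] → ℂ), (∑ᶠ f ∈ {f : Fq[X] | f.Monic ∧ f.natDegree = m}, F f)
      = ∑ f ∈ (sicf_finM Fq m).toFinset, F f := fun m F =>
    finsum_mem_eq_finite_toFinset_sum _ _
  have hX : ∀ F : MulChar (Fq[X] ⧸ Ideal.span {(X : Fq[X]) ^ (n - h)}) ℂ → ℂ,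
      (∑ᶠ χ ∈ {χ : MulChar (Fq[X] ⧸ Ideal.span {(X : Fq[X]) ^ (n - h)}) ℂ |
                χ ≠ 1 ∧ ∀ c : Fq, c ≠ 0 →
                  χ (Ideal.Quotient.mk (Ideal.span {(X : Fq[X]) ^ (n - h)}) (C c)) = 1}, F χ)
      = (∑ χ with (∀ c : Fq, c ≠ 0 →
          χ (Ideal.Quotient.mk (Ideal.span {(X : Fq[X]) ^ (n - h)}) (C c)) = 1), F χ) - F 1 := by
    intro F
    have h1 : (1 : MulChar (Fq[X] ⧸ Ideal.span {(X : Fq[X]) ^ (n - h)}) ℂ) ∈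
        Finset.univ.filter (fun χ : MulChar (Fq[X] ⧸ Ideal.span {(X : Fq[X]) ^ (n - h)}) ℂ =>
          ∀ c : Fq, c ≠ 0 →
          χ (Ideal.Quotient.mk (Ideal.span {(X : Fq[X]) ^ (n - h)}) (C c)) = 1) := by
      simp only [Finset.mem_filter, Finset.mem_univ, true_and]
      intro c hc
      exact MulChar.one_apply ((hun (C c)).2 (by simpa using hc))
    rw [← Finset.sum_erase_eq_sub h1]
    apply finsum_mem_eq_sum_of_inter_support_eq
    congr 1
    ext χ
    simp [and_comm]
  have hk1 := sicf_key Fq n α w heven hsym hmul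
  have hk2 := sicf_key Fq n α (fun _ => 1) heven hsym hmul
  simp only [one_mul] at hk2
  rw [hL, hk1]
  simp only [hM, hX]
  rw [hk2]
  have hpow : (Fintype.card Fq : ℂ) ^ n
      = (Fintype.card Fq : ℂ) ^ (h + 1) * (Fintype.card Fq : ℂ) ^ (n - h - 1) := by
    rw [← pow_add]; congr 1; omega
  have hcoef : ∀ S : ℂ, (Fintype.card Fq : ℂ) ^ (h + 1) * ((1 / (Fintype.card Fq : ℂ) ^ n) * S)
      = (1 / (Fintype.card Fq : ℂ) ^ (n - h - 1)) * S := by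
    intro S
    rw [hpow]
    have := pow_ne_zero (h + 1) hq
    have := pow_ne_zero (n - h - 1) hq
    field_simp
  rw [hcoef, ← mul_add, ← Finset.sum_add_distrib, Finset.mul_sum]
  apply Finset.sum_congr rfl
  intro m hm
  have hm' : m < n + 1 := Finset.mem_range.1 hm
  rw [← mul_add, mul_left_comm]
  congr 1
  rw [MulChar.one_apply hb, map_one, one_mul]
  have hone : ∑ f ∈ (sicf_finM Fq m).toFinset, α f *
      (1 : MulChar (Fq[X] ⧸ Ideal.span {(X : Fq[X]) ^ (n - h)}) ℂ)
        (Ideal.Quotient.mk (Ideal.span {(X : Fq[X]) ^ (n - h)}) f)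
      = ∑ g ∈ (sicf_finM Fq m).toFinset, if g.coeff 0 ≠ 0 then α g else 0 := by
    apply Finset.sum_congr rfl
    intro g _
    split_ifs with h0
    · rw [MulChar.one_apply ((hun g).2 h0), mul_one]
    · rw [MulChar.map_nonunit _ (fun H => h0 ((hun g).1 H)), mul_zero]
  rw [hone, add_sub_cancel]
  simp only [Finset.mul_sum]
  rw [Finset.sum_comm]
  apply Finset.sum_congr rfl
  intro g hg
  have hgd : g.natDegree ≤ n := by
    have := ((sicf_finM Fq m).mem_toFinset.1 hg).2
    omega
  rw [← Finset.mul_sum]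
  have h5 := hE g hgd
  have h6 : ∀ x y : ℂ, x * (α g * y) = α g * (x * y) := fun x y => by ring
  simp only [h6]
  rw [← Finset.mul_sum, h5]
  have := pow_ne_zero (n - h - 1) hq
  split_ifs
  · field_simp
  · simp
end

section
/- Let α, β : 𝔽_q[t] → ℂ both be even, symmetric and weakly multiplicative (α(cf) = α(f) for c ∈ 𝔽_q^×; α(f*) = α(f) when f(0) ≠ 0 with f*(t) = t^{deg f}f(1/t); α(t^k f) = α(t^k)α(f) when f(0) ≠ 0; likewise for β). Then for 0 ≤ h ≤ n−2 the covariance of the short-interval sums satisfies Cov(N_α, N_β) = (1/q^{2(n−h−1)})·Σ_{χ ≠ χ₀ even mod t^{n−h}} Σ_{m₁=0}^{n} Σ_{m₂=0}^{n} α(t^{n−m₁})·conj(β(t^{n−m₂}))·M(m₁; αχ)·conj(M(m₂; βχ)), where M(m; αχ) = Σ_{f∈M_m} α(f)χ(f) and the character sum is over nontrivial even Dirichlet characters modulo t^{n−h}. -/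
open Polynomial

/-- `N_α(A; h) = ∑_{f ∈ I(A;h)} α(f)`, the sum of `α` over the short interval `I(A;h)`. -/
noncomputable def Nshort {Fq : Type} [Field Fq] (α : Fq[X] → ℂ) (A : Fq[X]) (h : ℕ) : ℂ :=
  ∑ᶠ f ∈ {f : Fq[X] | (f - A).degree ≤ (h : WithBot ℕ)}, α f

/-- The mean `⟨N_α⟩` of `N_α(t^{h+1}B; h)` over `B ∈ M_{n-h-1}`. -/
noncomputable def meanNshort (Fq : Type) [Field Fq] [Fintype Fq]
    (α : Fq[X] → ℂ) (n h : ℕ) : ℂ :=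
  (1 / (Fintype.card Fq : ℂ) ^ (n - h - 1)) *
    ∑ᶠ B ∈ {B : Fq[X] | B.Monic ∧ B.natDegree = n - h - 1},
      Nshort α (X ^ (h + 1) * B) h

/-- The covariance `Cov(N_α, N_β)` over the short intervals partitioning `M_n`. -/
noncomputable def covNshort (Fq : Type) [Field Fq] [Fintype Fq]
    (α β : Fq[X] → ℂ) (n h : ℕ) : ℂ :=
  (1 / (Fintype.card Fq : ℂ) ^ (n - h - 1)) *
    ∑ᶠ B ∈ {B : Fq[X] | B.Monic ∧ B.natDegree = n - h - 1},
      (Nshort α (X ^ (h + 1) * B) h - meanNshort Fq α n h) *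
        (starRingEnd ℂ) (Nshort β (X ^ (h + 1) * B) h - meanNshort Fq β n h)

/-- `M(m; αχ) = ∑_{f ∈ M_m} α(f)χ(f)` for a Dirichlet character `χ` modulo `t^{n-h}`. -/
noncomputable def MsumChar {Fq : Type} [Field Fq] (r : ℕ) (m : ℕ) (α : Fq[X] → ℂ)
    (χ : MulChar (Fq[X] ⧸ Ideal.span {(X : Fq[X]) ^ r}) ℂ) : ℂ :=
  ∑ᶠ f ∈ {f : Fq[X] | f.Monic ∧ f.natDegree = m},
    α f * χ (Ideal.Quotient.mk (Ideal.span {(X : Fq[X]) ^ r}) f)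

section Helpers

variable {Fq : Type} [Field Fq] [Fintype Fq]

lemma cc_monFin (n : ℕ) : {f : Fq[X] | f.Monic ∧ f.natDegree = n}.Finite := by
  have : Finite {f : Fq[X] // f.Monic ∧ f.natDegree = n} :=
    Finite.of_equiv _ ((monicEquivDegreeLT n).trans (degreeLTEquiv Fq n).toEquiv).symm
  exact Set.finite_coe_iff.1 this

noncomputable def ccMon (Fq : Type) [Field Fq] [Fintype Fq] (n : ℕ) : Finset Fq[X] :=
  (cc_monFin (Fq := Fq) n).toFinset

lemma cc_mem (n : ℕ) (f : Fq[X]) : f ∈ ccMon Fq n ↔ f.Monic ∧ f.natDegree = n := by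
  simp [ccMon]

lemma cc_finsum (n : ℕ) (φ : Fq[X] → ℂ) :
    ∑ᶠ f ∈ {f : Fq[X] | f.Monic ∧ f.natDegree = n}, φ f = ∑ f ∈ ccMon Fq n, φ f :=
  finsum_mem_eq_finite_toFinset_sum _ _

lemma cc_card (n : ℕ) : (ccMon Fq n).card = Fintype.card Fq ^ n := by
  have h1 : Nat.card {f : Fq[X] // f.Monic ∧ f.natDegree = n} = Fintype.card Fq ^ n := by
    rw [Nat.card_congr ((monicEquivDegreeLT n).trans (degreeLTEquiv Fq n).toEquiv)]
    simp
  rw [← h1, ccMon]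
  exact (Set.ncard_eq_toFinset_card {f : Fq[X] | f.Monic ∧ f.natDegree = n} _).symm

lemma cc_quot_eq (r : ℕ) (p q : Fq[X]) :
    Ideal.Quotient.mk (Ideal.span {(X : Fq[X]) ^ r}) p
      = Ideal.Quotient.mk (Ideal.span {(X : Fq[X]) ^ r}) q ↔ ∀ d < r, p.coeff d = q.coeff d := by
  rw [Ideal.Quotient.mk_eq_mk_iff_sub_mem, Ideal.mem_span_singleton, X_pow_dvd_iff]
  simp [sub_eq_zero]

lemma cc_unit (r : ℕ) (hr : 0 < r) (p : Fq[X]) :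
    IsUnit (Ideal.Quotient.mk (Ideal.span {(X : Fq[X]) ^ r}) p) ↔ p.coeff 0 ≠ 0 := by
  constructor
  · intro hu h0
    obtain ⟨q, hq⟩ := hu.exists_right_inv
    obtain ⟨q, rfl⟩ := Ideal.Quotient.mk_surjective q
    rw [← map_mul, ← map_one (Ideal.Quotient.mk _), cc_quot_eq] at hq
    simpa [mul_coeff_zero, h0] using hq 0 hr
  · intro h0
    have : IsCoprime p (X ^ r) := by
      apply IsCoprime.pow_right
      refine (Irreducible.coprime_iff_not_dvd irreducible_X).2 ?_ |>.symm
      rwa [X_dvd_iff]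
    obtain ⟨a, b, hab⟩ := this
    refine IsUnit.of_mul_eq_one (Ideal.Quotient.mk _ a) ?_
    rw [← map_mul, ← map_one (Ideal.Quotient.mk _), Ideal.Quotient.mk_eq_mk_iff_sub_mem,
      Ideal.mem_span_singleton]
    exact ⟨-b, by linear_combination hab⟩

lemma cc_quot_finite (r : ℕ) : Finite (Fq[X] ⧸ Ideal.span {(X : Fq[X]) ^ r}) := by
  have h := (monic_X_pow (R := Fq) r).finite_adjoinRoot
  have : Finite (AdjoinRoot ((X : Fq[X]) ^ r)) := Module.finite_of_finite Fq
  exact this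

lemma cc_coeff0 (k : ℕ) (B : Fq[X]) (hB : B ∈ ccMon Fq k) : (reflect k B).coeff 0 = 1 := by
  rw [cc_mem] at hB
  rw [coeff_reflect, revAt_zero, ← hB.2]
  exact hB.1

lemma cc_monic_of (k : ℕ) (p : Fq[X]) (hp : p.natDegree ≤ k) (h0 : p.coeff 0 = 1) :
    reflect k p ∈ ccMon Fq k := by
  have hle : (reflect k p).natDegree ≤ k := by
    refine natDegree_reflect_le.trans ?_
    simp [hp]
  have hc : (reflect k p).coeff k = 1 := by
    rw [coeff_reflect, revAt_le le_rfl, Nat.sub_self, h0]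
  rw [cc_mem]
  have hm : (reflect k p).Monic := monic_of_natDegree_le_of_coeff_eq_one k hle hc
  refine ⟨hm, le_antisymm hle (le_natDegree_of_ne_zero (by rw [hc]; exact one_ne_zero))⟩

/-- units are parametrised by constants and monic polynomials -/
lemma cc_card_units (k : ℕ) : Nat.card (Fq[X] ⧸ Ideal.span {(X : Fq[X]) ^ (k + 1)})ˣ
    = Nat.card Fqˣ * Fintype.card Fq ^ k := by
  have hu : ∀ x : Fqˣ × ccMon Fq k, IsUnit (Ideal.Quotient.mk (Ideal.span {(X : Fq[X]) ^ (k + 1)})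
      (C (x.1 : Fq) * reflect k (x.2 : Fq[X]))) := by
    intro x
    rw [cc_unit _ (Nat.succ_pos k)]
    simp [mul_coeff_zero, cc_coeff0 k _ x.2.2]
  have hb : Function.Bijective (fun x : Fqˣ × ccMon Fq k => (hu x).unit) := by
    constructor
    · rintro ⟨c, B, hB⟩ ⟨c', B', hB'⟩ h
      have h := congrArg Units.val h
      simp only [IsUnit.unit_spec] at h
      rw [cc_quot_eq] at h
      have h0 := h 0 (Nat.succ_pos k)
      simp only [coeff_C_mul, cc_coeff0 k _ hB, cc_coeff0 k _ hB', mul_one] at h0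
      have hc : c = c' := Units.ext h0
      subst hc
      have : reflect k B = reflect k B' := by
        ext d
        by_cases hd : d < k + 1
        · have := h d hd
          simp only [coeff_C_mul] at this
          exact mul_left_cancel₀ c.ne_zero this
        · rw [cc_mem] at hB hB'
          rw [coeff_eq_zero_of_natDegree_lt, coeff_eq_zero_of_natDegree_lt]
          · refine natDegree_reflect_le.trans_lt ?_
            rw [hB'.2]; simp; omega
          · refine natDegree_reflect_le.trans_lt ?_
            rw [hB.2]; simp; omega
      have : B = B' := by
        rw [← reflect_reflect (N := k) (p := B), this, reflect_reflect]
      subst this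
      rfl
    · intro u
      obtain ⟨p, hp⟩ := Ideal.Quotient.mk_surjective (u : Fq[X] ⧸ Ideal.span {(X : Fq[X]) ^ (k + 1)})
      have hpu : p.coeff 0 ≠ 0 := by
        rw [← cc_unit (k + 1) (Nat.succ_pos k), hp]; exact u.isUnit
      set s : Fq[X] := C (p.coeff 0)⁻¹ * (p %ₘ X ^ (k + 1)) with hs
      have hmod : ∀ d < k + 1, (p %ₘ X ^ (k + 1)).coeff d = p.coeff d := by
        rw [← cc_quot_eq, Ideal.Quotient.mk_eq_mk_iff_sub_mem, Ideal.mem_span_singleton]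
        refine ⟨-(p /ₘ X ^ (k + 1)), ?_⟩
        linear_combination modByMonic_add_div p (X ^ (k + 1))
      have hsd : s.natDegree ≤ k := by
        refine (natDegree_C_mul_le _ _).trans ?_
        have := natDegree_modByMonic_lt p (monic_X_pow (R := Fq) (k + 1))
          (by intro h; simpa using congrArg natDegree h)
        simp at this
        omega
      have hs0 : s.coeff 0 = 1 := by
        rw [hs, coeff_C_mul, hmod 0 (Nat.succ_pos k), inv_mul_cancel₀ hpu]
      refine ⟨(Units.mk0 _ hpu, ⟨reflect k s, cc_monic_of k s hsd hs0⟩), ?_⟩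
      apply Units.ext
      simp only [IsUnit.unit_spec]
      rw [← hp, cc_quot_eq]
      intro d hd
      simp only [reflect_reflect, Units.val_mk0, coeff_C_mul, hs, hmod d hd]
      field_simp
  rw [← Nat.card_congr (Equiv.ofBijective _ hb), Nat.card_prod]
  simp [cc_card]

lemma cc_orth {R : Type} [CommRing R] [Finite R] [Fintype (MulChar R ℂ)] [DecidableEq R] (a : R) :
    ∑ χ : MulChar R ℂ, χ a = if a = 1 then (Nat.card Rˣ : ℂ) else 0 := by
  split_ifs with ha
  · subst ha
    simp only [map_one, Finset.sum_const, Finset.card_univ, nsmul_eq_mul, mul_one,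
      ← Nat.card_eq_fintype_card]
    rw [MulChar.card_eq_card_units_of_hasEnoughRootsOfUnity R ℂ]
  · obtain ⟨χ, hχ⟩ := MulChar.exists_apply_ne_one_of_hasEnoughRootsOfUnity R ℂ ha
    refine eq_zero_of_mul_eq_self_left hχ ?_
    simp only [Finset.mul_sum, ← MulChar.mul_apply]
    exact Fintype.sum_bijective _ (Group.mulLeft_bijective χ) _ _ fun χ' ↦ rfl

/-- even characters -/
def ccEven (Fq : Type) [Field Fq] (r : ℕ) : Set (MulChar (Fq[X] ⧸ Ideal.span {(X : Fq[X]) ^ r}) ℂ) :=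
  {χ | ∀ c : Fq, c ≠ 0 → χ (Ideal.Quotient.mk (Ideal.span {(X : Fq[X]) ^ r}) (C c)) = 1}

lemma cc_even_ind (r : ℕ) (χ : MulChar (Fq[X] ⧸ Ideal.span {(X : Fq[X]) ^ r}) ℂ) 
    [Decidable (χ ∈ ccEven Fq r)] :
    ∑ᶠ c : Fqˣ, χ (Ideal.Quotient.mk (Ideal.span {(X : Fq[X]) ^ r}) (C (c : Fq)))
      = if χ ∈ ccEven Fq r then (Nat.card Fqˣ : ℂ) else 0 := by
  classical
  rw [finsum_eq_sum_of_fintype]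
  split_ifs with h
  · rw [Finset.sum_congr rfl (fun (c : Fqˣ) _ => h (c : Fq) c.ne_zero)]
    simp
  · simp only [ccEven, Set.mem_ofPred_eq, not_forall] at h
    obtain ⟨c, hc, hne⟩ := h
    refine eq_zero_of_mul_eq_self_left hne ?_
    rw [Finset.mul_sum]
    refine Fintype.sum_bijective _ (Group.mulLeft_bijective (Units.mk0 c hc)) _ _ fun c' => ?_
    simp

lemma cc_even_orth (k : ℕ) (E : Finset (MulChar (Fq[X] ⧸ Ideal.span {(X : Fq[X]) ^ (k + 1)}) ℂ))
    (hE : ∀ χ, χ ∈ E ↔ χ ∈ ccEven Fq (k + 1)) [DecidableEq Fq[X]] (B B' : Fq[X]) (hB : B ∈ ccMon Fq k)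
    (hB' : B' ∈ ccMon Fq k) :
    ∑ χ ∈ E, χ (Ideal.Quotient.mk _ (reflect k B)) *
      (starRingEnd ℂ) (χ (Ideal.Quotient.mk _ (reflect k B')))
      = if B = B' then (Fintype.card Fq : ℂ) ^ k else 0 := by
  classical
  have hfin := cc_quot_finite (Fq := Fq) (k + 1)
  let _ : Fintype (MulChar (Fq[X] ⧸ Ideal.span {(X : Fq[X]) ^ (k + 1)}) ℂ) := Fintype.ofFinite _
  set b := Ideal.Quotient.mk (Ideal.span {(X : Fq[X]) ^ (k + 1)}) (reflect k B) with hb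
  set b' := Ideal.Quotient.mk (Ideal.span {(X : Fq[X]) ^ (k + 1)}) (reflect k B') with hb'
  have hu : IsUnit b' := by
    rw [hb', cc_unit _ (Nat.succ_pos k), cc_coeff0 k _ hB']; exact one_ne_zero
  obtain ⟨u, hu⟩ := hu
  have hcard0 : (Nat.card Fqˣ : ℂ) ≠ 0 := by
    simp only [ne_eq, Nat.cast_eq_zero]; exact Nat.card_pos.ne'
  have hterm : ∀ χ : MulChar (Fq[X] ⧸ Ideal.span {(X : Fq[X]) ^ (k + 1)}) ℂ,
      χ b * (starRingEnd ℂ) (χ b') = χ (b * (↑u⁻¹ : Fq[X] ⧸ Ideal.span {(X : Fq[X]) ^ (k + 1)})) := by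
    intro χ
    rw [map_mul, ← hu]
    congr 1
    have := MulChar.star_apply' χ (u : Fq[X] ⧸ Ideal.span {(X : Fq[X]) ^ (k + 1)})
    rw [RCLike.star_def] at this
    rw [this, MulChar.inv_apply, Ring.inverse_unit]
  have key : (Nat.card Fqˣ : ℂ) * ∑ χ ∈ E, χ b * (starRingEnd ℂ) (χ b')
      = (Nat.card Fqˣ : ℂ) * (if B = B' then (Fintype.card Fq : ℂ) ^ k else 0) := by
    calc _ = ∑ χ : MulChar (Fq[X] ⧸ Ideal.span {(X : Fq[X]) ^ (k + 1)}) ℂ,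
          (if χ ∈ ccEven Fq (k + 1) then (Nat.card Fqˣ : ℂ) else 0) *
            χ (b * (↑u⁻¹ : Fq[X] ⧸ Ideal.span {(X : Fq[X]) ^ (k + 1)})) := by
          have : E = Finset.univ.filter (· ∈ ccEven Fq (k + 1)) := by ext; simp [hE]
          rw [this, Finset.sum_filter, Finset.mul_sum]
          refine Finset.sum_congr rfl fun χ _ => ?_
          rw [hterm]; split_ifs <;> simp
      _ = ∑ c : Fqˣ, ∑ χ : MulChar (Fq[X] ⧸ Ideal.span {(X : Fq[X]) ^ (k + 1)}) ℂ,
          χ (Ideal.Quotient.mk _ (C (c : Fq)) *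
            (b * (↑u⁻¹ : Fq[X] ⧸ Ideal.span {(X : Fq[X]) ^ (k + 1)}))) := by
          rw [Finset.sum_comm]
          refine Finset.sum_congr rfl fun χ _ => ?_
          rw [← cc_even_ind, finsum_eq_sum_of_fintype, Finset.sum_mul]
          simp only [map_mul]
      _ = ∑ c : Fqˣ, if c = 1 then
            (if B = B' then (Nat.card Fqˣ : ℂ) * (Fintype.card Fq : ℂ) ^ k else 0) else 0 := by
          refine Finset.sum_congr rfl fun c _ => ?_
          rw [cc_orth, cc_card_units]
          push_cast
          rw [← ite_and]
          refine if_congr ?_ rfl rfl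
          rw [← mul_assoc, Units.mul_inv_eq_one, hu, hb, hb', ← map_mul, cc_quot_eq]
          constructor
          · intro h
            have h0 := h 0 (Nat.succ_pos k)
            simp only [coeff_C_mul, cc_coeff0 k _ hB, cc_coeff0 k _ hB', mul_one] at h0
            have hc : c = 1 := Units.ext h0
            refine ⟨hc, ?_⟩
            subst hc
            rw [← reflect_reflect (N := k) (p := B), ← reflect_reflect (N := k) (p := B')]
            congr 1
            ext d
            by_cases hd : d < k + 1
            · simpa using h d hd
            · rw [cc_mem] at hB hB'
              rw [coeff_eq_zero_of_natDegree_lt, coeff_eq_zero_of_natDegree_lt]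
              · refine natDegree_reflect_le.trans_lt ?_
                rw [hB'.2]; simp; omega
              · refine natDegree_reflect_le.trans_lt ?_
                rw [hB.2]; simp; omega
          · rintro ⟨rfl, rfl⟩; simp
      _ = _ := by
          rw [Finset.sum_ite_eq' Finset.univ]; simp
  exact mul_left_cancel₀ hcard0 key

lemma cc_parseval (k : ℕ) (E : Finset (MulChar (Fq[X] ⧸ Ideal.span {(X : Fq[X]) ^ (k + 1)}) ℂ))
    (hE : ∀ χ, χ ∈ E ↔ χ ∈ ccEven Fq (k + 1)) (a b : Fq[X] → ℂ) :
    ∑ χ ∈ E, (∑ B ∈ ccMon Fq k, a B * χ (Ideal.Quotient.mk _ (reflect k B))) *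
      (starRingEnd ℂ) (∑ B ∈ ccMon Fq k, b B * χ (Ideal.Quotient.mk _ (reflect k B)))
      = (Fintype.card Fq : ℂ) ^ k * ∑ B ∈ ccMon Fq k, a B * (starRingEnd ℂ) (b B) := by
  classical
  simp only [map_sum, Finset.sum_mul_sum]
  rw [Finset.sum_comm, Finset.mul_sum]
  refine Finset.sum_congr rfl fun B hB => ?_
  rw [Finset.sum_comm]
  calc _ = ∑ B' ∈ ccMon Fq k, a B * (starRingEnd ℂ) (b B') *
        (if B = B' then (Fintype.card Fq : ℂ) ^ k else 0) := by
        refine Finset.sum_congr rfl fun B' hB' => ?_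
        rw [← cc_even_orth k E hE B B' hB hB', Finset.mul_sum]
        refine Finset.sum_congr rfl fun χ _ => ?_
        rw [map_mul]; ring
    _ = _ := by
        simp only [mul_ite, mul_zero]
        rw [Finset.sum_ite_eq, if_pos hB]; ring

lemma cc_rel (n h : ℕ) (f B : Fq[X]) :
    (f - X ^ (h + 1) * B).degree ≤ (h : WithBot ℕ) ↔ f /ₘ X ^ (h + 1) = B := by
  have hdeg : (X ^ (h + 1) : Fq[X]).degree = ((h + 1 : ℕ) : WithBot ℕ) := degree_X_pow _
  constructor
  · intro hd
    refine (div_modByMonic_unique B (f - X ^ (h + 1) * B) (monic_X_pow _) ⟨by ring, ?_⟩).1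
    rw [hdeg]
    refine hd.trans_lt ?_
    exact_mod_cast Nat.lt_succ_self h
  · rintro rfl
    have : f - X ^ (h + 1) * (f /ₘ X ^ (h + 1)) = f %ₘ X ^ (h + 1) := by
      linear_combination -modByMonic_add_div f (X ^ (h + 1))
    rw [this]
    have := natDegree_modByMonic_lt f (monic_X_pow (R := Fq) (h + 1))
      (by intro h; simpa using congrArg natDegree h)
    rw [natDegree_X_pow] at this
    exact degree_le_of_natDegree_le (by omega)

lemma cc_short_mem (k h : ℕ) (f B : Fq[X]) (hB : B ∈ ccMon Fq k)
    (hf : (f - X ^ (h + 1) * B).degree ≤ (h : WithBot ℕ)) : f ∈ ccMon Fq (h + 1 + k) := by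
  rw [cc_mem] at *
  have hm : (X ^ (h + 1) * B).Monic := (monic_X_pow _).mul hB.1
  have hd : (X ^ (h + 1) * B).natDegree = h + 1 + k := by
    rw [(monic_X_pow _).natDegree_mul hB.1, natDegree_X_pow, hB.2]
  have hlt : (f - X ^ (h + 1) * B).degree < (X ^ (h + 1) * B).degree := by
    rw [degree_eq_natDegree hm.ne_zero, hd]
    refine hf.trans_lt ?_
    exact_mod_cast (by omega : h < h + 1 + k)
  have e : f = X ^ (h + 1) * B + (f - X ^ (h + 1) * B) := by ring
  rw [e]
  refine ⟨hm.add_of_left hlt, ?_⟩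
  rw [natDegree_add_eq_left_of_degree_lt hlt, hd]

lemma cc_div_mem (k h : ℕ) (f : Fq[X]) (hf : f ∈ ccMon Fq (h + 1 + k)) :
    f /ₘ X ^ (h + 1) ∈ ccMon Fq k := by
  rw [cc_mem] at *
  have hd : (f /ₘ X ^ (h + 1)).natDegree = k := by
    rw [natDegree_divByMonic f (monic_X_pow _), hf.2, natDegree_X_pow]; omega
  refine ⟨?_, hd⟩
  rw [Monic, leadingCoeff_divByMonic_of_monic (monic_X_pow _)]
  · exact hf.1
  · rw [degree_X_pow, degree_eq_natDegree hf.1.ne_zero, hf.2]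
    exact_mod_cast (by omega : h + 1 ≤ h + 1 + k)

lemma cc_nshort [DecidableEq Fq[X]] (k h : ℕ) (α : Fq[X] → ℂ) (B : Fq[X]) (hB : B ∈ ccMon Fq k) :
    Nshort α (X ^ (h + 1) * B) h
      = ∑ f ∈ ccMon Fq (h + 1 + k) with f /ₘ X ^ (h + 1) = B, α f := by
  rw [Nshort, ← finsum_mem_coe_finset]
  congr 1
  ext f
  have : f ∈ {f : Fq[X] | (f - X ^ (h + 1) * B).degree ≤ (h : WithBot ℕ)} ↔
      f ∈ ((ccMon Fq (h + 1 + k)).filter (fun f => f /ₘ X ^ (h + 1) = B) : Finset Fq[X]) := by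
    rw [Finset.mem_filter, Set.mem_ofPred_eq, ← cc_rel (h + 1) h]
    exact ⟨fun hf => ⟨cc_short_mem k h f B hB hf, hf⟩, fun hf => hf.2⟩
  simp only [this, Finset.mem_coe]

lemma cc_reflect (k h : ℕ) (f : Fq[X]) (hf : f ∈ ccMon Fq (h + 1 + k)) :
    Ideal.Quotient.mk (Ideal.span {(X : Fq[X]) ^ (k + 1)}) (reflect (h + 1 + k) f)
     = Ideal.Quotient.mk (Ideal.span {(X : Fq[X]) ^ (k + 1)}) (reflect k (f /ₘ X ^ (h + 1))) := by
  have hB := (cc_mem _ _).1 (cc_div_mem k h f hf)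
  have h1 : reflect (h + 1 + k) (X ^ (h + 1) * (f /ₘ X ^ (h + 1)))
      = reflect k (f /ₘ X ^ (h + 1)) := by
    rw [reflect_mul _ _ (F := h + 1) (G := k) (by simp) hB.2.le, reflect_monomial,
      revAt_le le_rfl]
    simp
  rw [← h1, cc_quot_eq]
  intro d hd
  rw [coeff_reflect, coeff_reflect, ← sub_eq_zero, ← coeff_sub]
  apply coeff_eq_zero_of_degree_lt
  refine ((cc_rel (h + 1) h f _).2 rfl).trans_lt ?_
  rw [revAt_le (by omega)]
  exact_mod_cast (by omega : h < h + 1 + k - d)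

lemma cc_sum_short (k h : ℕ) (α : Fq[X] → ℂ)
    (χ : MulChar (Fq[X] ⧸ Ideal.span {(X : Fq[X]) ^ (k + 1)}) ℂ) :
    ∑ B ∈ ccMon Fq k, Nshort α (X ^ (h + 1) * B) h * χ (Ideal.Quotient.mk _ (reflect k B))
     = ∑ f ∈ ccMon Fq (h + 1 + k), α f * χ (Ideal.Quotient.mk _ (reflect (h + 1 + k) f)) := by
  classical
  rw [← Finset.sum_fiberwise_of_maps_to (fun f hf => cc_div_mem k h f hf)]
  refine Finset.sum_congr rfl fun B hB => ?_
  rw [cc_nshort k h α B hB, Finset.sum_mul]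
  refine Finset.sum_congr rfl fun f hf => ?_
  rw [Finset.mem_filter] at hf
  rw [cc_reflect k h f hf.1, hf.2]

lemma cc_msum (k n : ℕ) (α : Fq[X] → ℂ)
    (hevenα : ∀ (c : Fq), c ≠ 0 → ∀ f : Fq[X], α (C c * f) = α f)
    (hsymα : ∀ f : Fq[X], f.coeff 0 ≠ 0 → α (Polynomial.reflect f.natDegree f) = α f)
    (hmulα : ∀ (k : ℕ) (f : Fq[X]), f.coeff 0 ≠ 0 → α ((X : Fq[X]) ^ k * f) = α (X ^ k) * α f)
    (χ : MulChar (Fq[X] ⧸ Ideal.span {(X : Fq[X]) ^ (k + 1)}) ℂ) (hχ : χ ∈ ccEven Fq (k + 1)) :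
    ∑ m ∈ Finset.range (n + 1), α (X ^ (n - m)) * MsumChar (k + 1) m α χ
     = ∑ f ∈ ccMon Fq n, α f * χ (Ideal.Quotient.mk _ (reflect n f)) := by
  classical
  have hdeg : ∀ p : Fq[X], p.natDegree ≤ n → (reflect n p).natDegree ≤ n := fun p hp =>
    natDegree_reflect_le.trans (by simp [hp])
  simp only [MsumChar, cc_finsum, Finset.mul_sum]
  rw [Finset.sum_sigma']
  have hz : ∀ x ∈ (Finset.range (n + 1)).sigma (fun m => ccMon Fq m), x.2.coeff 0 = 0 →
      α (X ^ (n - x.1)) * (α x.2 * χ (Ideal.Quotient.mk _ x.2)) = 0 := by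
    intro x _ h0
    rw [MulChar.map_nonunit, mul_zero, mul_zero]
    rw [cc_unit _ (Nat.succ_pos k)]; simpa using h0
  rw [← Finset.sum_filter_of_ne (p := fun x : (_ : ℕ) × Fq[X] => x.2.coeff 0 ≠ 0)
    (fun x hx hne h0 => hne (hz x hx h0))]
  refine Finset.sum_bij' (fun x _ => C (x.2.coeff 0)⁻¹ * reflect n x.2)
    (fun f _ => ⟨(reflect n f).natDegree, C (reflect n f).leadingCoeff⁻¹ * reflect n f⟩)
    ?_ ?_ ?_ ?_ ?_
  · rintro ⟨m, g⟩ hx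
    simp only [Finset.mem_filter, Finset.mem_sigma, Finset.mem_range, cc_mem] at hx
    obtain ⟨⟨hm, hg, hgm⟩, h0⟩ := hx
    rw [← reflect_C_mul]
    apply cc_monic_of
    · exact (natDegree_C_mul_le _ _).trans (by simp only; omega)
    · rw [coeff_C_mul, inv_mul_cancel₀ h0]
  · intro f hf
    have h0 := cc_coeff0 n f hf
    rw [cc_mem] at hf
    have hne : reflect n f ≠ 0 := by intro h; rw [h] at h0; simp at h0
    have hl : (reflect n f).leadingCoeff⁻¹ ≠ 0 := inv_ne_zero (leadingCoeff_ne_zero.2 hne)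
    simp only [Finset.mem_filter, Finset.mem_sigma, Finset.mem_range, cc_mem]
    refine ⟨⟨Nat.lt_succ_of_le (hdeg f hf.2.le), ?_, ?_⟩, ?_⟩
    · rw [mul_comm]; exact monic_mul_leadingCoeff_inv hne
    · exact natDegree_C_mul hl
    · rw [coeff_C_mul, h0, mul_one]; exact hl
  · rintro ⟨m, g⟩ hx
    simp only [Finset.mem_filter, Finset.mem_sigma, Finset.mem_range, cc_mem] at hx
    obtain ⟨⟨hm, hg, hgm⟩, h0⟩ := hx
    have e1 : reflect n (C (g.coeff 0)⁻¹ * reflect n g) = C (g.coeff 0)⁻¹ * g := by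
      rw [reflect_C_mul, reflect_reflect]
    have e2 : (C (g.coeff 0)⁻¹ * g).natDegree = m := by
      rw [natDegree_C_mul (inv_ne_zero h0), hgm]
    have e3 : (C (g.coeff 0)⁻¹ * g).leadingCoeff = (g.coeff 0)⁻¹ := by
      rw [leadingCoeff_mul, leadingCoeff_C, hg.leadingCoeff, mul_one]
    simp only [e1, e2, e3]
    congr 1
    rw [← mul_assoc, ← C_mul, inv_inv, mul_inv_cancel₀ h0, C_1, one_mul]
  · intro f hf
    have h0 := cc_coeff0 n f hf
    have hne : reflect n f ≠ 0 := by intro h; rw [h] at h0; simp at h0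
    have hl : (reflect n f).leadingCoeff ≠ 0 := leadingCoeff_ne_zero.2 hne
    simp only [coeff_C_mul, h0, mul_one, inv_inv, reflect_C_mul, reflect_reflect]
    rw [← mul_assoc, ← C_mul, mul_inv_cancel₀ hl, C_1, one_mul]
  · rintro ⟨m, g⟩ hx
    simp only [Finset.mem_filter, Finset.mem_sigma, Finset.mem_range, cc_mem] at hx
    obtain ⟨⟨hm, hg, hgm⟩, h0⟩ := hx
    have e1 : reflect n (C (g.coeff 0)⁻¹ * reflect n g) = C (g.coeff 0)⁻¹ * g := by
      rw [reflect_C_mul, reflect_reflect]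
    have e2 : reflect n g = X ^ (n - m) * reflect m g := by
      have := reflect_mul (1 : Fq[X]) g (F := n - m) (G := m) (by simp) hgm.le
      rw [one_mul, reflect_one, Nat.sub_add_cancel (by omega)] at this
      exact this
    have e3 : (reflect m g).coeff 0 ≠ 0 := by
      rw [cc_coeff0 m g ((cc_mem _ _).2 ⟨hg, hgm⟩)]; exact one_ne_zero
    have e4 : α (reflect m g) = α g := by rw [← hsymα g h0, hgm]
    simp only [e1]
    rw [hevenα _ (inv_ne_zero h0), e2, hmulα _ _ e3, e4, map_mul, map_mul,
      hχ _ (inv_ne_zero h0), one_mul, mul_assoc]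

end Helpers

/-- for `α, β` even, symmetric and weakly multiplicative and `0 ≤ h ≤ n-2`,
`Cov(N_α, N_β) = (1/q^{2(n-h-1)}) ∑_{χ ≠ χ₀ even mod t^{n-h}} ∑_{m₁=0}^{n} ∑_{m₂=0}^{n}
  α(t^{n-m₁}) conj(β(t^{n-m₂})) M(m₁; αχ) conj(M(m₂; βχ))`,
the character sum running over nontrivial even Dirichlet characters modulo `t^{n-h}`. -/
theorem covariance_character_formula (Fq : Type) [Field Fq] [Fintype Fq]
    (n h : ℕ) (hh : h + 2 ≤ n) (α β : Fq[X] → ℂ)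
    (hevenα : ∀ (c : Fq), c ≠ 0 → ∀ f : Fq[X], α (C c * f) = α f)
    (hsymα : ∀ f : Fq[X], f.coeff 0 ≠ 0 → α (Polynomial.reflect f.natDegree f) = α f)
    (hmulα : ∀ (k : ℕ) (f : Fq[X]), f.coeff 0 ≠ 0 → α ((X : Fq[X]) ^ k * f) = α (X ^ k) * α f)
    (hevenβ : ∀ (c : Fq), c ≠ 0 → ∀ f : Fq[X], β (C c * f) = β f)
    (hsymβ : ∀ f : Fq[X], f.coeff 0 ≠ 0 → β (Polynomial.reflect f.natDegree f) = β f)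
    (hmulβ : ∀ (k : ℕ) (f : Fq[X]), f.coeff 0 ≠ 0 → β ((X : Fq[X]) ^ k * f) = β (X ^ k) * β f) :
    covNshort Fq α β n h
      = (1 / (Fintype.card Fq : ℂ) ^ (2 * (n - h - 1))) *
          ∑ᶠ χ ∈ {χ : MulChar (Fq[X] ⧸ Ideal.span {(X : Fq[X]) ^ (n - h)}) ℂ |
              χ ≠ 1 ∧ ∀ c : Fq, c ≠ 0 →
                χ (Ideal.Quotient.mk (Ideal.span {(X : Fq[X]) ^ (n - h)}) (C c)) = 1},
            ∑ m₁ ∈ Finset.range (n + 1), ∑ m₂ ∈ Finset.range (n + 1),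
              α ((X : Fq[X]) ^ (n - m₁)) * (starRingEnd ℂ) (β ((X : Fq[X]) ^ (n - m₂))) *
                MsumChar (n - h) m₁ α χ * (starRingEnd ℂ) (MsumChar (n - h) m₂ β χ) := by
  classical
  obtain ⟨k, rfl⟩ : ∃ k, n = h + 1 + k := ⟨n - (h + 1), by omega⟩
  have e1 : h + 1 + k - h - 1 = k := by omega
  have e2 : h + 1 + k - h = k + 1 := by omega
  simp only [covNshort, meanNshort]
  rw [e1, e2]
  have hfin := cc_quot_finite (Fq := Fq) (k + 1)
  have hEf : (ccEven Fq (k + 1)).Finite := Set.toFinite _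
  set E := hEf.toFinset with hEdef
  have hE : ∀ χ, χ ∈ E ↔ χ ∈ ccEven Fq (k + 1) := by intro χ; simp [hEdef]
  have h1E : (1 : MulChar (Fq[X] ⧸ Ideal.span {(X : Fq[X]) ^ (k + 1)}) ℂ) ∈ E := by
    rw [hE]
    intro c hc
    rw [MulChar.one_apply]
    rw [cc_unit _ (Nat.succ_pos k)]; simpa using hc
  set a : Fq[X] → ℂ := fun B => Nshort α (X ^ (h + 1) * B) h with ha
  set b : Fq[X] → ℂ := fun B => Nshort β (X ^ (h + 1) * B) h with hb
  have hP := cc_parseval k E hE a b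
  rw [← Finset.add_sum_erase E _ h1E] at hP
  have hone : ∀ φ : Fq[X] → ℂ, ∑ B ∈ ccMon Fq k, φ B *
      (1 : MulChar (Fq[X] ⧸ Ideal.span {(X : Fq[X]) ^ (k + 1)}) ℂ)
        (Ideal.Quotient.mk _ (reflect k B)) = ∑ B ∈ ccMon Fq k, φ B := by
    intro φ
    refine Finset.sum_congr rfl fun B hB => ?_
    rw [MulChar.one_apply, mul_one]
    rw [cc_unit _ (Nat.succ_pos k), cc_coeff0 k B hB]; exact one_ne_zero
  rw [hone, hone] at hP
  have hR : ∑ᶠ χ ∈ {χ : MulChar (Fq[X] ⧸ Ideal.span {(X : Fq[X]) ^ (k + 1)}) ℂ |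
              χ ≠ 1 ∧ ∀ c : Fq, c ≠ 0 →
                χ (Ideal.Quotient.mk (Ideal.span {(X : Fq[X]) ^ (k + 1)}) (C c)) = 1},
            ∑ m₁ ∈ Finset.range (h + 1 + k + 1), ∑ m₂ ∈ Finset.range (h + 1 + k + 1),
              α ((X : Fq[X]) ^ (h + 1 + k - m₁)) *
                (starRingEnd ℂ) (β ((X : Fq[X]) ^ (h + 1 + k - m₂))) *
                MsumChar (k + 1) m₁ α χ * (starRingEnd ℂ) (MsumChar (k + 1) m₂ β χ)
      = ∑ χ ∈ E.erase 1, (∑ B ∈ ccMon Fq k, a B * χ (Ideal.Quotient.mk _ (reflect k B))) *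
      (starRingEnd ℂ) (∑ B ∈ ccMon Fq k, b B * χ (Ideal.Quotient.mk _ (reflect k B))) := by
    rw [finsum_mem_eq_finite_toFinset_sum _ (Set.toFinite _)]
    have hs : (Set.toFinite {χ : MulChar (Fq[X] ⧸ Ideal.span {(X : Fq[X]) ^ (k + 1)}) ℂ |
              χ ≠ 1 ∧ ∀ c : Fq, c ≠ 0 →
                χ (Ideal.Quotient.mk (Ideal.span {(X : Fq[X]) ^ (k + 1)}) (C c)) = 1}).toFinset
        = E.erase 1 := by
      ext χ
      rw [Set.Finite.mem_toFinset, Finset.mem_erase, hE]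
      rfl
    rw [hs]
    refine Finset.sum_congr rfl fun χ hχ => ?_
    have hχe := (hE χ).1 (Finset.mem_of_mem_erase hχ)
    simp only [ha, hb]
    rw [cc_sum_short, cc_sum_short, ← cc_msum k _ α hevenα hsymα hmulα χ hχe,
      ← cc_msum k _ β hevenβ hsymβ hmulβ χ hχe, map_sum, Finset.sum_mul_sum]
    refine Finset.sum_congr rfl fun m₁ _ => Finset.sum_congr rfl fun m₂ _ => ?_
    rw [map_mul]; ring
  rw [hR, cc_finsum, cc_finsum, cc_finsum]
  have hQ : ((Fintype.card Fq : ℂ) ^ k) ≠ 0 := by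
    apply pow_ne_zero
    simp only [ne_eq, Nat.cast_eq_zero]
    exact Fintype.card_ne_zero
  have hcard : ((ccMon Fq k).card : ℂ) = (Fintype.card Fq : ℂ) ^ k := by
    rw [cc_card]; push_cast; rfl
  have hpow : (Fintype.card Fq : ℂ) ^ (2 * k)
      = (Fintype.card Fq : ℂ) ^ k * (Fintype.card Fq : ℂ) ^ k := by ring
  rw [hpow, eq_sub_of_add_eq' hP]
  have hconjQ : (starRingEnd ℂ) ((Fintype.card Fq : ℂ) ^ k) = (Fintype.card Fq : ℂ) ^ k := by
    simp
  set Q : ℂ := (Fintype.card Fq : ℂ) ^ k with hQdef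
  have hcov : ∀ x y : ℂ, ∑ B ∈ ccMon Fq k, (a B - x) * (starRingEnd ℂ) (b B - y)
      = ∑ B ∈ ccMon Fq k, a B * (starRingEnd ℂ) (b B)
        - (∑ B ∈ ccMon Fq k, a B) * (starRingEnd ℂ) y
        - x * (starRingEnd ℂ) (∑ B ∈ ccMon Fq k, b B) + Q * (x * (starRingEnd ℂ) y) := by
    intro x y
    rw [map_sum, Finset.sum_mul, Finset.mul_sum, ← hcard, ← nsmul_eq_mul, ← Finset.sum_const,
      ← Finset.sum_sub_distrib, ← Finset.sum_sub_distrib, ← Finset.sum_add_distrib]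
    refine Finset.sum_congr rfl fun B _ => ?_
    rw [map_sub]; ring
  change 1 / Q * ∑ B ∈ ccMon Fq k, (a B - 1 / Q * ∑ B ∈ ccMon Fq k, a B) *
    (starRingEnd ℂ) (b B - 1 / Q * ∑ B ∈ ccMon Fq k, b B) = _
  rw [hcov]
  simp only [map_mul, map_div₀, map_one, hconjQ]
  field_simp
  ring
end
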